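/- Let M = g⁻¹(0) be a nonempty compact hypersurface in ℝ⁴ contained in the open unit ball B⁴ = {x ∈ ℝ⁴ : |x| < 1} (g : ℝ⁴ → ℝ smooth with dg_x ≠ 0 for all x ∈ M), and let Y be a Liouville vector field for ω_st defined on an open set U ⊆ ℝ⁴ containing M and transverse to M. Then the induced contact form α = (ι_Y ω_st)|TM has a closed Reeb orbit of period T with 0 < T ≤ π: there exist such a T and a nonconstant smooth map γ : ℝ → ℝ⁴ with image in M such that for all t ∈ ℝ one has γ(t + T) = γ(t), γ′(t) ∈ ker(dg_{γ(t)}), ω_st(γ′(t), v) = 0 for all v ∈ ker(dg_{γ(t)}), and ω_st(Y(γ(t)), γ′(t)) = 1. -/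

import Mathlib

noncomputable section

open scoped ContDiff
open Real

/-- ℝ⁴ with the Euclidean inner product. -/
abbrev R4 : Type := EuclideanSpace ℝ (Fin 4)

/-- The standard symplectic form ω_st = dx₁∧dy₁ + dx₂∧dy₂ on ℝ⁴. -/
def omegaSt (u v : R4) : ℝ := u 0 * v 1 - u 1 * v 0 + u 2 * v 3 - u 3 * v 2

section Brouwer

set_option linter.unusedSectionVars false

variable {V : Type*} [NormedAddCommGroup V] [InnerProductSpace ℝ V] [FiniteDimensional ℝ V]

open MeasureTheory Module

/-- The determinant of `1 + A` is a fixed affine combination of determinants `det (1 + tᵢ A)` for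
arbitrary distinct nodes `tᵢ`. -/
lemma exists_affineCombination_det (t : Fin (finrank ℝ V + 1) → ℝ) (ht : Function.Injective t) :
    ∃ c : Fin (finrank ℝ V + 1) → ℝ, ∑ i, c i = 1 ∧ ∀ A : V →L[ℝ] V,
      (ContinuousLinearMap.id ℝ V + A).det
        = ∑ i, c i * (ContinuousLinearMap.id ℝ V + t i • A).det := by
  classical
  refine ⟨fun i => (Lagrange.basis Finset.univ t i).eval 1, ?_, fun A => ?_⟩
  · rw [← Polynomial.eval_finsetSum, Lagrange.sum_basis ht.injOn Finset.univ_nonempty,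
      Polynomial.eval_one]
  · let b := finBasis ℝ V
    let a := LinearMap.toMatrix b b (A : V →ₗ[ℝ] V)
    let P : Polynomial ℝ :=
      ((Polynomial.X : Polynomial ℝ) • a.map (Polynomial.C : ℝ →+* Polynomial ℝ) +
        (1 : Matrix (Fin (finrank ℝ V)) (Fin (finrank ℝ V)) ℝ).map
          (Polynomial.C : ℝ →+* Polynomial ℝ)).det
    have hP : ∀ s : ℝ, P.eval s = (ContinuousLinearMap.id ℝ V + s • A).det := by
      intro s
      have h1 : (ContinuousLinearMap.id ℝ V + s • A).det
          = LinearMap.det (LinearMap.id + s • (A : V →ₗ[ℝ] V)) := rfl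
      rw [h1, ← LinearMap.det_toMatrix b, ← Polynomial.coe_evalRingHom, RingHom.map_det]
      congr 1
      ext i j
      simp [Matrix.one_apply, a, apply_ite, add_comm, LinearMap.toMatrix_apply,
        Finsupp.single_apply]
      try grind
    have hdeg : P.degree < (Finset.univ : Finset (Fin (finrank ℝ V + 1))).card := by
      have := Polynomial.natDegree_det_X_add_C_le a 1
      refine lt_of_le_of_lt Polynomial.degree_le_natDegree ?_
      rw [Finset.card_univ, Fintype.card_fin]
      rw [Fintype.card_fin] at this
      exact_mod_cast Nat.lt_succ_of_le this
    have h2 := Lagrange.eq_interpolate (s := Finset.univ) (v := t) ht.injOn hdeg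
    have h3 := congrArg (Polynomial.eval 1) h2
    rw [hP 1, Lagrange.interpolate_apply, Polynomial.eval_finsetSum, one_smul] at h3
    rw [h3]
    refine Finset.sum_congr rfl fun i _ => ?_
    rw [Polynomial.eval_mul, Polynomial.eval_C, hP, mul_comm]

lemma exists_det_pos_of_norm_lt :
    ∃ ε > 0, ∀ A : V →L[ℝ] V, ‖A‖ < ε → 0 < (ContinuousLinearMap.id ℝ V + A).det := by
  have hc : Continuous fun A : V →L[ℝ] V => (ContinuousLinearMap.id ℝ V + A).det :=
    ContinuousLinearMap.continuous_det.comp (continuous_const.add continuous_id)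
  have h0 : 0 < (ContinuousLinearMap.id ℝ V + (0 : V →L[ℝ] V)).det := by
    rw [add_zero]
    simp [ContinuousLinearMap.det]
  obtain ⟨ε, hε, h⟩ := Metric.mem_nhds_iff.1 ((isOpen_lt continuous_const hc).mem_nhds h0)
  exact ⟨ε, hε, fun A hA => h (by simpa using hA)⟩

/-- A differentiable map preserving the sphere `‖·‖ = R` pointwise, close to the identity inside,
has a bijective extension by the identity. -/
lemma image_ball_eq_of_lipschitzWith {R : ℝ} {h : V → V} {K : NNReal} (hK : K < 1)
    (hL : LipschitzWith K h) (hout : ∀ x, R ≤ ‖x‖ → h x = 0) :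
    Function.Injective (fun x => x + h x) ∧
      (fun x => x + h x) '' Metric.ball 0 R = Metric.ball 0 R := by
  have happ : ApproximatesLinearOn (fun x => x + h x)
      ((ContinuousLinearEquiv.refl ℝ V : V ≃L[ℝ] V) : V →L[ℝ] V) Set.univ K := by
    rw [ApproximatesLinearOn.approximatesLinearOn_iff_lipschitzOnWith]
    have : ((fun x => x + h x) - ⇑((ContinuousLinearEquiv.refl ℝ V : V ≃L[ℝ] V) : V →L[ℝ] V))
        = h := by
      ext x; simp
    rw [this]
    exact hL.lipschitzOnWith
  have hN : Subsingleton V ∨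
      K < ‖((ContinuousLinearEquiv.refl ℝ V).symm : V →L[ℝ] V)‖₊⁻¹ := by
    rcases subsingleton_or_nontrivial V with hV | hV
    · exact Or.inl hV
    · right
      have : ‖((ContinuousLinearEquiv.refl ℝ V).symm : V →L[ℝ] V)‖₊ = 1 := by
        ext
        exact ContinuousLinearMap.norm_id
      rw [this]; simpa using hK
  have hinj : Function.Injective (fun x => x + h x) := by
    have := happ.injective hN
    rwa [← Set.injOn_iff_injective, Set.injOn_univ] at this
  have hsurj := happ.surjective hN
  refine ⟨hinj, Set.Subset.antisymm ?_ ?_⟩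
  · rintro _ ⟨x, hx, rfl⟩
    by_contra hcon
    simp only [Metric.mem_ball, dist_zero_right, not_lt] at hcon hx
    have h1 : x + h x + h (x + h x) = x + h x := by rw [hout _ hcon, add_zero]
    have h2 : x + h x = x := hinj (by simpa using h1)
    rw [h2] at hcon
    exact absurd hx (not_lt.2 hcon)
  · intro y hy
    obtain ⟨x, rfl⟩ := hsurj y
    refine ⟨x, ?_, rfl⟩
    by_contra hcon
    simp only [Metric.mem_ball, dist_zero_right, not_lt] at hcon hy
    rw [hout _ hcon, add_zero] at hy
    exact absurd hy (not_lt.2 hcon)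

lemma lipschitzWith_indicator_ball {R : ℝ} (hR : 0 < R) {h : V → V} {K : NNReal}
    (hL : LipschitzOnWith K h (Metric.closedBall 0 R)) (hS : ∀ x, ‖x‖ = R → h x = 0) :
    LipschitzWith K ((Metric.ball (0 : V) R).indicator h) := by
  classical
  have key : ∀ x y : V, ‖x‖ < R → R ≤ ‖y‖ → ‖h x‖ ≤ K * ‖x - y‖ := by
    intro x y hx hy
    have hyx : R - ‖x‖ ≤ ‖x - y‖ := by
      have := norm_sub_norm_le y x
      rw [norm_sub_rev] at this
      linarith
    suffices h' : ‖h x‖ ≤ K * (R - ‖x‖) from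
      h'.trans (mul_le_mul_of_nonneg_left hyx K.2)
    have : ∃ z : V, ‖z‖ = R ∧ ‖x - z‖ = R - ‖x‖ := by
      by_cases hx0 : x = 0
      · subst hx0
        have hy0 : ‖y‖ ≠ 0 := by linarith [hR] |> fun h : 0 < ‖y‖ => h.ne'
        refine ⟨(R / ‖y‖) • y, ?_, ?_⟩ <;>
        simp [norm_smul, abs_of_pos hR, hy0]
      · have hx0' : ‖x‖ ≠ 0 := norm_ne_zero_iff.2 hx0
        have hpos : 0 < ‖x‖ := norm_pos_iff.2 hx0
        refine ⟨(R / ‖x‖) • x, ?_, ?_⟩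
        · simp [norm_smul, abs_of_pos hR, hx0]
        · have h1 : x - (R / ‖x‖) • x = (-((R - ‖x‖) / ‖x‖)) • x := by
            rw [sub_eq_iff_eq_add, ← add_smul]
            have : -((R - ‖x‖) / ‖x‖) + R / ‖x‖ = 1 := by field_simp; ring
            rw [this, one_smul]
          rw [h1, norm_smul, norm_neg, norm_div, norm_norm, Real.norm_eq_abs,
            abs_of_pos (by linarith)]
          field_simp
    obtain ⟨z, hz, hxz⟩ := this
    have := hL.dist_le_mul x (by simpa using hx.le) z (by simp [hz])
    rwa [hS z hz, dist_zero_right, dist_eq_norm, hxz] at this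
  refine LipschitzWith.of_dist_le_mul fun x y => ?_
  by_cases hx : x ∈ Metric.ball (0 : V) R <;> by_cases hy : y ∈ Metric.ball (0 : V) R
  · rw [Set.indicator_of_mem hx, Set.indicator_of_mem hy]
    exact hL.dist_le_mul x (Metric.ball_subset_closedBall hx) y (Metric.ball_subset_closedBall hy)
  · rw [Set.indicator_of_mem hx, Set.indicator_of_notMem hy, dist_zero_right, dist_eq_norm]
    exact key x y (by simpa using hx) (by simpa using hy)
  · rw [Set.indicator_of_notMem hx, Set.indicator_of_mem hy, dist_comm, dist_zero_right,
      dist_comm, dist_eq_norm]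
    exact key y x (by simpa using hy) (by simpa using hx)
  · rw [Set.indicator_of_notMem hx, Set.indicator_of_notMem hy, dist_self]
    positivity

lemma det_eq_zero_of_inner_eq_zero {A : V →L[ℝ] V} {w : V} (hw : w ≠ 0)
    (h : ∀ v, inner ℝ w (A v) = 0) : A.det = 0 := by
  by_contra hne
  have hunit : IsUnit (A : V →ₗ[ℝ] V) := by
    rw [LinearMap.isUnit_iff_isUnit_det]
    exact isUnit_iff_ne_zero.2 hne
  rw [LinearMap.isUnit_iff_range_eq_top] at hunit
  obtain ⟨v, hv⟩ := LinearMap.range_eq_top.1 hunit w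
  have := h v
  rw [show A v = w from hv] at this
  exact hw (inner_self_eq_zero.1 this)

/-- A `C¹` map fixing a sphere pointwise has the integral of its Jacobian over the ball equal to the
volume of the ball. -/
lemma integral_det_fderiv_eq_volume_ball [MeasurableSpace V] [BorelSpace V] {R : ℝ}
    (hR : 0 < R) {f : V → V} (hf : ContDiff ℝ 1 f)
    (hS : ∀ x, ‖x‖ = R → f x = x) :
    ∫ x in Metric.ball (0 : V) R, (fderiv ℝ f x).det
      = (volume (Metric.ball (0 : V) R)).toReal := by
  classical
  set h : V → V := fun x => f x - x with hh
  have hhd : ContDiff ℝ 1 h := hf.sub contDiff_id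
  have hfd : ∀ x, fderiv ℝ f x = ContinuousLinearMap.id ℝ V + fderiv ℝ h x := by
    intro x
    have h1 : HasFDerivAt h (fderiv ℝ f x - ContinuousLinearMap.id ℝ V) x :=
      (hf.differentiable one_ne_zero x).hasFDerivAt.sub (hasFDerivAt_id x)
    rw [h1.fderiv]
    abel
  have hcont : Continuous (fderiv ℝ h) := hhd.continuous_fderiv one_ne_zero
  obtain ⟨C, hC⟩ := (isCompact_closedBall (0 : V) R).exists_bound_of_continuousOn hcont.continuousOn
  set K : NNReal := Real.toNNReal C with hK
  have hbd : ∀ x ∈ Metric.closedBall (0 : V) R, ‖fderiv ℝ h x‖ ≤ K := fun x hx =>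
    (hC x hx).trans (Real.le_coe_toNNReal C)
  have hLip : LipschitzOnWith K h (Metric.closedBall 0 R) :=
    Convex.lipschitzOnWith_of_nnnorm_fderiv_le
      (fun x _ => hhd.differentiable one_ne_zero x) hbd (convex_closedBall 0 R)
  have hLip' := lipschitzWith_indicator_ball hR hLip (fun x hx => by simp [hh, hS x hx])
  obtain ⟨ε, hε, hdet⟩ := exists_det_pos_of_norm_lt (V := V)
  obtain ⟨τ, hτ, hτ1, hτ2⟩ : ∃ τ : ℝ, 0 < τ ∧ τ * K < 1 ∧ τ * K < ε := by
    refine ⟨min 1 ε / (K + 1) / 2, by positivity, ?_, ?_⟩ <;>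
    · have hK0 : (0 : ℝ) ≤ K := K.2
      have h1 : min 1 ε / (K + 1) / 2 * K ≤ min 1 ε / 2 := by
        rw [div_mul_eq_mul_div, div_mul_eq_mul_div]
        have : min 1 ε * ↑K / (↑K + 1) ≤ min 1 ε := by
          rw [div_le_iff₀ (by positivity)]
          have : 0 < min 1 ε := by positivity
          nlinarith
        linarith
      have h2 : 0 < min 1 ε := by positivity
      have h3 := min_le_left 1 ε
      have h4 := min_le_right 1 ε
      linarith
  have hvol : ∀ t : ℝ, 0 < t → t ≤ τ → ∫ x in Metric.ball (0 : V) R,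
      (ContinuousLinearMap.id ℝ V + t • fderiv ℝ h x).det
        = (volume (Metric.ball (0 : V) R)).toReal := by
    intro t ht htτ
    have htK : t * K ≤ τ * K := mul_le_mul_of_nonneg_right htτ K.2
    set ht' : V → V := fun x => t • (Metric.ball (0 : V) R).indicator h x with hht'
    have hL2 : LipschitzWith (Real.toNNReal t * K) ht' := by
      refine LipschitzWith.of_dist_le_mul fun x y => ?_
      simp only [hht', dist_smul₀]
      rw [NNReal.coe_mul, Real.coe_toNNReal _ ht.le, Real.norm_of_nonneg ht.le, mul_assoc]
      exact mul_le_mul_of_nonneg_left (hLip'.dist_le_mul x y) ht.le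
    have hlt : Real.toNNReal t * K < 1 := by
      rw [← NNReal.coe_lt_coe, NNReal.coe_mul, Real.coe_toNNReal _ ht.le]
      simpa using htK.trans_lt hτ1
    obtain ⟨hinj, himg⟩ := image_ball_eq_of_lipschitzWith (R := R) hlt hL2 (fun x hx => by
      simp [hht', Set.indicator_of_notMem, hx])
    have hder : ∀ x ∈ Metric.ball (0 : V) R, HasFDerivWithinAt (fun x => x + ht' x)
        (ContinuousLinearMap.id ℝ V + t • fderiv ℝ h x) (Metric.ball 0 R) x := by
      intro x hx
      have h1 : HasFDerivAt (fun x => x + t • h x)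
        (ContinuousLinearMap.id ℝ V + t • fderiv ℝ h x) x :=
        (hasFDerivAt_id x).add
          (((hhd.differentiable one_ne_zero x).hasFDerivAt).const_smul t)
      refine h1.hasFDerivWithinAt.congr (fun y hy => ?_) ?_
      · simp [hht', Set.indicator_of_mem hy]
      · simp [hht', Set.indicator_of_mem hx]
    have := integral_image_eq_integral_abs_det_fderiv_smul volume Metric.isOpen_ball.measurableSet
      hder hinj.injOn (fun _ => (1 : ℝ))
    rw [himg] at this
    simp only [smul_eq_mul, mul_one] at this
    rw [setIntegral_const, smul_eq_mul, mul_one] at this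
    rw [Measure.real] at this
    rw [this]
    refine setIntegral_congr_fun Metric.isOpen_ball.measurableSet fun x hx => ?_
    refine (abs_of_pos (hdet _ ?_)).symm
    rw [norm_smul, Real.norm_of_nonneg ht.le]
    calc t * ‖fderiv ℝ h x‖ ≤ t * K :=
          mul_le_mul_of_nonneg_left (hbd x (Metric.ball_subset_closedBall hx)) ht.le
      _ < ε := htK.trans_lt hτ2
  let n := finrank ℝ V
  let t : Fin (n + 1) → ℝ := fun i => τ * ((i : ℝ) + 1) / (n + 1)
  have htinj : Function.Injective t := by
    intro i j hij
    have h1 : τ * ((i : ℝ) + 1) / (n + 1) = τ * ((j : ℝ) + 1) / (n + 1) := hij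
    have h0 : (n : ℝ) + 1 ≠ 0 := by positivity
    rw [div_left_inj' h0] at h1
    have h2 := mul_left_cancel₀ hτ.ne' h1
    exact Fin.ext (by exact_mod_cast add_right_cancel h2)
  have htpos : ∀ i, 0 < t i ∧ t i ≤ τ := by
    intro i
    refine ⟨by positivity, ?_⟩
    change τ * ((i : ℝ) + 1) / (n + 1) ≤ τ
    rw [div_le_iff₀ (by positivity)]
    have : ((i : ℕ) : ℝ) + 1 ≤ n + 1 := by exact_mod_cast i.2
    exact mul_le_mul_of_nonneg_left this hτ.le
  obtain ⟨c, hc1, hc⟩ := exists_affineCombination_det t htinj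
  have h_int : ∀ i, IntegrableOn
      (fun x => c i * (ContinuousLinearMap.id ℝ V + t i • fderiv ℝ h x).det)
      (Metric.ball (0 : V) R) := by
    intro i
    have hco : Continuous fun x =>
        c i * (ContinuousLinearMap.id ℝ V + t i • fderiv ℝ h x).det :=
      continuous_const.mul (ContinuousLinearMap.continuous_det.comp
        (continuous_const.add (hcont.const_smul (t i))))
    exact (hco.continuousOn.integrableOn_compact (isCompact_closedBall (0 : V) R)).mono_set
      Metric.ball_subset_closedBall
  have hsum : ∀ x, (fderiv ℝ f x).det
      = ∑ i, c i * (ContinuousLinearMap.id ℝ V + t i • fderiv ℝ h x).det := fun x => by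
    rw [hfd x, hc]
  rw [funext hsum, integral_finsetSum _ fun i _ => h_int i]
  simp_rw [integral_const_mul, hvol _ (htpos _).1 (htpos _).2]
  rw [← Finset.sum_mul, hc1, one_mul]

/-- A continuous self-map equal to the identity off a bounded set is surjective. -/
theorem exists_eq_zero_of_eq_id_off_bounded {k : V → V} (hk : Continuous k) {R : ℝ}
    (hR : 0 < R) (hid : ∀ x, R ≤ ‖x‖ → k x = x) : ∃ x, k x = 0 := by
  by_contra! hne
  borelize V
  obtain ⟨ε, hε, hεk⟩ : ∃ ε > 0, ∀ x, ε ≤ ‖k x‖ := by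
    obtain ⟨x0, hx0, hmin⟩ := (isCompact_closedBall (0 : V) R).exists_isMinOn
      ⟨0, Metric.mem_closedBall_self hR.le⟩ hk.norm.continuousOn
    refine ⟨min R ‖k x0‖, lt_min hR (norm_pos_iff.2 (hne x0)), fun x => ?_⟩
    rcases le_total R ‖x‖ with hx | hx
    · rw [hid x hx]; exact (min_le_left _ _).trans hx
    · exact (min_le_right _ _).trans (hmin (mem_closedBall_zero_iff.2 hx))
  have hSc : IsClosed {x : V | R + 1 ≤ ‖x‖} := isClosed_le continuous_const continuous_norm
  have hU : {x : V | R < ‖x‖} ∈ nhdsSet {x : V | R + 1 ≤ ‖x‖} := by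
    refine (isOpen_lt continuous_const continuous_norm).mem_nhdsSet.2 fun x hx => ?_
    have : R + 1 ≤ ‖x‖ := hx
    change R < ‖x‖
    linarith
  obtain ⟨q, hq, hqε, hqid, -⟩ := hk.exists_contDiff_approx_and_eqOn 1 continuous_const
    (ε := fun _ => ε) (fun _ => hε) hSc hU
    (contDiffOn_id.congr fun x hx => hid x (le_of_lt hx))
  have hq0 : ∀ x, q x ≠ 0 := by
    intro x h0
    have := hqε x
    rw [h0, dist_zero_left] at this
    exact absurd (hεk x) (not_le.2 this)
  have hR1 : 0 < R + 1 := by linarith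
  let f : V → V := fun x => ((R + 1) / ‖q x‖) • q x
  have hf : ContDiff ℝ 1 f :=
    (contDiff_const.div (hq.norm ℝ hq0) fun x => norm_ne_zero_iff.2 (hq0 x)).smul hq
  have hfn : ∀ x, ‖f x‖ = R + 1 := by
    intro x
    simp only [f, norm_smul, norm_div, norm_norm]
    rw [div_mul_cancel₀ _ (norm_ne_zero_iff.2 (hq0 x)), Real.norm_of_nonneg hR1.le]
  have hfS : ∀ x, ‖x‖ = R + 1 → f x = x := by
    intro x hx
    have : q x = x := (hqid (show R + 1 ≤ ‖x‖ from hx.ge)).trans (hid x (by linarith))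
    simp only [f, this, hx]
    rw [div_self hR1.ne', one_smul]
  have h1 := integral_det_fderiv_eq_volume_ball hR1 hf hfS
  have h2 : ∀ x, (fderiv ℝ f x).det = 0 := by
    intro x
    refine det_eq_zero_of_inner_eq_zero (w := f x) ?_ fun v => ?_
    · rw [← norm_pos_iff, hfn]; exact hR1
    · have hd := ((hf.differentiable one_ne_zero x).hasFDerivAt).norm_sq
      have hc : HasFDerivAt (fun x => ‖f x‖ ^ 2) (0 : V →L[ℝ] ℝ) x := by
        simp_rw [hfn]
        exact hasFDerivAt_const _ _
      have := congrArg (fun L : V →L[ℝ] ℝ => L v) (hd.unique hc)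
      simpa using this
  simp_rw [h2, integral_zero] at h1
  have hpos : 0 < volume (Metric.ball (0 : V) (R + 1)) :=
    Metric.isOpen_ball.measure_pos _ ⟨0, by simp [hR1]⟩
  have hfin : volume (Metric.ball (0 : V) (R + 1)) ≠ ⊤ := measure_ball_lt_top.ne
  exact (ENNReal.toReal_pos hpos.ne' hfin).ne h1

end Brouwer

section Linking

variable {V : Type*} [NormedAddCommGroup V] [InnerProductSpace ℝ V] [FiniteDimensional ℝ V]
variable {F : Type*} [NormedAddCommGroup F] [InnerProductSpace ℝ F] [FiniteDimensional ℝ F]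

/-- A continuous map on a compact set that fixes the frontier pointwise hits every point of the
set. -/
lemma exists_eq_of_eq_id_on_frontier {D : Set V} (hD : IsCompact D) {k : V → V}
    (hk : ContinuousOn k D) (hfr : ∀ v ∈ frontier D, k v = v) {p : V} (hp : p ∈ D) :
    ∃ v ∈ D, k v = p := by
  classical
  have hcont : Continuous (D.piecewise k id) :=
    continuous_piecewise hfr (by rwa [hD.isClosed.closure_eq]) continuousOn_id
  obtain ⟨r, hr⟩ := hD.isBounded.exists_norm_le
  obtain ⟨x, hx⟩ := exists_eq_zero_of_eq_id_off_bounded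
    (k := fun x => D.piecewise k id (x + p) - p) (R := |r| + ‖p‖ + 1)
    ((hcont.comp (continuous_id.add continuous_const)).sub continuous_const) (by positivity)
    (fun x hx => by
      have : x + p ∉ D := by
        intro hmem
        have h1 := hr _ hmem
        have h2 := norm_sub_le (x + p) p
        rw [add_sub_cancel_right] at h2
        have h3 := le_abs_self r
        linarith
      rw [Set.piecewise_eq_of_notMem _ _ _ this, id, add_sub_cancel_right])
  rw [sub_eq_zero] at hx
  by_cases hmem : x + p ∈ D
  · rw [Set.piecewise_eq_of_mem _ _ _ hmem] at hx
    exact ⟨_, hmem, hx⟩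
  · rw [Set.piecewise_eq_of_notMem _ _ _ hmem, id] at hx
    exact (hmem (by rw [hx]; exact hp)).elim

/-- One explicit step of gradient descent lowers the function by a definite amount. -/
lemma gradient_step_le {Φ : F → ℝ} {Φ' : F → F} (hΦ : ∀ z, HasGradientAt Φ (Φ' z) z)
    {δ τ c : ℝ} (hδ : 0 < δ) (hτ : 0 ≤ τ) (hc : c = δ ^ 2 / (1 + δ) / 2)
    (hosc : ∀ z w, ‖w - z‖ ≤ τ → ‖Φ' w - Φ' z‖ ≤ c) {z : F} (hz : δ ≤ ‖Φ' z‖) {θ : ℝ}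
    (hθ0 : 0 ≤ θ) (hθ1 : θ ≤ 1) :
    Φ (z - (τ * θ / (1 + ‖Φ' z‖)) • Φ' z) ≤ Φ z - τ * θ * c := by
  set N := ‖Φ' z‖ with hN
  have hNpos : 0 < N := hδ.trans_le hz
  set w := z - (τ * θ / (1 + N)) • Φ' z with hw
  have hwz : ‖w - z‖ = τ * θ * (N / (1 + N)) := by
    rw [hw, sub_sub_cancel_left, norm_neg, norm_smul, Real.norm_of_nonneg (by positivity)]
    rw [← hN]; ring
  have hN1 : N / (1 + N) ≤ 1 := by rw [div_le_one (by positivity)]; linarith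
  have hwzle : ‖w - z‖ ≤ τ * θ := by
    rw [hwz]; exact mul_le_of_le_one_right (by positivity) hN1
  have hwzτ : ‖w - z‖ ≤ τ := hwzle.trans (mul_le_of_le_one_right hτ hθ1)
  have hmv := (convex_closedBall z τ).norm_image_sub_le_of_norm_hasFDerivWithin_le'
    (f := Φ) (f' := fun y => InnerProductSpace.toDual ℝ F (Φ' y))
    (φ := InnerProductSpace.toDual ℝ F (Φ' z)) (C := c) (x := z) (y := w)
    (fun y _ => (hΦ y).hasFDerivAt.hasFDerivWithinAt)
    (fun y hy => by
      rw [← map_sub, LinearIsometryEquiv.norm_map]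
      exact hosc z y (by simpa [dist_eq_norm] using hy))
    (Metric.mem_closedBall_self hτ) (by simpa [dist_eq_norm] using hwzτ)
  rw [InnerProductSpace.toDual_apply_apply] at hmv
  have hin : inner ℝ (Φ' z) (w - z) = -(τ * θ * (N ^ 2 / (1 + N))) := by
    rw [hw, sub_sub_cancel_left, inner_neg_right, inner_smul_right, real_inner_self_eq_norm_sq]
    rw [← hN]; ring
  rw [hin] at hmv
  have h1 := (le_abs_self _).trans hmv
  have hc0 : 0 ≤ c := by rw [hc]; positivity
  have h2 : c * ‖w - z‖ ≤ c * (τ * θ) := mul_le_mul_of_nonneg_left hwzle hc0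
  have h3 : 2 * c ≤ N ^ 2 / (1 + N) := by
    rw [hc, mul_div_cancel₀ _ (two_ne_zero), div_le_div_iff₀ (by positivity) (by positivity)]
    have : 0 ≤ (N - δ) * (N + δ + N * δ) := mul_nonneg (by linarith) (by positivity)
    nlinarith
  have h4 : τ * θ * (2 * c) ≤ τ * θ * (N ^ 2 / (1 + N)) :=
    mul_le_mul_of_nonneg_left h3 (by positivity)
  linarith

/-- A finite-dimensional linking theorem: if `Φ ≥ β` on the fibre of `P` over `p ∈ D` and `Φ ≤ 0` on
the frontier of a section over the compact set `D`, then `Φ` has a critical point of value at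
least `β`. -/
theorem exists_critical_point_of_linking {Φ : F → ℝ} {Φ' : F → F}
    (hΦ : ∀ z, HasGradientAt Φ (Φ' z) z) (huc : UniformContinuous Φ')
    {R₀ δ₀ : ℝ} (hδ₀ : 0 < δ₀) (hcoer : ∀ z, R₀ ≤ ‖z‖ → δ₀ ≤ ‖Φ' z‖)
    {D : Set V} (hD : IsCompact D) {j : V → F} (hj : ContinuousOn j D) {P : F → V}
    (hP : Continuous P) (hPj : ∀ v ∈ D, P (j v) = v) {p : V} (hp : p ∈ D)
    {β : ℝ} (hβ : 0 < β) (hfib : ∀ z, P z = p → β ≤ Φ z)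
    (hfr : ∀ v ∈ frontier D, Φ (j v) ≤ 0) : ∃ z, Φ' z = 0 ∧ β ≤ Φ z := by
  by_contra! hno
  have hΦc : Continuous Φ := continuous_iff_continuousAt.2 fun z => (hΦ z).hasFDerivAt.continuousAt
  have hΦ'c := huc.continuous
  obtain ⟨β₁, hβ₁0, hβ₁β, δ, hδ, hδΦ⟩ : ∃ β₁, 0 < β₁ ∧ β₁ < β ∧ ∃ δ > 0, ∀ z, β₁ ≤ Φ z →
      δ ≤ ‖Φ' z‖ := by
    obtain ⟨b, hbβ, hb⟩ : ∃ b < β, ∀ z, ‖z‖ ≤ R₀ → Φ' z = 0 → Φ z < b := by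
      set Z := {z : F | Φ' z = 0} ∩ Metric.closedBall 0 R₀
      have hZ : IsCompact Z :=
        (isCompact_closedBall (0 : F) R₀).inter_left (isClosed_eq hΦ'c continuous_const)
      rcases Z.eq_empty_or_nonempty with he | hne
      · refine ⟨β - 1, by linarith, fun z hz h0 => ?_⟩
        have : z ∈ Z := ⟨h0, by simpa using hz⟩
        simp [he] at this
      · obtain ⟨z0, hz0, hmax⟩ := hZ.exists_isMaxOn hne hΦc.continuousOn
        have h1 := hno z0 hz0.1
        refine ⟨(Φ z0 + β) / 2, by linarith, fun z hz h0 => ?_⟩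
        have : Φ z ≤ Φ z0 := hmax (show z ∈ Z from ⟨h0, by simpa using hz⟩)
        linarith
    refine ⟨max b (β / 2), lt_max_of_lt_right (by linarith), max_lt hbβ (by linarith), ?_⟩
    set Z := {z : F | max b (β / 2) ≤ Φ z} ∩ Metric.closedBall 0 R₀
    have hZ : IsCompact Z :=
      (isCompact_closedBall (0 : F) R₀).inter_left (isClosed_le continuous_const hΦc)
    rcases Z.eq_empty_or_nonempty with he | hne
    · refine ⟨δ₀, hδ₀, fun z hz => hcoer z ?_⟩
      by_contra! hlt
      have : z ∈ Z := ⟨hz, by simpa using hlt.le⟩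
      simp [he] at this
    · obtain ⟨z0, hz0, hmin⟩ := hZ.exists_isMinOn hne hΦ'c.norm.continuousOn
      have h0 : 0 < ‖Φ' z0‖ := by
        rw [norm_pos_iff]
        intro h0
        have h1 := hb z0 (by simpa using hz0.2) h0
        have h2 : max b (β / 2) ≤ Φ z0 := hz0.1
        have h3 := le_max_left b (β / 2)
        linarith
      refine ⟨min δ₀ ‖Φ' z0‖, lt_min hδ₀ h0, fun z hz => ?_⟩
      rcases le_total R₀ ‖z‖ with h | h
      · exact (min_le_left _ _).trans (hcoer z h)
      · exact (min_le_right _ _).trans (hmin (show z ∈ Z from ⟨hz, by simpa using h⟩))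
  set c := δ ^ 2 / (1 + δ) / 2 with hc
  have hcpos : 0 < c := by positivity
  obtain ⟨τ, hτ, hosc⟩ : ∃ τ > 0, ∀ z w, ‖w - z‖ ≤ τ → ‖Φ' w - Φ' z‖ ≤ c := by
    obtain ⟨τ, hτ, h⟩ := Metric.uniformContinuous_iff.1 huc c hcpos
    refine ⟨τ / 2, by linarith, fun z w hzw => ?_⟩
    have := h (a := w) (b := z) (by rw [dist_eq_norm]; linarith)
    rw [dist_eq_norm] at this
    exact this.le
  set β₂ := (β₁ + β) / 2 with hβ₂
  let θ : ℝ → ℝ := fun s => max 0 (min 1 ((s - β₁) / (β₂ - β₁)))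
  have hθc : Continuous θ := by fun_prop
  have hθ0 : ∀ s, 0 ≤ θ s := fun s => le_max_left _ _
  have hθ1 : ∀ s, θ s ≤ 1 := fun s => max_le zero_le_one (min_le_left _ _)
  have hθlow : ∀ s, s ≤ β₁ → θ s = 0 := by
    intro s hs
    refine max_eq_left ((min_le_right _ _).trans ?_)
    exact div_nonpos_of_nonpos_of_nonneg (by linarith) (by linarith)
  have hθhigh : ∀ s, β₂ ≤ s → θ s = 1 := by
    intro s hs
    have : 1 ≤ (s - β₁) / (β₂ - β₁) := by
      rw [le_div_iff₀ (by linarith)]; linarith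
    change max 0 (min 1 _) = _
    rw [min_eq_left this, max_eq_right zero_le_one]
  let T : F → F := fun z => z - (τ * θ (Φ z) / (1 + ‖Φ' z‖)) • Φ' z
  have hT : Continuous T := by
    refine continuous_id.sub (Continuous.smul (Continuous.div ?_ ?_ ?_) hΦ'c)
    · exact continuous_const.mul (hθc.comp hΦc)
    · exact continuous_const.add hΦ'c.norm
    · intro z; positivity
  have hTlow : ∀ z, Φ z ≤ β₁ → T z = z := by
    intro z hz
    simp [T, hθlow _ hz]
  have hTdesc : ∀ z, Φ (T z) ≤ Φ z ∧ (β₂ ≤ Φ z → Φ (T z) ≤ Φ z - τ * c) := by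
    intro z
    rcases le_total (Φ z) β₁ with h | h
    · rw [hTlow z h]
      exact ⟨le_rfl, fun h' => by linarith⟩
    · have := gradient_step_le hΦ hδ hτ.le hc hosc (hδΦ z h) (hθ0 (Φ z)) (hθ1 (Φ z))
      refine ⟨this.trans ?_, fun h' => ?_⟩
      · have : 0 ≤ τ * θ (Φ z) * c := mul_nonneg (mul_nonneg hτ.le (hθ0 _)) hcpos.le
        linarith
      · rw [hθhigh _ h', mul_one] at this
        simpa [T, hθhigh _ h'] using this
  have hiter : ∀ (n : ℕ) z, Φ (T^[n] z) ≤ max β₂ (Φ z - n * (τ * c)) := by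
    intro n
    induction n with
    | zero => intro z; simp
    | succ n ih =>
      intro z
      rw [Function.iterate_succ_apply']
      obtain ⟨h1, h2⟩ := hTdesc (T^[n] z)
      rcases le_total (Φ (T^[n] z)) β₂ with h | h
      · exact h1.trans (h.trans (le_max_left _ _))
      · have h3 := h2 h
        rcases le_max_iff.1 (ih z) with h4 | h4
        · exact (h1.trans h4).trans (le_max_left _ _)
        · refine le_max_of_le_right ?_
          push_cast
          linarith
  obtain ⟨v1, hv1, hmax⟩ := hD.exists_isMaxOn ⟨p, hp⟩ (hΦc.comp_continuousOn hj)
  obtain ⟨n, hn⟩ := exists_nat_ge ((Φ (j v1) - β₂) / (τ * c))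
  rw [div_le_iff₀ (by positivity)] at hn
  have hlow : ∀ v ∈ D, Φ (T^[n] (j v)) ≤ β₂ := by
    intro v hv
    refine (hiter n (j v)).trans (max_le le_rfl ?_)
    have : Φ (j v) ≤ Φ (j v1) := hmax hv
    linarith
  obtain ⟨v, hv, hkv⟩ := exists_eq_of_eq_id_on_frontier hD
    (k := fun v => P (T^[n] (j v)))
    (hP.comp_continuousOn ((hT.iterate n).comp_continuousOn hj))
    (fun v hv => by
      have h1 : T (j v) = j v := hTlow _ ((hfr v hv).trans hβ₁0.le)
      have h2 : T^[n] (j v) = j v := Function.iterate_fixed h1 n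
      rw [h2, hPj v (hD.isClosed.frontier_subset hv)]) hp
  have h1 := hfib _ hkv
  have h2 := hlow v hv
  linarith

end Linking

section TrigPoly

open MeasureTheory AddCircle

/-- The complex plane `ℂ²`. -/
abbrev C2 : Type := EuclideanSpace ℂ (Fin 2)

lemma real_inner_C2 (x y : C2) : inner ℝ x y = (inner ℂ x y).re := by
  simp [PiLp.inner_apply]

/-- The coefficient space of trigonometric polynomials with frequencies in `s`. -/
abbrev TrigSpace (s : Finset ℤ) : Type :=
  PiLp 2 (fun _ : s => C2)

lemma real_inner_trigSpace {s : Finset ℤ} (x y : TrigSpace s) :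
    inner ℝ x y = (inner ℂ x y).re := by
  simp [PiLp.inner_apply]

/-- The loop with prescribed Fourier coefficients. -/
def trigPoly {s : Finset ℤ} (x : TrigSpace s) : C(UnitAddCircle, C2) where
  toFun t := ∑ k : s, fourier (k : ℤ) t • x k
  continuous_toFun := by
    refine continuous_finsetSum _ fun k _ => ?_
    exact (map_continuous (fourier (k : ℤ))).smul continuous_const

/-- The Fourier coefficients of a loop with indices in `s`. -/
def coeffs (s : Finset ℤ) (g : UnitAddCircle → C2) : TrigSpace s :=
  WithLp.toLp 2 fun k => fourierCoeff g (k : ℤ)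

lemma trigPoly_apply {s : Finset ℤ} (x : TrigSpace s) (t : UnitAddCircle) :
    trigPoly x t = ∑ k : s, fourier (k : ℤ) t • x k := rfl

lemma coeffs_apply (s : Finset ℤ) (g : UnitAddCircle → C2) (k : s) :
    coeffs s g k = fourierCoeff g (k : ℤ) := rfl

lemma trigPoly_sub {s : Finset ℤ} (x y : TrigSpace s) :
    trigPoly (x - y) = trigPoly x - trigPoly y := by
  ext t
  simp only [trigPoly_apply, ContinuousMap.sub_apply, PiLp.sub_apply, smul_sub,
    Finset.sum_sub_distrib]

lemma norm_fourier_apply (k : ℤ) (t : UnitAddCircle) : ‖fourier k t‖ = 1 := Circle.norm_coe _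

lemma norm_trigPoly_apply_le {s : Finset ℤ} (x : TrigSpace s) (t : UnitAddCircle) :
    ‖trigPoly x t‖ ≤ s.card * ‖x‖ := by
  rw [trigPoly_apply]
  refine (norm_sum_le _ _).trans ?_
  calc ∑ k : s, ‖fourier (k : ℤ) t • x k‖ ≤ ∑ _k : s, ‖x‖ := by
        refine Finset.sum_le_sum fun k _ => ?_
        rw [norm_smul, norm_fourier_apply, one_mul]
        exact PiLp.norm_apply_le x k
    _ = s.card * ‖x‖ := by simp

lemma integrable_circle {E : Type*} [NormedAddCommGroup E] {f : UnitAddCircle → E}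
    (hf : Continuous f) : Integrable f (haarAddCircle (T := 1)) :=
  hf.integrable_of_hasCompactSupport (HasCompactSupport.of_compactSpace f)

lemma integral_fourier (n : ℤ) :
    ∫ t, fourier n t ∂(haarAddCircle (T := 1)) = if n = 0 then 1 else 0 := by
  have h := orthonormal_iff_ite.1 (orthonormal_fourier (T := 1)) 0 n
  rw [ContinuousMap.inner_toLp (@haarAddCircle 1 _) (fourier 0) (fourier n)] at h
  simp only [fourier_zero, map_one, mul_one] at h
  rw [h]
  simp [eq_comm]

lemma fourierCoeff_fourier_smul (k n : ℤ) (w : C2) :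
    fourierCoeff (T := 1) (fun t => fourier k t • w) n = if n = k then w else 0 := by
  have h : ∀ t : UnitAddCircle, fourier (-n) t • fourier k t • w = fourier (k - n) t • w := by
    intro t
    rw [smul_smul, ← fourier_add, neg_add_eq_sub]
  unfold fourierCoeff
  rw [funext h, integral_smul_const, integral_fourier]
  by_cases hk : n = k
  · simp [hk]
  · have : k - n ≠ 0 := fun h => hk (sub_eq_zero.1 h).symm
    simp [hk, this]

lemma fourierCoeff_trigPoly {s : Finset ℤ} (x : TrigSpace s) (n : ℤ) :
    fourierCoeff (trigPoly x) n = if h : n ∈ s then x ⟨n, h⟩ else 0 := by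
  have h1 : (trigPoly x : UnitAddCircle → C2) = ∑ k : s, fun t => fourier (k : ℤ) t • x k := by
    ext t; simp [trigPoly_apply]
  rw [h1, fourierCoeff.sum _ (fun k : s => fun t => fourier (k : ℤ) t • x k)
    fun k _ => integrable_circle
    ((map_continuous (fourier (k : ℤ))).smul continuous_const), Finset.sum_apply]
  simp_rw [fourierCoeff_fourier_smul]
  split_ifs with h
  · rw [Finset.sum_eq_single (⟨n, h⟩ : s)]
    · simp
    · intro b _ hb
      rw [if_neg]
      rintro rfl
      exact hb rfl
    · simp
  · refine Finset.sum_eq_zero fun k _ => ?_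
    rw [if_neg]
    rintro rfl
    exact h k.2

lemma coeffs_trigPoly {s : Finset ℤ} (x : TrigSpace s) : coeffs s (trigPoly x) = x := by
  ext k
  rw [coeffs_apply, fourierCoeff_trigPoly, dif_pos k.2]

lemma integral_inner_trigPoly {s : Finset ℤ} (x : TrigSpace s) {g : UnitAddCircle → C2}
    (hg : Continuous g) :
    ∫ t, inner ℂ (trigPoly x t) (g t) ∂(haarAddCircle (T := 1)) = inner ℂ x (coeffs s g) := by
  have h1 : ∀ t, inner ℂ (trigPoly x t) (g t)
      = ∑ k : s, inner ℂ (x k) (fourier (-(k : ℤ)) t • g t) := by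
    intro t
    rw [trigPoly_apply, sum_inner]
    refine Finset.sum_congr rfl fun k _ => ?_
    rw [inner_smul_left, inner_smul_right, fourier_neg]
  have hc : ∀ k : s, Continuous fun t => fourier (-(k : ℤ)) t • g t := fun k =>
    (map_continuous (fourier (-(k : ℤ)))).smul hg
  rw [funext h1, integral_finsetSum _ fun k _ => (integrable_circle (hc k)).const_inner (x k),
    PiLp.inner_apply]
  refine Finset.sum_congr rfl fun k _ => ?_
  exact integral_inner (integrable_circle (hc k)) (x k)

lemma integral_re_inner_trigPoly {s : Finset ℤ} (x : TrigSpace s) {g : UnitAddCircle → C2}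
    (hg : Continuous g) :
    ∫ t, inner ℝ (trigPoly x t) (g t) ∂(haarAddCircle (T := 1))
      = inner ℝ x (coeffs s g) := by
  rw [real_inner_trigSpace, ← integral_inner_trigPoly x hg]
  simp_rw [real_inner_C2]
  have h_int : Integrable (fun t => inner ℂ (trigPoly x t) (g t)) (haarAddCircle (T := 1)) :=
    integrable_circle ((map_continuous (trigPoly x)).inner hg)
  exact (integral_re h_int)

lemma integral_norm_sq_trigPoly {s : Finset ℤ} (x : TrigSpace s) :
    ∫ t, ‖trigPoly x t‖ ^ 2 ∂(haarAddCircle (T := 1)) = ‖x‖ ^ 2 := by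
  have h := integral_re_inner_trigPoly x (map_continuous (trigPoly x))
  rw [coeffs_trigPoly] at h
  simp_rw [real_inner_self_eq_norm_sq] at h
  exact h

/-- Bessel's inequality for vector-valued loops. -/
lemma norm_sq_coeffs_le {s : Finset ℤ} {g : UnitAddCircle → C2} (hg : Continuous g) :
    ‖coeffs s g‖ ^ 2 ≤ ∫ t, ‖g t‖ ^ 2 ∂(haarAddCircle (T := 1)) := by
  set x := coeffs s g with hx
  have h1 := integral_re_inner_trigPoly x hg
  have h2 := integral_norm_sq_trigPoly x
  have h3 : inner ℝ x (coeffs s g) = ‖x‖ ^ 2 := real_inner_self_eq_norm_sq x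
  have hp := map_continuous (trigPoly x)
  have h4 : 0 ≤ ∫ t, ‖g t - trigPoly x t‖ ^ 2 ∂(haarAddCircle (T := 1)) :=
    integral_nonneg fun t => by positivity
  have h5 : ∀ t, ‖g t - trigPoly x t‖ ^ 2
      = ‖g t‖ ^ 2 - 2 * inner ℝ (trigPoly x t) (g t) + ‖trigPoly x t‖ ^ 2 := by
    intro t
    rw [norm_sub_sq_real, real_inner_comm]
  rw [funext h5, integral_add, integral_sub, integral_const_mul, h1, h2, h3] at h4
  · linarith
  · exact integrable_circle (hg.norm.pow 2)
  · exact integrable_circle (continuous_const.mul (hp.inner hg))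
  · exact integrable_circle ((hg.norm.pow 2).sub (continuous_const.mul (hp.inner hg)))
  · exact integrable_circle (hp.norm.pow 2)

lemma norm_coeffs_le {s : Finset ℤ} {g : UnitAddCircle → C2} (hg : Continuous g) {B : ℝ}
    (hB : ∀ t, ‖g t‖ ≤ B) : ‖coeffs s g‖ ≤ B := by
  have hB0 : 0 ≤ B := (norm_nonneg _).trans (hB 0)
  refine le_of_sq_le_sq ?_ hB0
  refine (norm_sq_coeffs_le hg).trans ?_
  calc ∫ t, ‖g t‖ ^ 2 ∂(haarAddCircle (T := 1)) ≤ ∫ _t, B ^ 2 ∂(haarAddCircle (T := 1)) :=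
        integral_mono (integrable_circle (hg.norm.pow 2)) (integrable_const _)
          fun t => pow_le_pow_left₀ (norm_nonneg _) (hB t) 2
    _ = B ^ 2 := by simp

lemma coeffs_sub {s : Finset ℤ} {g h : UnitAddCircle → C2} (hg : Continuous g)
    (hh : Continuous h) : coeffs s (fun t => g t - h t) = coeffs s g - coeffs s h := by
  refine PiLp.ext fun k => ?_
  simp only [coeffs_apply, PiLp.sub_apply, fourierCoeff, smul_sub]
  exact integral_sub ((integrable_circle hg).fourier_smul _) ((integrable_circle hh).fourier_smul _)

end TrigPoly

section Quartic

open MeasureTheory AddCircle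

/-- Coordinatewise product on `ℂ²`. -/
def hadamardMul (u v : C2) : C2 := WithLp.toLp 2 fun i => u i * v i

lemma hadamardMul_apply (u v : C2) (i : Fin 2) : hadamardMul u v i = u i * v i := rfl

lemma norm_hadamardMul_le (u v : C2) : ‖hadamardMul u v‖ ≤ ‖u‖ * ‖v‖ := by
  refine le_of_sq_le_sq ?_ (by positivity)
  rw [mul_pow, EuclideanSpace.norm_sq_eq, EuclideanSpace.norm_sq_eq, EuclideanSpace.norm_sq_eq]
  simp only [hadamardMul_apply, Fin.sum_univ_two, norm_mul, mul_pow]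
  nlinarith [mul_nonneg (sq_nonneg ‖u 0‖) (sq_nonneg ‖v 1‖),
    mul_nonneg (sq_nonneg ‖u 1‖) (sq_nonneg ‖v 0‖)]

lemma norm_pow_four_le_hadamardMul (u : C2) : ‖u‖ ^ 4 ≤ 2 * ‖hadamardMul u u‖ ^ 2 := by
  have h : ‖u‖ ^ 4 = (‖u‖ ^ 2) ^ 2 := by ring
  rw [h, EuclideanSpace.norm_sq_eq, EuclideanSpace.norm_sq_eq]
  simp only [hadamardMul_apply, Fin.sum_univ_two, norm_mul]
  nlinarith [sq_nonneg (‖u 0‖ ^ 2 - ‖u 1‖ ^ 2)]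

/-- The set of sums of two frequencies. -/
def pairSums (s : Finset ℤ) : Finset ℤ := Finset.univ.image fun p : s × s => (p.1 : ℤ) + p.2

/-- The coefficients of the coordinatewise square of a trigonometric polynomial. -/
def squareCoeffs {s : Finset ℤ} (x : TrigSpace s) : TrigSpace (pairSums s) :=
  WithLp.toLp 2 fun n => ∑ p : s × s,
    if (p.1 : ℤ) + p.2 = n then hadamardMul (x p.1) (x p.2) else 0

lemma trigPoly_squareCoeffs {s : Finset ℤ} (x : TrigSpace s) (t : UnitAddCircle) :
    trigPoly (squareCoeffs x) t = hadamardMul (trigPoly x t) (trigPoly x t) := by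
  have h1 : trigPoly (squareCoeffs x) t = ∑ p : s × s,
      fourier ((p.1 : ℤ) + p.2) t • hadamardMul (x p.1) (x p.2) := by
    rw [trigPoly_apply]
    simp only [squareCoeffs, Finset.smul_sum]
    rw [Finset.sum_comm]
    refine Finset.sum_congr rfl fun p _ => ?_
    rw [Finset.sum_eq_single
      (⟨(p.1 : ℤ) + p.2, Finset.mem_image_of_mem _ (Finset.mem_univ p)⟩ : pairSums s)]
    · simp
    · intro b _ hb
      rw [if_neg, smul_zero]
      intro h
      exact hb (Subtype.ext h.symm)
    · simp
  rw [h1]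
  ext i
  rw [hadamardMul_apply, trigPoly_apply]
  simp only [WithLp.ofLp_sum, WithLp.ofLp_smul, Finset.sum_apply, Pi.smul_apply, smul_eq_mul,
    hadamardMul_apply]
  rw [Finset.sum_mul_sum, ← Finset.univ_product_univ, Finset.sum_product]
  refine Finset.sum_congr rfl fun k _ => Finset.sum_congr rfl fun l _ => ?_
  rw [fourier_add]
  ring

/-- The square of the `H^{1/2}` seminorm, for positive frequencies. -/
def halfEnergy {s : Finset ℤ} (x : TrigSpace s) : ℝ := ∑ k : s, (k : ℝ) * ‖x k‖ ^ 2

lemma norm_squareCoeffs_apply_sq_le {s : Finset ℤ} {x : TrigSpace s}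
    (hx : ∀ k : s, (k : ℤ) ≤ 0 → x k = 0) (n : pairSums s) :
    ‖squareCoeffs x n‖ ^ 2 ≤ 2 * ∑ p : s × s,
      if (p.1 : ℤ) + p.2 = n then ((p.1 : ℝ) * ‖x p.1‖ ^ 2) * ((p.2 : ℝ) * ‖x p.2‖ ^ 2) else 0 := by
  classical
  set T : Finset (s × s) := Finset.univ.filter fun p =>
    (p.1 : ℤ) + p.2 = n ∧ 0 < (p.1 : ℤ) ∧ 0 < (p.2 : ℤ) with hT
  have hpos : ∀ p ∈ T, (0 : ℝ) < p.1 ∧ (0 : ℝ) < p.2 := by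
    intro p hp
    have := (Finset.mem_filter.1 hp).2
    exact ⟨by exact_mod_cast this.2.1, by exact_mod_cast this.2.2⟩
  have hsum : ∀ p ∈ T, (p.1 : ℝ) + p.2 = n := by
    intro p hp
    have := (Finset.mem_filter.1 hp).2
    exact_mod_cast this.1
  have hred : ∀ {E : Type} [AddCommMonoid E] (f : s × s → E),
      (∀ p : s × s, ((p.1 : ℤ) ≤ 0 ∨ (p.2 : ℤ) ≤ 0) → f p = 0) →
      (∑ p : s × s, if (p.1 : ℤ) + p.2 = n then f p else 0) = ∑ p ∈ T, f p := by
    intro E _ f hf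
    rw [hT, Finset.sum_filter]
    refine Finset.sum_congr rfl fun p _ => ?_
    by_cases h1 : (p.1 : ℤ) + p.2 = n
    · by_cases h2 : 0 < (p.1 : ℤ) ∧ 0 < (p.2 : ℤ)
      · simp [h1, h2]
      · rw [if_pos h1, if_neg (fun h => h2 h.2)]
        apply hf
        by_contra! h
        exact h2 h
    · rw [if_neg h1, if_neg (fun h => h1 h.1)]
  have hb : squareCoeffs x n = ∑ p ∈ T, hadamardMul (x p.1) (x p.2) := by
    rw [← hred]
    · rfl
    · rintro p (h | h)
      · rw [hx _ h]; ext i; simp [hadamardMul_apply]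
      · rw [hx _ h]; ext i; simp [hadamardMul_apply]
  rw [hb, hred]
  swap
  · rintro p (h | h) <;> simp [hx _ h]
  have hcard : ((T.card : ℕ) : ℝ) ≤ max (n : ℝ) 0 := by
    have hinj : Set.InjOn (fun p : s × s => (p.1 : ℤ)) (T : Set (s × s)) := by
      intro p hp q hq hpq
      have h1 := (Finset.mem_filter.1 hp).2.1
      have h2 := (Finset.mem_filter.1 hq).2.1
      simp only at hpq
      refine Prod.ext (Subtype.ext hpq) (Subtype.ext ?_)
      lia
    have hc : T.card ≤ (Finset.Icc 1 (n : ℤ)).card := by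
      refine Finset.card_le_card_of_injOn _ ?_ hinj
      intro p hp
      have := (Finset.mem_filter.1 hp).2
      simp only [Finset.coe_Icc, Set.mem_Icc]
      lia
    rw [Int.card_Icc] at hc
    have h3 : ((T.card : ℕ) : ℤ) ≤ max (n : ℤ) 0 := by lia
    exact_mod_cast h3
  have hweights : ∑ p ∈ T, 1 / ((p.1 : ℝ) * p.2) ≤ 2 := by
    rcases T.eq_empty_or_nonempty with h0 | ⟨q, hq⟩
    · rw [h0]; simp
    have hn : (0 : ℝ) < n := by
      rw [← hsum q hq]
      exact add_pos (hpos q hq).1 (hpos q hq).2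
    calc ∑ p ∈ T, 1 / ((p.1 : ℝ) * p.2) ≤ ∑ _p ∈ T, 2 / (n : ℝ) := by
          refine Finset.sum_le_sum fun p hp => ?_
          have h1 : (1 : ℝ) ≤ p.1 := by
            exact_mod_cast (Finset.mem_filter.1 hp).2.2.1
          have h2 : (1 : ℝ) ≤ p.2 := by
            exact_mod_cast (Finset.mem_filter.1 hp).2.2.2
          rw [div_le_div_iff₀ (by positivity) hn, ← hsum p hp]
          nlinarith [mul_nonneg (sub_nonneg.2 h1) (sub_nonneg.2 h2)]
      _ = T.card * (2 / (n : ℝ)) := by simp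
      _ ≤ n * (2 / (n : ℝ)) := by
          rw [max_eq_left hn.le] at hcard
          gcongr
      _ = 2 := by field_simp
  have h1 : ‖∑ p ∈ T, hadamardMul (x p.1) (x p.2)‖ ≤ ∑ p ∈ T, ‖x p.1‖ * ‖x p.2‖ :=
    (norm_sum_le _ _).trans (Finset.sum_le_sum fun p _ => norm_hadamardMul_le _ _)
  have h2 : (∑ p ∈ T, ‖x p.1‖ * ‖x p.2‖) ^ 2 ≤ (∑ p ∈ T, 1 / ((p.1 : ℝ) * p.2)) *
      ∑ p ∈ T, ((p.1 : ℝ) * ‖x p.1‖ ^ 2) * ((p.2 : ℝ) * ‖x p.2‖ ^ 2) := by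
    refine Finset.sum_sq_le_sum_mul_sum_of_sq_le_mul T ?_ ?_ ?_
    · intro p hp
      have := hpos p hp
      have h3 := this.1
      have h4 := this.2
      positivity
    · intro p hp
      have := hpos p hp
      have h3 := this.1
      have h4 := this.2
      positivity
    · intro p hp
      have := hpos p hp
      have h3 := this.1
      have h4 := this.2
      refine le_of_eq ?_
      field_simp
  have h5 : 0 ≤ ∑ p ∈ T, ((p.1 : ℝ) * ‖x p.1‖ ^ 2) * ((p.2 : ℝ) * ‖x p.2‖ ^ 2) := by
    refine Finset.sum_nonneg fun p hp => ?_
    have := hpos p hp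
    have h3 := this.1
    have h4 := this.2
    positivity
  exact ((pow_le_pow_left₀ (norm_nonneg _) h1 2).trans h2).trans
    (mul_le_mul_of_nonneg_right hweights h5)

/-- The embedding `H^{1/2} → L⁴` for loops with positive frequencies. -/
lemma integral_norm_pow_four_trigPoly_le {s : Finset ℤ} {x : TrigSpace s}
    (hx : ∀ k : s, (k : ℤ) ≤ 0 → x k = 0) :
    ∫ t, ‖trigPoly x t‖ ^ 4 ∂(haarAddCircle (T := 1)) ≤ 4 * halfEnergy x ^ 2 := by
  have hb : ‖squareCoeffs x‖ ^ 2 ≤ 2 * halfEnergy x ^ 2 := by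
    rw [PiLp.norm_sq_eq_of_L2]
    refine (Finset.sum_le_sum fun n _ => norm_squareCoeffs_apply_sq_le hx n).trans_eq ?_
    rw [← Finset.mul_sum, Finset.sum_comm]
    congr 1
    rw [halfEnergy, sq, Finset.sum_mul_sum, Fintype.sum_prod_type]
    refine Finset.sum_congr rfl fun k _ => Finset.sum_congr rfl fun l _ => ?_
    rw [Finset.sum_eq_single
      (⟨(k : ℤ) + l, Finset.mem_image_of_mem _ (Finset.mem_univ ((k, l) : s × s))⟩ : pairSums s)]
    · simp
    · intro b _ hb
      rw [if_neg]
      intro h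
      exact hb (Subtype.ext h.symm)
    · simp
  have hc := map_continuous (trigPoly x)
  have hc2 := map_continuous (trigPoly (squareCoeffs x))
  calc ∫ t, ‖trigPoly x t‖ ^ 4 ∂(haarAddCircle (T := 1))
      ≤ ∫ t, 2 * ‖trigPoly (squareCoeffs x) t‖ ^ 2 ∂(haarAddCircle (T := 1)) := by
        refine integral_mono (integrable_circle (hc.norm.pow 4))
          (integrable_circle (continuous_const.mul (hc2.norm.pow 2))) fun t => ?_
        simp only [trigPoly_squareCoeffs]
        exact norm_pow_four_le_hadamardMul _
    _ = 2 * ‖squareCoeffs x‖ ^ 2 := by rw [integral_const_mul, integral_norm_sq_trigPoly]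
    _ ≤ 4 * halfEnergy x ^ 2 := by linarith

end Quartic

section Action

open MeasureTheory AddCircle

variable {s : Finset ℤ}

/-- Diagonal multiplication of Fourier coefficients. -/
def diagMul (s : Finset ℤ) (c : ℤ → ℝ) : TrigSpace s →ₗ[ℝ] TrigSpace s where
  toFun x := WithLp.toLp 2 fun k => c k • x k
  map_add' x y := by ext k; simp [smul_add]
  map_smul' a x := by
    refine PiLp.ext fun k => ?_
    simp only [PiLp.smul_apply, RingHom.id_apply]
    rw [smul_comm]

lemma diagMul_apply (c : ℤ → ℝ) (x : TrigSpace s) (k : s) : diagMul s c x k = c k • x k := rfl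

/-- The symplectic action of a Hamiltonian restricted to trigonometric polynomials. -/
def action (s : Finset ℤ) (H : C2 → ℝ) (x : TrigSpace s) : ℝ :=
  π * halfEnergy x - ∫ t, H (trigPoly x t) ∂(haarAddCircle (T := 1))

/-- The gradient of the action. -/
def actionGrad (s : Finset ℤ) (H' : C2 → C2) (x : TrigSpace s) : TrigSpace s :=
  diagMul s (fun k => 2 * π * k) x - coeffs s fun t => H' (trigPoly x t)

lemma hasGradientAt_halfEnergy (x : TrigSpace s) :
    HasGradientAt (halfEnergy (s := s)) (diagMul s (fun k => 2 * k) x) x := by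
  rw [hasGradientAt_iff_hasFDerivAt]
  have h : ∀ k : s, HasFDerivAt (fun y : TrigSpace s => (k : ℝ) * ‖y k‖ ^ 2)
      ((k : ℝ) • ((2 • (innerSL ℝ (x k))).comp (PiLp.proj 2 (fun _ : s => C2) k))) x := by
    intro k
    have h1 : HasFDerivAt (fun y : TrigSpace s => y k)
      ((PiLp.proj 2 (fun _ : s => C2) k : TrigSpace s →L[ℝ] C2)) x :=
      (PiLp.proj (𝕜 := ℝ) 2 (fun _ : s => C2) k).hasFDerivAt
    exact (h1.norm_sq).const_mul (k : ℝ)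
  refine (HasFDerivAt.fun_sum fun k _ => h k).congr_fderiv ?_
  ext y
  rw [InnerProductSpace.toDual_apply_apply, PiLp.inner_apply, sum_apply]
  refine Finset.sum_congr rfl fun k _ => ?_
  rw [diagMul_apply, real_inner_smul_left]
  change (k : ℝ) * ((2 : ℕ) • inner ℝ (x k) (y k)) = _
  rw [nsmul_eq_mul]
  push_cast
  ring

lemma abs_sub_sub_inner_le {H : C2 → ℝ} {H' : C2 → C2} (hH : ∀ z, HasGradientAt H (H' z) z)
    {ε δ : ℝ} (h : ∀ z w, dist z w < δ → dist (H' z) (H' w) < ε) (z v : C2) (hv : ‖v‖ < δ) :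
    |H (z + v) - H z - inner ℝ (H' z) v| ≤ ε * ‖v‖ := by
  have hb : ∀ y ∈ Metric.ball z δ, ‖InnerProductSpace.toDual ℝ C2 (H' y)
      - InnerProductSpace.toDual ℝ C2 (H' z)‖ ≤ ε := by
    intro y hy
    rw [← map_sub, LinearIsometryEquiv.norm_map, ← dist_eq_norm]
    exact (h y z hy).le
  have hδ : 0 < δ := (norm_nonneg v).trans_lt hv
  have := (convex_ball z δ).norm_image_sub_le_of_norm_hasFDerivWithin_le'
    (f := H) (f' := fun y => InnerProductSpace.toDual ℝ C2 (H' y))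
    (φ := InnerProductSpace.toDual ℝ C2 (H' z)) (C := ε)
    (fun y _ => (hH y).hasFDerivAt.hasFDerivWithinAt) hb
    (Metric.mem_ball_self hδ) (y := z + v) (by simpa [Metric.mem_ball, dist_eq_norm] using hv)
  simpa using this

lemma hasGradientAt_integral_trigPoly {H : C2 → ℝ} {H' : C2 → C2}
    (hH : ∀ z, HasGradientAt H (H' z) z) (huc : UniformContinuous H') (x : TrigSpace s) :
    HasGradientAt (fun y : TrigSpace s => ∫ t, H (trigPoly y t) ∂(haarAddCircle (T := 1)))
      (coeffs s fun t => H' (trigPoly x t)) x := by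
  rw [hasGradientAt_iff_isLittleO, Asymptotics.isLittleO_iff]
  intro c hc
  have hHc : Continuous H := continuous_iff_continuousAt.2 fun z => (hH z).hasFDerivAt.continuousAt
  have hH'c := huc.continuous
  set m : ℝ := s.card + 1 with hm
  have hm0 : 0 < m := by positivity
  obtain ⟨δ, hδ, huc⟩ := Metric.uniformContinuous_iff.1 huc (c / m) (by positivity)
  filter_upwards [Metric.ball_mem_nhds x (show 0 < δ / m by positivity)] with y hy
  have hle : ∀ t, ‖trigPoly (y - x) t‖ ≤ m * ‖y - x‖ := fun t =>
    (norm_trigPoly_apply_le _ t).trans (by gcongr; rw [hm]; linarith)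
  have hcx := map_continuous (trigPoly x)
  have hcy := map_continuous (trigPoly y)
  have hcd := map_continuous (trigPoly (y - x))
  have hcH : Continuous fun t => H' (trigPoly x t) := hH'c.comp hcx
  have hix : Continuous fun t => H (trigPoly x t) := hHc.comp hcx
  have hiy : Continuous fun t => H (trigPoly y t) := hHc.comp hcy
  rw [real_inner_comm, ← integral_re_inner_trigPoly _ hcH,
    ← integral_sub (integrable_circle hiy) (integrable_circle hix),
    ← integral_sub (integrable_circle (hiy.fun_sub hix)) (integrable_circle (hcd.inner hcH))]
  refine (norm_integral_le_of_norm_le_const (C := c * ‖y - x‖)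
    (Filter.Eventually.of_forall fun t => ?_)).trans
    (by simp)
  rw [Metric.mem_ball, dist_eq_norm, lt_div_iff₀ hm0] at hy
  have h1 := abs_sub_sub_inner_le hH (fun z w => huc (a := z) (b := w))
    (trigPoly x t) (trigPoly (y - x) t)
    ((hle t).trans_lt (by linarith))
  have h2 : trigPoly x t + trigPoly (y - x) t = trigPoly y t := by
    rw [trigPoly_sub]; simp
  rw [h2, real_inner_comm] at h1
  rw [Real.norm_eq_abs]
  refine h1.trans ?_
  calc c / m * ‖trigPoly (y - x) t‖ ≤ c / m * (m * ‖y - x‖) := by gcongr; exact hle t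
    _ = c * ‖y - x‖ := by field_simp

lemma hasGradientAt_action {H : C2 → ℝ} {H' : C2 → C2}
    (hH : ∀ z, HasGradientAt H (H' z) z) (huc : UniformContinuous H') (x : TrigSpace s) :
    HasGradientAt (action s H) (actionGrad s H' x) x := by
  have h1 := (hasGradientAt_halfEnergy x).hasFDerivAt.const_mul π
  have h2 := (hasGradientAt_integral_trigPoly hH huc x).hasFDerivAt
  rw [hasGradientAt_iff_hasFDerivAt]
  refine (h1.sub h2).congr_fderiv ?_
  rw [actionGrad, map_sub]
  congr 1
  rw [← map_smul]
  congr 1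
  refine PiLp.ext fun k => ?_
  rw [PiLp.smul_apply, diagMul_apply, diagMul_apply, smul_smul]
  congr 1
  ring

lemma actionGrad_eq {H' r : C2 → C2} {A : ℝ} (hr : Continuous r)
    (hH' : ∀ z, H' z = (2 * A) • z + r z) (x : TrigSpace s) :
    actionGrad s H' x = diagMul s (fun k => 2 * π * k - 2 * A) x
      - coeffs s fun t => r (trigPoly x t) := by
  have hc := map_continuous (trigPoly x)
  have h1 : (fun t => r (trigPoly x t)) = fun t => H' (trigPoly x t) - (2 * A) • trigPoly x t := by
    ext1 t; rw [hH']; simp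
  have hcH : Continuous fun t => H' (trigPoly x t) := by
    simp only [hH']
    exact (hc.fun_const_smul (2 * A)).fun_add (hr.comp hc)
  have hcA : Continuous fun t => (2 * A) • trigPoly x t := hc.fun_const_smul (2 * A)
  rw [h1, coeffs_sub hcH hcA, actionGrad]
  refine PiLp.ext fun k => ?_
  have h2 : coeffs s (fun t => (2 * A) • trigPoly x t) k = (2 * A) • x k := by
    have h3 := congrArg (fun y : TrigSpace s => y k) (coeffs_trigPoly x)
    simp only [coeffs_apply] at h3 ⊢
    rw [← h3]
    simp only [fourierCoeff]
    rw [← integral_smul]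
    congr 1
    ext1 t
    rw [smul_comm]
  simp only [PiLp.sub_apply, diagMul_apply, h2, sub_smul]
  abel

lemma le_norm_diagMul {c : ℤ → ℝ} {q : ℝ} (hq : 0 ≤ q) (hc : ∀ k, q ≤ |c k|) (x : TrigSpace s) :
    q * ‖x‖ ≤ ‖diagMul s c x‖ := by
  refine le_of_sq_le_sq ?_ (norm_nonneg _)
  rw [mul_pow, PiLp.norm_sq_eq_of_L2, PiLp.norm_sq_eq_of_L2, Finset.mul_sum]
  refine Finset.sum_le_sum fun k _ => ?_
  rw [diagMul_apply, norm_smul, mul_pow, Real.norm_eq_abs]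
  gcongr
  exact hc k

lemma uniformContinuous_actionGrad {H' r : C2 → C2} {A : ℝ} (hr : UniformContinuous r)
    (hH' : ∀ z, H' z = (2 * A) • z + r z) : UniformContinuous (actionGrad s H') := by
  have h0 : actionGrad s H' = fun x => diagMul s (fun k => 2 * π * k - 2 * A) x
      - coeffs s fun t => r (trigPoly x t) := funext fun x => actionGrad_eq hr.continuous hH' x
  rw [h0]
  refine UniformContinuous.sub ?_ ?_
  · exact (LinearMap.toContinuousLinearMap (diagMul s fun k => 2 * π * k - 2 * A)).uniformContinuous
  · rw [Metric.uniformContinuous_iff]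
    intro e he
    obtain ⟨δ, hδ, h⟩ := Metric.uniformContinuous_iff.1 hr (e / 2) (by positivity)
    refine ⟨δ / (s.card + 1), by positivity, fun {x y} hxy => ?_⟩
    have hcx : Continuous fun t => r (trigPoly x t) :=
      hr.continuous.comp (map_continuous (trigPoly x))
    have hcy : Continuous fun t => r (trigPoly y t) :=
      hr.continuous.comp (map_continuous (trigPoly y))
    rw [dist_eq_norm, ← coeffs_sub hcx hcy]
    refine (norm_coeffs_le (hcx.fun_sub hcy) (B := e / 2) fun t => ?_).trans_lt (by linarith)
    rw [← dist_eq_norm]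
    refine (h ?_).le
    rw [dist_eq_norm, ← ContinuousMap.sub_apply, ← trigPoly_sub]
    rw [dist_eq_norm, lt_div_iff₀ (by positivity)] at hxy
    refine (norm_trigPoly_apply_le _ t).trans_lt ?_
    nlinarith [norm_nonneg (x - y)]

end Action

section ActionLinking

open MeasureTheory AddCircle

variable {s : Finset ℤ}

/-- Trigonometric polynomials with nonpositive frequencies. -/
def nonposPart (s : Finset ℤ) : Submodule ℝ (TrigSpace s) where
  carrier := {x | ∀ k : s, 0 < (k : ℤ) → x k = 0}
  add_mem' hx hy k hk := by rw [PiLp.add_apply, hx k hk, hy k hk, add_zero]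
  zero_mem' _ _ := rfl
  smul_mem' c x hx k hk := by rw [PiLp.smul_apply, hx k hk, smul_zero]

/-- Projection to nonpositive frequencies. -/
def projNonpos (s : Finset ℤ) : TrigSpace s →ₗ[ℝ] nonposPart s :=
  (diagMul s fun k => if k ≤ 0 then 1 else 0).codRestrict (nonposPart s) fun x => by
    intro k hk
    rw [diagMul_apply, if_neg (by lia), zero_smul]

lemma projNonpos_apply (x : TrigSpace s) (k : s) :
    (projNonpos s x : TrigSpace s) k = if (k : ℤ) ≤ 0 then x k else 0 := by
  change (if (k : ℤ) ≤ 0 then (1 : ℝ) else 0) • x k = _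
  split_ifs <;> simp

/-- A trigonometric polynomial with a single frequency. -/
def singleFreq (s : Finset ℤ) (n : ℤ) (w : C2) : TrigSpace s :=
  WithLp.toLp 2 fun k => if (k : ℤ) = n then w else 0

lemma singleFreq_apply (n : ℤ) (w : C2) (k : s) :
    singleFreq s n w k = if (k : ℤ) = n then w else 0 := rfl

lemma norm_sq_singleFreq {n : ℤ} (hn : n ∈ s) (w : C2) : ‖singleFreq s n w‖ ^ 2 = ‖w‖ ^ 2 := by
  rw [PiLp.norm_sq_eq_of_L2, Finset.sum_eq_single ⟨n, hn⟩]
  · simp [singleFreq_apply]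
  · intro k _ hk
    rw [singleFreq_apply, if_neg (fun h => hk (Subtype.ext h))]
    simp
  · simp

lemma trigPoly_singleFreq_zero (h0 : (0 : ℤ) ∈ s) (w : C2) (t : UnitAddCircle) :
    trigPoly (singleFreq s 0 w) t = w := by
  rw [trigPoly_apply, Finset.sum_eq_single ⟨0, h0⟩]
  · simp [singleFreq_apply]
  · intro k _ hk
    rw [singleFreq_apply, if_neg (fun h => hk (Subtype.ext h)), smul_zero]
  · simp

lemma norm_sq_add_singleFreq_one (h1 : (1 : ℤ) ∈ s) {w : TrigSpace s} (hw : w ∈ nonposPart s)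
    (e : C2) : ‖w + singleFreq s 1 e‖ ^ 2 = ‖w‖ ^ 2 + ‖e‖ ^ 2 := by
  rw [← norm_sq_singleFreq h1, PiLp.norm_sq_eq_of_L2, PiLp.norm_sq_eq_of_L2,
    PiLp.norm_sq_eq_of_L2, ← Finset.sum_add_distrib]
  refine Finset.sum_congr rfl fun k _ => ?_
  rw [PiLp.add_apply, singleFreq_apply]
  split_ifs with hk
  · rw [hw k (by lia)]; simp
  · simp

lemma halfEnergy_add_singleFreq_one_le (h1 : (1 : ℤ) ∈ s) {w : TrigSpace s}
    (hw : w ∈ nonposPart s) (e : C2) : halfEnergy (w + singleFreq s 1 e) ≤ ‖e‖ ^ 2 := by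
  rw [← norm_sq_singleFreq h1, PiLp.norm_sq_eq_of_L2, halfEnergy]
  refine Finset.sum_le_sum fun k _ => ?_
  rw [PiLp.add_apply, singleFreq_apply]
  split_ifs with hk
  · rw [hw k (by lia), hk]; simp
  · by_cases h0 : 0 < (k : ℤ)
    · rw [hw k h0]; simp
    · have : (k : ℝ) ≤ 0 := by exact_mod_cast not_lt.1 h0
      rw [norm_zero, zero_pow two_ne_zero, add_zero]
      exact mul_nonpos_of_nonpos_of_nonneg this (sq_nonneg _)

/-- The positive part of the quadratic form of the action. -/
def posEnergy (x : TrigSpace s) : ℝ := ∑ k : s, max (k : ℝ) 0 * ‖x k‖ ^ 2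

lemma continuous_posEnergy : Continuous (posEnergy (s := s)) := by
  unfold posEnergy
  fun_prop

lemma posEnergy_add_singleFreq_one (h1 : (1 : ℤ) ∈ s) {w : TrigSpace s}
    (hw : w ∈ nonposPart s) (e : C2) : posEnergy (w + singleFreq s 1 e) = ‖e‖ ^ 2 := by
  rw [← norm_sq_singleFreq h1, PiLp.norm_sq_eq_of_L2, posEnergy]
  refine Finset.sum_congr rfl fun k _ => ?_
  rw [PiLp.add_apply, singleFreq_apply]
  split_ifs with hk
  · rw [hw k (by lia), hk]; simp
  · by_cases h0 : 0 < (k : ℤ)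
    · rw [hw k h0]; simp
    · have : (k : ℝ) ≤ 0 := by exact_mod_cast not_lt.1 h0
      rw [max_eq_right this]; simp

lemma action_lower_bound {H : C2 → ℝ} (hHc : Continuous H) {z₀ : C2} {C : ℝ}
    (hC : ∀ z, H (z₀ + z) ≤ C * ‖z‖ ^ 4) (hC0 : 0 ≤ C) (h0 : (0 : ℤ) ∈ s) {x : TrigSpace s}
    (hx : (projNonpos s x : TrigSpace s) = singleFreq s 0 z₀) :
    π * posEnergy x - C * (4 * posEnergy x ^ 2) ≤ action s H x := by
  set y : TrigSpace s := x - singleFreq s 0 z₀ with hy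
  have hxk : ∀ k : s, (k : ℤ) ≤ 0 → x k = singleFreq s 0 z₀ k := by
    intro k hk
    rw [← hx, projNonpos_apply, if_pos hk]
  have hyk : ∀ k : s, (k : ℤ) ≤ 0 → y k = 0 := by
    intro k hk
    rw [hy, PiLp.sub_apply, hxk k hk, sub_self]
  have hyk' : ∀ k : s, 0 < (k : ℤ) → y k = x k := by
    intro k hk
    rw [hy, PiLp.sub_apply, singleFreq_apply, if_neg (by lia), sub_zero]
  have h1 : halfEnergy x = posEnergy x := by
    refine Finset.sum_congr rfl fun k _ => ?_
    rcases lt_trichotomy (k : ℤ) 0 with hk | hk | hk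
    · rw [hxk k hk.le, singleFreq_apply, if_neg hk.ne]; simp
    · simp [hk]
    · have : (0 : ℝ) < k := by exact_mod_cast hk
      rw [max_eq_left this.le]
  have h2 : halfEnergy y = posEnergy x := by
    refine Finset.sum_congr rfl fun k _ => ?_
    rcases le_or_gt (k : ℤ) 0 with hk | hk
    · have : (k : ℝ) ≤ 0 := by exact_mod_cast hk
      rw [hyk k hk, max_eq_right this]; simp
    · have : (0 : ℝ) < k := by exact_mod_cast hk
      rw [max_eq_left this.le, hyk' k hk]
  have hc := map_continuous (trigPoly x)
  have hcy := map_continuous (trigPoly y)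
  have h3 : ∫ t, H (trigPoly x t) ∂(haarAddCircle (T := 1)) ≤ C * (4 * posEnergy x ^ 2) := by
    calc ∫ t, H (trigPoly x t) ∂(haarAddCircle (T := 1))
        ≤ ∫ t, C * ‖trigPoly y t‖ ^ 4 ∂(haarAddCircle (T := 1)) := by
          refine integral_mono (integrable_circle (hHc.comp hc))
            (integrable_circle (continuous_const.fun_mul (hcy.norm.pow 4))) fun t => ?_
          have : trigPoly x t = z₀ + trigPoly y t := by
            rw [hy, trigPoly_sub, ContinuousMap.sub_apply, trigPoly_singleFreq_zero h0]
            abel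
          change H (trigPoly x t) ≤ C * ‖trigPoly y t‖ ^ 4
          rw [this]
          exact hC _
      _ = C * ∫ t, ‖trigPoly y t‖ ^ 4 ∂(haarAddCircle (T := 1)) := integral_const_mul _ _
      _ ≤ C * (4 * posEnergy x ^ 2) := by
          rw [← h2]
          gcongr
          exact integral_norm_pow_four_trigPoly_le hyk
  rw [action, h1]
  linarith

lemma action_upper_bound {H : C2 → ℝ} (hHc : Continuous H) {A C₀ : ℝ}
    (hlow : ∀ z, A * ‖z‖ ^ 2 - C₀ ≤ H z) (x : TrigSpace s) :
    action s H x ≤ π * halfEnergy x - (A * ‖x‖ ^ 2 - C₀) := by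
  have hc := map_continuous (trigPoly x)
  have h : A * ‖x‖ ^ 2 - C₀ ≤ ∫ t, H (trigPoly x t) ∂(haarAddCircle (T := 1)) := by
    calc A * ‖x‖ ^ 2 - C₀
        = ∫ t, (A * ‖trigPoly x t‖ ^ 2 - C₀) ∂(haarAddCircle (T := 1)) := by
          have hi : Continuous fun t => A * ‖trigPoly x t‖ ^ 2 :=
            continuous_const.fun_mul (hc.norm.pow 2)
          rw [integral_sub (integrable_circle hi) (integrable_const _), integral_const_mul,
            integral_norm_sq_trigPoly]
          simp
      _ ≤ _ := by
          refine integral_mono ?_ (integrable_circle (hHc.comp hc)) fun t => hlow _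
          exact integrable_circle ((continuous_const.fun_mul (hc.norm.pow 2)).fun_sub
            continuous_const)
  rw [action]
  linarith

lemma action_le_of_nonneg {H : C2 → ℝ} (hnn : ∀ z, 0 ≤ H z) (x : TrigSpace s) :
    action s H x ≤ π * halfEnergy x := by
  have : 0 ≤ ∫ t, H (trigPoly x t) ∂(haarAddCircle (T := 1)) := integral_nonneg fun t => hnn _
  rw [action]
  linarith

lemma two_mul_le_abs_nonresonant {A ε : ℝ} (hA : A = π + ε) (hε2 : ε ≤ π / 2) (k : ℤ) :
    2 * ε ≤ |2 * π * k - 2 * A| := by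
  rcases le_or_gt k 1 with hk | hk
  · have : (k : ℝ) ≤ 1 := by exact_mod_cast hk
    rw [le_abs]; right
    nlinarith [pi_pos]
  · have : (2 : ℝ) ≤ k := by exact_mod_cast hk
    rw [le_abs]; left
    nlinarith [pi_pos]

/-- Critical points of the action on trigonometric polynomials, with critical value bounded below
independently of the frequencies. -/
theorem exists_critical_trigPoly {H : C2 → ℝ} {H' r : C2 → C2} {A ε B C₀ C : ℝ} {z₀ : C2}
    (hH : ∀ z, HasGradientAt H (H' z) z) (hr : UniformContinuous r) (hrB : ∀ z, ‖r z‖ ≤ B)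
    (hH' : ∀ z, H' z = (2 * A) • z + r z) (hε : 0 < ε) (hA : A = π + ε) (hε2 : ε ≤ π / 2)
    (hlow : ∀ z, A * ‖z‖ ^ 2 - C₀ ≤ H z) (hnn : ∀ z, 0 ≤ H z) (hC0 : 0 < C)
    (hC : ∀ z, H (z₀ + z) ≤ C * ‖z‖ ^ 4) :
    ∃ β > 0, ∀ s : Finset ℤ, (0 : ℤ) ∈ s → (1 : ℤ) ∈ s →
      ∃ x : TrigSpace s, actionGrad s H' x = 0 ∧ β ≤ action s H x := by
  have hpi := pi_pos
  have hHc : Continuous H := continuous_iff_continuousAt.2 fun z => (hH z).hasFDerivAt.continuousAt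
  have hH'uc : UniformContinuous H' := by
    rw [funext hH']
    exact (uniformContinuous_id.const_smul (2 * A)).add hr
  set a2 : ℝ := π / (8 * C) with ha2
  have ha2pos : 0 < a2 := by positivity
  refine ⟨π * a2 / 2, by positivity, fun s h0 h1 => ?_⟩
  set R : ℝ := ‖z₀‖ + √a2 + √(|C₀| / ε) + 1 with hR
  have hR0 : 0 < R := by positivity
  have hRC : C₀ ≤ ε * R ^ 2 := by
    have h2 : √(|C₀| / ε) ≤ R := by
      rw [hR]; have := norm_nonneg z₀; have := sqrt_nonneg a2; linarith
    have h3 : |C₀| / ε ≤ R ^ 2 := (sqrt_le_left hR0.le).1 h2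
    rw [div_le_iff₀ hε] at h3
    linarith [le_abs_self C₀]
  obtain ⟨e, he⟩ : ∃ e : C2, ‖e‖ = 1 := ⟨EuclideanSpace.single 0 1, by simp⟩
  let W := WithLp 2 (nonposPart s × ℝ)
  let j : W → TrigSpace s := fun v => (v.fst : TrigSpace s) + singleFreq s 1 (v.snd • e)
  let P : TrigSpace s → W := fun x => WithLp.toLp 2 (projNonpos s x, √(posEnergy x))
  let D : Set W := {v | ‖v.fst‖ ≤ R ∧ 0 ≤ v.snd ∧ v.snd ≤ R}
  have hfst : Continuous fun v : W => v.fst := by fun_prop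
  have hsnd : Continuous fun v : W => v.snd := by fun_prop
  have hDclosed : IsClosed D :=
    (isClosed_le hfst.norm continuous_const).inter
      ((isClosed_le continuous_const hsnd).inter (isClosed_le hsnd continuous_const))
  have hDcpt : IsCompact D := by
    refine Metric.isCompact_of_isClosed_isBounded hDclosed ?_
    refine (Metric.isBounded_closedBall (x := (0 : W)) (r := R + R)).subset fun v hv => ?_
    rw [mem_closedBall_zero_iff]
    refine le_of_sq_le_sq ?_ (by positivity)
    rw [WithLp.prod_norm_sq_eq_of_L2, Real.norm_eq_abs, sq_abs]
    have := norm_nonneg v.fst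
    nlinarith [hv.1, hv.2.1, hv.2.2]
  have hjmem : ∀ v : W, ‖v.snd • e‖ ^ 2 = v.snd ^ 2 := by
    intro v
    rw [norm_smul, he, mul_one, Real.norm_eq_abs, sq_abs]
  have hz0 : singleFreq s 0 z₀ ∈ nonposPart s := by
    intro k hk
    rw [singleFreq_apply, if_neg (by lia)]
  let p : W := WithLp.toLp 2 (⟨singleFreq s 0 z₀, hz0⟩, √a2)
  have hkey := exists_critical_point_of_linking (Φ := action s H) (Φ' := actionGrad s H')
    (fun z => hasGradientAt_action hH hH'uc z) (uniformContinuous_actionGrad hr hH')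
    (R₀ := (B + 1) / (2 * ε)) one_pos ?_ (D := D) hDcpt (j := j) ?_ (P := P) ?_ ?_ (p := p) ?_
    (β := π * a2 / 2) (by positivity) ?_ ?_
  · exact hkey
  · intro z hz
    rw [actionGrad_eq hr.continuous hH']
    have h2 := le_norm_diagMul (c := fun k => 2 * π * k - 2 * A) (by positivity)
      (two_mul_le_abs_nonresonant hA hε2) z
    have h3 := norm_coeffs_le (s := s) (hr.continuous.comp (map_continuous (trigPoly z)))
      fun t => hrB (trigPoly z t)
    rw [div_le_iff₀ (by positivity)] at hz
    have h4 := norm_sub_norm_le (diagMul s (fun k => 2 * π * k - 2 * A) z)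
      (coeffs s fun t => r (trigPoly z t))
    simp only [Function.comp_def] at h3
    linarith
  · refine Continuous.continuousOn ?_
    refine (continuous_subtype_val.comp hfst).add ?_
    refine (PiLp.continuous_toLp 2 _).comp (continuous_pi fun k => ?_)
    split_ifs
    · exact hsnd.smul continuous_const
    · exact continuous_const
  · refine (WithLp.prod_continuous_toLp 2 _ _).comp ?_
    exact (LinearMap.continuous_of_finiteDimensional (projNonpos s)).prodMk
      (continuous_sqrt.comp continuous_posEnergy)
  · intro v hv
    refine (WithLp.equiv 2 _).injective (Prod.ext ?_ ?_)
    · refine Subtype.ext (PiLp.ext fun k => ?_)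
      change (projNonpos s (j v) : TrigSpace s) k = (v.fst : TrigSpace s) k
      rw [projNonpos_apply]
      split_ifs with hk
      · change (v.fst : TrigSpace s) k + singleFreq s 1 (v.snd • e) k = _
        rw [singleFreq_apply, if_neg (by lia), add_zero]
      · exact (v.fst.2 k (by lia)).symm
    · change √(posEnergy (j v)) = v.snd
      rw [posEnergy_add_singleFreq_one h1 v.fst.2, hjmem, sqrt_sq hv.2.1]
  · refine ⟨?_, sqrt_nonneg _, ?_⟩
    · change ‖singleFreq s 0 z₀‖ ≤ R
      refine le_of_sq_le_sq ?_ hR0.le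
      rw [norm_sq_singleFreq h0]
      refine pow_le_pow_left₀ (norm_nonneg _) ?_ 2
      have := sqrt_nonneg a2; have := sqrt_nonneg (|C₀| / ε); rw [hR]; linarith
    · change √a2 ≤ R
      have := sqrt_nonneg (|C₀| / ε); have := norm_nonneg z₀; rw [hR]; linarith
  · intro x hx
    have hx1 : (projNonpos s x : TrigSpace s) = singleFreq s 0 z₀ :=
      congrArg (fun v : W => (v.fst : TrigSpace s)) hx
    have hx2 : √(posEnergy x) = √a2 := congrArg (fun v : W => v.snd) hx
    have hx3 : posEnergy x = a2 := by
      have hnn : 0 ≤ posEnergy x := Finset.sum_nonneg fun k _ => by positivity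
      exact (sqrt_inj hnn ha2pos.le).1 hx2
    have := action_lower_bound hHc hC hC0.le h0 hx1
    rw [hx3] at this
    have h5 : C * (4 * a2 ^ 2) = π * a2 / 2 := by
      rw [ha2]; field_simp; ring
    linarith
  · intro v hv
    have hvD : v ∈ D := hDclosed.frontier_subset hv
    have hen := halfEnergy_add_singleFreq_one_le h1 v.fst.2 (v.snd • e)
    have hnorm := norm_sq_add_singleFreq_one h1 v.fst.2 (v.snd • e)
    rw [hjmem] at hen hnorm
    by_cases hs0 : v.snd = 0
    · refine (action_le_of_nonneg hnn _).trans ?_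
      have hen' : halfEnergy ((v.fst : TrigSpace s) + singleFreq s 1 (v.snd • e)) ≤ 0 := by
        refine hen.trans_eq ?_
        rw [hs0]; simp
      change π * halfEnergy ((v.fst : TrigSpace s) + singleFreq s 1 (v.snd • e)) ≤ 0
      nlinarith
    have hor : R ≤ ‖v.fst‖ ∨ R ≤ v.snd := by
      by_contra! hlt
      refine hv.2 (mem_interior.2 ⟨{u | ‖u.fst‖ < R ∧ 0 < u.snd ∧ u.snd < R}, ?_, ?_, ?_⟩)
      · exact fun u hu => ⟨hu.1.le, hu.2.1.le, hu.2.2.le⟩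
      · exact (isOpen_lt hfst.norm continuous_const).inter
          ((isOpen_lt continuous_const hsnd).inter (isOpen_lt hsnd continuous_const))
      · exact ⟨hlt.1, lt_of_le_of_ne hvD.2.1 (Ne.symm hs0), hlt.2⟩
    have hup := action_upper_bound hHc hlow ((v.fst : TrigSpace s) + singleFreq s 1 (v.snd • e))
    rw [hnorm] at hup
    change action s H ((v.fst : TrigSpace s) + singleFreq s 1 (v.snd • e)) ≤ 0
    have hw : ‖(v.fst : TrigSpace s)‖ = ‖v.fst‖ := rfl
    rw [hw] at hup
    have hfn := norm_nonneg v.fst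
    have hAe : ε ≤ A := by linarith
    have hmain : ε * R ^ 2 ≤ A * ‖v.fst‖ ^ 2 + ε * v.snd ^ 2 := by
      rcases hor with h | h
      · have h6 : R ^ 2 ≤ ‖v.fst‖ ^ 2 := pow_le_pow_left₀ hR0.le h 2
        nlinarith [sq_nonneg v.snd, sq_nonneg ‖v.fst‖]
      · have h6 : R ^ 2 ≤ v.snd ^ 2 := pow_le_pow_left₀ hR0.le h 2
        nlinarith [sq_nonneg v.snd, sq_nonneg ‖v.fst‖]
    nlinarith [sq_nonneg v.snd]

end ActionLinking

section Compactness

open MeasureTheory AddCircle Filter Topology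

lemma exists_subseq_tendsto_of_modulus (f : ℕ → C(UnitAddCircle, C2)) {C : ℝ}
    (hC : ∀ n t, ‖f n t‖ ≤ C) (m : UnitAddCircle → UnitAddCircle → ℝ)
    (hm : ∀ s, Tendsto (m s) (𝓝 s) (𝓝 0)) (hf : ∀ n s t, ‖f n s - f n t‖ ≤ m s t) :
    ∃ (x : C(UnitAddCircle, C2)) (φ : ℕ → ℕ), StrictMono φ ∧ Tendsto (f ∘ φ) atTop (𝓝 x) := by
  let e := ContinuousMap.linearIsometryBoundedOfCompact UnitAddCircle C2 ℝ
  have hcpt := BoundedContinuousFunction.arzela_ascoli (Metric.closedBall (0 : C2) C)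
    (isCompact_closedBall 0 C) (Set.range fun n => e (f n)) (by
      rintro _ t ⟨n, rfl⟩
      rw [mem_closedBall_zero_iff]
      exact hC n t) (by
      intro s
      rw [Metric.equicontinuousAt_iff_right]
      intro ε hε
      filter_upwards [(hm s).eventually (gt_mem_nhds hε)] with t ht
      rintro ⟨_, n, rfl⟩
      rw [dist_eq_norm]
      exact (hf n s t).trans_lt ht)
  obtain ⟨y, -, φ, hφ, hy⟩ := hcpt.tendsto_subseq (x := fun n => e (f n))
    fun n => subset_closure ⟨n, rfl⟩
  refine ⟨e.symm y, φ, hφ, ?_⟩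
  have := (e.symm.continuous.tendsto y).comp hy
  refine this.congr fun n => ?_
  simp

lemma summable_inv_one_add_int_sq : Summable fun k : ℤ => (1 + (k : ℝ) ^ 2)⁻¹ := by
  have h1 : Summable fun k : ℤ => 1 / (k : ℝ) ^ 2 + (if k = 0 then 1 else 0) := by
    refine (Real.summable_one_div_int_pow.2 one_lt_two).add ?_
    exact summable_of_ne_finset_zero (s := {0}) fun k hk => by simpa using hk
  refine Summable.of_nonneg_of_le (fun k => by positivity) (fun k => ?_) h1
  by_cases hk : k = 0
  · simp [hk]
  · have : (0 : ℝ) < (k : ℝ) ^ 2 := by positivity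
    rw [if_neg hk, add_zero, inv_eq_one_div]
    exact one_div_le_one_div_of_le this (by linarith)

/-- A modulus of continuity for loops bounded in `H¹`. -/
def fourierModulus (s t : UnitAddCircle) : ℝ :=
  ∑' k : ℤ, ‖fourier k s - fourier k t‖ ^ 2 * (1 + (k : ℝ) ^ 2)⁻¹

lemma fourierModulus_term_le (s t : UnitAddCircle) (k : ℤ) :
    ‖fourier k s - fourier k t‖ ^ 2 * (1 + (k : ℝ) ^ 2)⁻¹ ≤ 4 * (1 + (k : ℝ) ^ 2)⁻¹ := by
  have h : ‖fourier k s - fourier k t‖ ≤ 2 := by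
    refine (norm_sub_le _ _).trans ?_
    rw [norm_fourier_apply, norm_fourier_apply]; norm_num
  have := norm_nonneg (fourier k s - fourier k t)
  gcongr
  nlinarith

lemma summable_fourierModulus (s t : UnitAddCircle) :
    Summable fun k : ℤ => ‖fourier k s - fourier k t‖ ^ 2 * (1 + (k : ℝ) ^ 2)⁻¹ :=
  Summable.of_nonneg_of_le (fun k => by positivity) (fourierModulus_term_le s t)
    (summable_inv_one_add_int_sq.mul_left 4)

lemma tendsto_fourierModulus (s : UnitAddCircle) :
    Tendsto (fourierModulus s) (𝓝 s) (𝓝 0) := by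
  have hc : Continuous (fourierModulus s) := by
    refine continuous_tsum (u := fun k : ℤ => 4 * (1 + (k : ℝ) ^ 2)⁻¹) (fun k => ?_)
      (summable_inv_one_add_int_sq.mul_left 4) fun k t => ?_
    · have := map_continuous (fourier (T := 1) k)
      exact ((continuous_const.fun_sub this).norm.pow 2).mul continuous_const
    · rw [Real.norm_of_nonneg (by positivity)]
      exact fourierModulus_term_le s t k
  have h0 : fourierModulus s s = 0 := by simp [fourierModulus]
  simpa [h0] using hc.tendsto s

variable {s : Finset ℤ}

lemma sum_coe_le_tsum {f : ℤ → ℝ} (hf : Summable f) (h0 : ∀ k, 0 ≤ f k) :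
    ∑ k : s, f k ≤ ∑' k, f k := by
  rw [Finset.sum_coe_sort s f]
  exact hf.sum_le_tsum s fun k _ => h0 k

lemma norm_trigPoly_le_of_sobolev {x : TrigSpace s} {b : ℝ} (hb : 0 ≤ b)
    (hx : ∑ k : s, (1 + (k : ℝ) ^ 2) * ‖x k‖ ^ 2 ≤ b ^ 2) (t : UnitAddCircle) :
    ‖trigPoly x t‖ ≤ b * √(∑' k : ℤ, (1 + (k : ℝ) ^ 2)⁻¹) := by
  rw [trigPoly_apply]
  refine (norm_sum_le _ _).trans ?_
  refine le_of_sq_le_sq ?_ (by positivity)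
  rw [mul_pow, sq_sqrt (tsum_nonneg fun k => by positivity), mul_comm]
  have h1 : (∑ k : s, ‖fourier (k : ℤ) t • x k‖) ^ 2 ≤
      (∑ k : s, (1 + (k : ℝ) ^ 2)⁻¹) * ∑ k : s, (1 + (k : ℝ) ^ 2) * ‖x k‖ ^ 2 := by
    refine Finset.sum_sq_le_sum_mul_sum_of_sq_le_mul _ (fun k _ => by positivity)
      (fun k _ => by positivity) fun k _ => le_of_eq ?_
    rw [norm_smul, norm_fourier_apply, one_mul, inv_mul_cancel_left₀ (by positivity)]
  refine h1.trans ?_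
  have h2 := sum_coe_le_tsum (s := s) summable_inv_one_add_int_sq fun k => by positivity
  exact mul_le_mul h2 hx (Finset.sum_nonneg fun k _ => by positivity)
    (tsum_nonneg fun k => by positivity)

lemma norm_trigPoly_sub_le_of_sobolev {x : TrigSpace s} {b : ℝ} (hb : 0 ≤ b)
    (hx : ∑ k : s, (1 + (k : ℝ) ^ 2) * ‖x k‖ ^ 2 ≤ b ^ 2) (t t' : UnitAddCircle) :
    ‖trigPoly x t - trigPoly x t'‖ ≤ b * √(fourierModulus t t') := by
  rw [trigPoly_apply, trigPoly_apply, ← Finset.sum_sub_distrib]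
  refine (norm_sum_le _ _).trans ?_
  refine le_of_sq_le_sq ?_ (by positivity)
  rw [mul_pow, sq_sqrt (show 0 ≤ fourierModulus t t' from tsum_nonneg fun k => by positivity),
    mul_comm]
  have h1 : (∑ k : s, ‖fourier (k : ℤ) t • x k - fourier (k : ℤ) t' • x k‖) ^ 2 ≤
      (∑ k : s, ‖fourier (k : ℤ) t - fourier (k : ℤ) t'‖ ^ 2 * (1 + (k : ℝ) ^ 2)⁻¹) *
        ∑ k : s, (1 + (k : ℝ) ^ 2) * ‖x k‖ ^ 2 := by
    refine Finset.sum_sq_le_sum_mul_sum_of_sq_le_mul _ (fun k _ => by positivity)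
      (fun k _ => by positivity) fun k _ => le_of_eq ?_
    rw [← sub_smul, norm_smul]
    field_simp
  refine h1.trans ?_
  have h2 := sum_coe_le_tsum (s := s) (summable_fourierModulus t t') fun k => by positivity
  exact mul_le_mul h2 hx (Finset.sum_nonneg fun k _ => by positivity)
    (tsum_nonneg fun k => by positivity)

lemma exists_nonresonance_weight {A ε : ℝ} (hε : 0 < ε) (hA : A = π + ε) (hε2 : ε ≤ π / 2) :
    ∃ q > 0, ∀ k : ℤ, 1 + (k : ℝ) ^ 2 ≤ q * (2 * π * k - 2 * A) ^ 2 := by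
  refine ⟨1 / (4 * ε ^ 2) + (1 + A / ε) ^ 2 / (4 * π ^ 2), by positivity, fun k => ?_⟩
  have hpi := pi_pos
  have hA0 : 0 < A := by linarith
  set d := |2 * π * k - 2 * A| with hd
  have h1 : 2 * ε ≤ d := two_mul_le_abs_nonresonant hA hε2 k
  rw [← sq_abs (2 * π * k - 2 * A), ← hd]
  have h2 : 2 * π * |(k : ℝ)| ≤ d * (1 + A / ε) := by
    have h3 : 2 * π * |(k : ℝ)| ≤ d + 2 * A := by
      have h4 := abs_sub_abs_le_abs_sub (2 * π * k) (2 * A)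
      rw [abs_mul, abs_of_pos (show 0 < 2 * π by positivity),
        abs_of_pos (show 0 < 2 * A by positivity)] at h4
      linarith
    have h5 : 2 * A ≤ d * (A / ε) := by
      rw [mul_div_assoc', le_div_iff₀ hε]
      nlinarith
    linarith
  have h6 : 1 ≤ 1 / (4 * ε ^ 2) * d ^ 2 := by
    rw [one_div, ← div_eq_inv_mul, le_div_iff₀ (by positivity)]
    nlinarith
  have h7 : (k : ℝ) ^ 2 ≤ (1 + A / ε) ^ 2 / (4 * π ^ 2) * d ^ 2 := by
    rw [div_mul_eq_mul_div, le_div_iff₀ (by positivity), ← sq_abs (k : ℝ)]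
    have := pow_le_pow_left₀ (by positivity) h2 2
    nlinarith
  linarith

lemma continuous_fourierCoeff (k : ℤ) :
    Continuous fun f : C(UnitAddCircle, C2) => fourierCoeff f k := by
  refine (LipschitzWith.of_dist_le_mul (K := 1) fun f g => ?_).continuous
  have h := norm_coeffs_le (s := {k}) (g := fun t => f t - g t)
    ((map_continuous f).fun_sub (map_continuous g)) (B := ‖f - g‖)
    fun t => (f - g).norm_coe_le_norm t
  rw [coeffs_sub (map_continuous f) (map_continuous g)] at h
  rw [dist_eq_norm, dist_eq_norm, NNReal.coe_one, one_mul]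
  exact (PiLp.norm_apply_le (coeffs {k} f - coeffs {k} g) ⟨k, by simp⟩).trans h

lemma continuous_integral_circle :
    Continuous fun f : C(UnitAddCircle, ℝ) => ∫ t, f t ∂(haarAddCircle (T := 1)) := by
  refine (LipschitzWith.of_dist_le_mul (K := 1) fun f g => ?_).continuous
  rw [dist_eq_norm, dist_eq_norm, NNReal.coe_one, one_mul,
    ← integral_sub (integrable_circle (map_continuous f)) (integrable_circle (map_continuous g))]
  refine (norm_integral_le_of_norm_le_const (C := ‖f - g‖)
    (Filter.Eventually.of_forall fun t => (f - g).norm_coe_le_norm t)).trans ?_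
  simp

/-- A weakly critical loop of positive action. -/
theorem exists_weak_critical_loop {H : C2 → ℝ} {H' r : C2 → C2} {A ε B C₀ C : ℝ} {z₀ : C2}
    (hH : ∀ z, HasGradientAt H (H' z) z) (hr : UniformContinuous r) (hrB : ∀ z, ‖r z‖ ≤ B)
    (hH' : ∀ z, H' z = (2 * A) • z + r z) (hε : 0 < ε) (hA : A = π + ε) (hε2 : ε ≤ π / 2)
    (hlow : ∀ z, A * ‖z‖ ^ 2 - C₀ ≤ H z) (hnn : ∀ z, 0 ≤ H z) (hC0 : 0 < C)
    (hC : ∀ z, H (z₀ + z) ≤ C * ‖z‖ ^ 4) :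
    ∃ x : C(UnitAddCircle, C2),
      (∀ k : ℤ, (2 * π * k) • fourierCoeff x k = fourierCoeff (fun t => H' (x t)) k) ∧
      0 < ∫ t, (inner ℝ (x t) (H' (x t)) / 2 - H (x t)) ∂(haarAddCircle (T := 1)) := by
  obtain ⟨β, hβ, hex⟩ := exists_critical_trigPoly hH hr hrB hH' hε hA hε2 hlow hnn hC0 hC
  have hHc : Continuous H := continuous_iff_continuousAt.2 fun z => (hH z).hasFDerivAt.continuousAt
  have hH'c : Continuous H' := by
    rw [funext hH']
    exact (continuous_id.fun_const_smul (2 * A)).fun_add hr.continuous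
  have hB : 0 ≤ B := (norm_nonneg _).trans (hrB 0)
  let s : ℕ → Finset ℤ := fun N => Finset.Icc (-(N + 1 : ℤ)) (N + 1)
  choose x hx hxβ using fun N => hex (s N) (by simp only [s, Finset.mem_Icc]; lia)
    (by simp only [s, Finset.mem_Icc]; lia)
  obtain ⟨q, hq, hqk⟩ := exists_nonresonance_weight hε hA hε2
  set b : ℝ := √q * B with hb
  have hsob : ∀ N, ∑ k : s N, (1 + (k : ℝ) ^ 2) * ‖x N k‖ ^ 2 ≤ b ^ 2 := by
    intro N
    have h1 : diagMul (s N) (fun k => 2 * π * k - 2 * A) (x N)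
        = coeffs (s N) fun t => r (trigPoly (x N) t) := by
      have := actionGrad_eq hr.continuous hH' (x N)
      rw [hx N] at this
      exact sub_eq_zero.1 this.symm
    have h2 : ‖diagMul (s N) (fun k => 2 * π * k - 2 * A) (x N)‖ ≤ B := by
      rw [h1]
      exact norm_coeffs_le (hr.continuous.comp (map_continuous _)) fun t => hrB _
    have h3 : ‖diagMul (s N) (fun k => 2 * π * k - 2 * A) (x N)‖ ^ 2 ≤ B ^ 2 :=
      pow_le_pow_left₀ (norm_nonneg _) h2 2
    rw [hb, mul_pow, sq_sqrt hq.le]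
    refine le_trans ?_ (mul_le_mul_of_nonneg_left h3 hq.le)
    rw [PiLp.norm_sq_eq_of_L2, Finset.mul_sum]
    refine Finset.sum_le_sum fun k _ => ?_
    rw [diagMul_apply, norm_smul, mul_pow, Real.norm_eq_abs, sq_abs, ← mul_assoc]
    gcongr
    exact hqk k
  have hb0 : 0 ≤ b := by positivity
  obtain ⟨y, φ, hφ, hy⟩ := exists_subseq_tendsto_of_modulus (fun N => trigPoly (x N))
    (fun N t => norm_trigPoly_le_of_sobolev hb0 (hsob N) t)
    (fun t t' => b * √(fourierModulus t t'))
    (fun t => by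
      have := ((continuous_sqrt.tendsto 0).comp (tendsto_fourierModulus t)).const_mul b
      simpa using this)
    (fun N t t' => norm_trigPoly_sub_le_of_sobolev hb0 (hsob N) t t')
  refine ⟨y, fun k => ?_, ?_⟩
  · have h1 := ((continuous_fourierCoeff k).tendsto y).comp hy
    have h2 := ((continuous_fourierCoeff k).tendsto _).comp
      (((ContinuousMap.continuous_postcomp (⟨H', hH'c⟩ : C(C2, C2))).tendsto y).comp hy)
    refine tendsto_nhds_unique ((h1.const_smul (2 * π * k)).congr' ?_) h2
    filter_upwards [eventually_ge_atTop k.natAbs] with n hn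
    have hkn : k ∈ s (φ n) := by
      have := hφ.id_le n
      simp only [s, Finset.mem_Icc, id] at this ⊢
      lia
    have h3 := congrArg (fun v : TrigSpace (s (φ n)) => v ⟨k, hkn⟩) (hx (φ n))
    simp only [actionGrad, PiLp.sub_apply, diagMul_apply, PiLp.zero_apply, coeffs_apply] at h3
    have h4 := fourierCoeff_trigPoly (x (φ n)) k
    rw [dif_pos hkn] at h4
    simp only [Function.comp_apply]
    rw [h4]
    exact sub_eq_zero.1 h3
  · have hGc : Continuous fun z : C2 => inner ℝ z (H' z) / 2 - H z :=
      ((continuous_id.inner hH'c).div_const 2).fun_sub hHc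
    have h2 := (continuous_integral_circle.tendsto _).comp
      (((ContinuousMap.continuous_postcomp (⟨_, hGc⟩ : C(C2, ℝ))).tendsto y).comp hy)
    refine hβ.trans_le (ge_of_tendsto' h2 fun n => ?_)
    have hc := map_continuous (trigPoly (x (φ n)))
    have hcH' : Continuous fun t => H' (trigPoly (x (φ n)) t) := hH'c.comp hc
    have hcH : Continuous fun t => H (trigPoly (x (φ n)) t) := hHc.comp hc
    have h4 : 2 * π * halfEnergy (x (φ n)) = ∫ t, inner ℝ (trigPoly (x (φ n)) t)
        (H' (trigPoly (x (φ n)) t)) ∂(haarAddCircle (T := 1)) := by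
      have h5 : coeffs (s (φ n)) (fun t => H' (trigPoly (x (φ n)) t))
        = diagMul (s (φ n)) (fun k => 2 * π * k) (x (φ n)) := (sub_eq_zero.1 (hx (φ n))).symm
      rw [integral_re_inner_trigPoly _ hcH', h5, PiLp.inner_apply, halfEnergy, Finset.mul_sum]
      refine Finset.sum_congr rfl fun k _ => ?_
      rw [diagMul_apply, real_inner_smul_right, real_inner_self_eq_norm_sq]
      ring
    refine (hxβ (φ n)).trans_eq ?_
    change _ = ∫ t, (inner ℝ (trigPoly (x (φ n)) t) (H' (trigPoly (x (φ n)) t)) / 2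
      - H (trigPoly (x (φ n)) t)) ∂(haarAddCircle (T := 1))
    rw [integral_sub (integrable_circle ((hc.inner hcH').div_const 2)) (integrable_circle hcH),
      integral_div, ← h4, action]
    ring

end Compactness

section WeakODE

open MeasureTheory AddCircle Filter Topology

lemma hasDerivAt_of_fourierCoeff {u v : C(UnitAddCircle, ℂ)}
    (h : ∀ k : ℤ, (2 * π * k) • fourierCoeff u k = fourierCoeff v k) (t : ℝ) :
    HasDerivAt (fun t : ℝ => u (t : UnitAddCircle)) (Complex.I * v t) t := by
  set V : ℝ → ℂ := fun t => Complex.I * v (t : UnitAddCircle) with hV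
  have hVc : Continuous V :=
    continuous_const.mul ((map_continuous v).comp (AddCircle.continuous_mk' 1))
  set z : ℝ → ℂ := fun t => ∫ τ in (0 : ℝ)..t, V τ with hz
  have hzd : ∀ t, HasDerivAt z (V t) t := fun t => (hVc.integral_hasStrictDerivAt 0 t).hasDerivAt
  have hzc : Continuous z := continuous_iff_continuousAt.2 fun t => (hzd t).continuousAt
  have hmean : ∀ t : ℝ, ∫ τ in t..t + 1, V τ = 0 := by
    intro t
    have h0 := h 0
    rw [fourierCoeff_eq_intervalIntegral v 0 t] at h0
    simp only [Int.cast_zero, mul_zero, zero_smul, neg_zero, fourier_zero, one_smul,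
      div_one] at h0
    rw [hV]
    simp only
    rw [intervalIntegral.integral_const_mul, ← h0, mul_zero]
  have hper : Function.Periodic z 1 := by
    intro t
    have := intervalIntegral.integral_add_adjacent_intervals (μ := volume)
      (hVc.intervalIntegrable 0 t) (hVc.intervalIntegrable t (t + 1))
    rw [hmean, add_zero] at this
    exact this.symm
  let zl : C(UnitAddCircle, ℂ) := ⟨hper.lift, continuous_coinduced_dom.2 hzc⟩
  have hzl : ∀ t : ℝ, zl (t : UnitAddCircle) = z t := fun t => rfl
  have hcoef : ∀ k : ℤ, k ≠ 0 → fourierCoeff zl k = fourierCoeff u k := by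
    intro k hk
    have h1 := fourierCoeffOn_of_hasDerivAt (a := 0) (b := 1) zero_lt_one hk
      (fun x _ => hzd x) (hVc.intervalIntegrable 0 1)
    have h2 : fourierCoeff zl k = fourierCoeffOn (zero_lt_one' ℝ) z k := by
      rw [fourierCoeff_eq_intervalIntegral _ _ 0, fourierCoeffOn_eq_integral]
      simp only [hzl, fourier_coe_apply, zero_add, sub_zero]
    have h3 : fourierCoeffOn (zero_lt_one' ℝ) V k = Complex.I * fourierCoeff v k := by
      rw [fourierCoeff_eq_intervalIntegral v k 0, fourierCoeffOn_eq_integral]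
      simp only [fourier_coe_apply, zero_add, sub_zero, div_one, one_smul, hV]
      rw [← intervalIntegral.integral_const_mul]
      congr 1
      ext τ
      simp only [smul_eq_mul]
      ring
    have h4 : z 1 - z 0 = 0 := by
      have := hper 0
      rw [zero_add] at this
      rw [this, sub_self]
    rw [h2, h1, h3, h4, ← h k, Complex.real_smul]
    have hkc : (k : ℂ) ≠ 0 := by exact_mod_cast hk
    have hpi : (π : ℂ) ≠ 0 := by exact_mod_cast pi_ne_zero
    push_cast
    field_simp
    ring_nf
  have hd : ∀ k : ℤ, k ≠ 0 → fourierCoeff (u - zl : C(UnitAddCircle, ℂ)) k = 0 := by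
    intro k hk
    have h5 : fourierCoeff (u - zl : C(UnitAddCircle, ℂ)) k =
        fourierCoeff u k - fourierCoeff zl k := by
      simp only [fourierCoeff, ContinuousMap.sub_apply, smul_sub]
      exact integral_sub ((integrable_circle (map_continuous u)).fourier_smul _)
        ((integrable_circle (map_continuous zl)).fourier_smul _)
    rw [h5, hcoef k hk, sub_self]
  have hsum : Summable (fourierCoeff (u - zl : C(UnitAddCircle, ℂ))) :=
    summable_of_ne_finset_zero (s := {0}) fun k hk => hd k (by simpa using hk)
  have hconst : ∀ t : ℝ, u (t : UnitAddCircle) =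
      z t + fourierCoeff (u - zl : C(UnitAddCircle, ℂ)) 0 := by
    intro t
    have h6 := has_pointwise_sum_fourier_series_of_summable hsum (t : UnitAddCircle)
    have h7 := h6.unique (hasSum_single 0 fun k hk => by rw [hd k hk, zero_smul])
    rw [ContinuousMap.sub_apply, hzl] at h7
    simp only [fourier_zero, smul_eq_mul, mul_one] at h7
    rw [← h7]; ring
  rw [funext hconst]
  exact (hzd t).add_const _

lemma hasDerivAt_C2_of_fourierCoeff {u v : C(UnitAddCircle, C2)}
    (h : ∀ k : ℤ, (2 * π * k) • fourierCoeff u k = fourierCoeff v k) (t : ℝ) :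
    HasDerivAt (fun t : ℝ => u (t : UnitAddCircle)) (Complex.I • v t) t := by
  have hcomp : ∀ i : Fin 2, HasDerivAt (fun t : ℝ => u (t : UnitAddCircle) i)
      ((Complex.I • v t) i) t := by
    intro i
    have hcoef : ∀ (w : C(UnitAddCircle, C2)) (k : ℤ),
        fourierCoeff (fun t => w t i) k = fourierCoeff w k i := by
      intro w k
      have := (EuclideanSpace.proj (𝕜 := ℂ) i : C2 →L[ℂ] ℂ).integral_comp_comm
        ((integrable_circle (map_continuous w)).fourier_smul (-k))
      exact this
    have hp : Continuous fun y : C2 => y i := by fun_prop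
    refine hasDerivAt_of_fourierCoeff (u := ⟨fun t => u t i, hp.comp (map_continuous u)⟩)
      (v := ⟨fun t => v t i, hp.comp (map_continuous v)⟩) (fun k => ?_) t
    change (2 * π * k) • fourierCoeff (fun t => u t i) k = fourierCoeff (fun t => v t i) k
    rw [hcoef, hcoef, ← h k]
    rfl
  have h1 : HasDerivAt (fun t : ℝ => WithLp.ofLp (u (t : UnitAddCircle)))
      (WithLp.ofLp (Complex.I • v t)) t := hasDerivAt_pi.2 hcomp
  have h2 := (PiLp.continuousLinearEquiv 2 ℝ (fun _ : Fin 2 => ℂ)).symm.hasFDerivAt.comp_hasDerivAt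
    t h1
  exact h2

end WeakODE

section HoferZehnder

open MeasureTheory AddCircle Filter Topology

lemma hasDerivAt_sq_max (u : ℝ) : HasDerivAt (fun u : ℝ => max u 0 ^ 2) (2 * max u 0) u := by
  rw [hasDerivAt_iff_isLittleO_nhds_zero]
  refine (Asymptotics.IsBigO.of_bound 1 (Eventually.of_forall fun h => ?_)).trans_isLittleO
    (Asymptotics.isLittleO_pow_id one_lt_two)
  rw [Real.norm_eq_abs, Real.norm_eq_abs, abs_of_nonneg (sq_nonneg h), abs_le, smul_eq_mul]
  rcases max_cases (u + h) 0 with ⟨h1, h2⟩ | ⟨h1, h2⟩ <;>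
    rcases max_cases u 0 with ⟨h3, h4⟩ | ⟨h3, h4⟩ <;> rw [h1, h3] <;>
    constructor <;> nlinarith [sq_nonneg h, sq_nonneg u, sq_nonneg (u + h)]

/-- A radial profile, zero up to `a` and of slope `A` beyond `a + κ`. -/
def radialProfile (A a κ s : ℝ) : ℝ :=
  A / (2 * κ) * (max (s - a) 0 ^ 2 - max (s - a - κ) 0 ^ 2)

/-- The slope of the radial profile. -/
def radialSlope (A a κ s : ℝ) : ℝ := A / κ * (max (s - a) 0 - max (s - a - κ) 0)

lemma hasDerivAt_radialProfile {A a κ : ℝ} (hκ : 0 < κ) (s : ℝ) :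
    HasDerivAt (radialProfile A a κ) (radialSlope A a κ s) s := by
  have h1 : HasDerivAt (fun s : ℝ => max (s - a) 0 ^ 2) (2 * max (s - a) 0) s := by
    have := (hasDerivAt_sq_max (s - a)).comp s ((hasDerivAt_id s).sub_const a)
    rw [mul_one] at this
    exact this
  have h2 : HasDerivAt (fun s : ℝ => max (s - a - κ) 0 ^ 2) (2 * max (s - a - κ) 0) s := by
    have := (hasDerivAt_sq_max (s - a - κ)).comp s
      (((hasDerivAt_id s).sub_const a).sub_const κ)
    rw [mul_one] at this
    exact this
  refine ((h1.sub h2).const_mul (A / (2 * κ))).congr_deriv ?_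
  rw [radialSlope]
  field_simp

lemma continuous_radialSlope (A a κ : ℝ) : Continuous (radialSlope A a κ) := by
  unfold radialSlope
  fun_prop

lemma radialProfile_of_le {A a κ s : ℝ} (hκ : 0 < κ) (hs : s ≤ a) : radialProfile A a κ s = 0 := by
  rw [radialProfile, max_eq_right (by linarith), max_eq_right (by linarith)]
  simp

lemma radialSlope_of_le {A a κ s : ℝ} (hκ : 0 < κ) (hs : s ≤ a) : radialSlope A a κ s = 0 := by
  rw [radialSlope, max_eq_right (by linarith), max_eq_right (by linarith)]
  simp

lemma radialSlope_of_ge {A a κ s : ℝ} (hκ : 0 < κ) (hs : a + κ ≤ s) : radialSlope A a κ s = A := by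
  rw [radialSlope, max_eq_left (by linarith), max_eq_left (by linarith)]
  field_simp
  ring

lemma radialProfile_nonneg {A a κ : ℝ} (hA : 0 ≤ A) (hκ : 0 < κ) (s : ℝ) :
    0 ≤ radialProfile A a κ s := by
  rw [radialProfile]
  have h1 : max (s - a - κ) 0 ≤ max (s - a) 0 := max_le_max (by linarith) le_rfl
  have h2 := pow_le_pow_left₀ (le_max_right (s - a - κ) 0) h1 2
  exact mul_nonneg (by positivity) (by linarith)

lemma le_radialProfile {A a κ : ℝ} (hA : 0 ≤ A) (hκ : 0 < κ) (s : ℝ) :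
    A * s - A * (a + κ / 2) ≤ radialProfile A a κ s := by
  have h : 2 * κ * (s - a) - κ ^ 2 ≤ max (s - a) 0 ^ 2 - max (s - a - κ) 0 ^ 2 := by
    rcases max_cases (s - a) 0 with ⟨h1, h2⟩ | ⟨h1, h2⟩ <;>
    rcases max_cases (s - a - κ) 0 with ⟨h3, h4⟩ | ⟨h3, h4⟩ <;> rw [h1, h3] <;>
    nlinarith [sq_nonneg (s - a - κ)]
  calc A * s - A * (a + κ / 2) = A / (2 * κ) * (2 * κ * (s - a) - κ ^ 2) := by field_simp; ring
    _ ≤ _ := mul_le_mul_of_nonneg_left h (by positivity)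

lemma radialProfile_le {A a κ s : ℝ} (hA : 0 ≤ A) (ha : 0 ≤ a) (hκ : 0 < κ) (hs : 0 ≤ s) :
    radialProfile A a κ s ≤ A * s := by
  have h : max (s - a) 0 ^ 2 - max (s - a - κ) 0 ^ 2 ≤ 2 * κ * s := by
    rcases max_cases (s - a) 0 with ⟨h1, h2⟩ | ⟨h1, h2⟩ <;>
    rcases max_cases (s - a - κ) 0 with ⟨h3, h4⟩ | ⟨h3, h4⟩ <;> rw [h1, h3] <;>
    nlinarith [mul_nonneg hκ.le hs, mul_nonneg hκ.le ha]
  calc radialProfile A a κ s ≤ A / (2 * κ) * (2 * κ * s) :=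
        mul_le_mul_of_nonneg_left h (by positivity)
    _ = A * s := by field_simp

lemma mul_radialSlope_sub_le {A a κ : ℝ} (hA : 0 ≤ A) (ha : 0 ≤ a) (hκ : 0 < κ) (s : ℝ) :
    s * radialSlope A a κ s - radialProfile A a κ s ≤ A * (a + κ / 2) := by
  have h : 2 * s * (max (s - a) 0 - max (s - a - κ) 0)
      - (max (s - a) 0 ^ 2 - max (s - a - κ) 0 ^ 2) ≤ 2 * κ * (a + κ / 2) := by
    rcases max_cases (s - a) 0 with ⟨h1, h2⟩ | ⟨h1, h2⟩ <;>
    rcases max_cases (s - a - κ) 0 with ⟨h3, h4⟩ | ⟨h3, h4⟩ <;> rw [h1, h3] <;>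
    nlinarith [mul_nonneg hκ.le ha, mul_pos hκ hκ]
  calc s * radialSlope A a κ s - radialProfile A a κ s
      = A / (2 * κ) * (2 * s * (max (s - a) 0 - max (s - a - κ) 0)
      - (max (s - a) 0 ^ 2 - max (s - a - κ) 0 ^ 2)) := by
        rw [radialSlope, radialProfile]; field_simp
    _ ≤ A / (2 * κ) * (2 * κ * (a + κ / 2)) := mul_le_mul_of_nonneg_left h (by positivity)
    _ = A * (a + κ / 2) := by field_simp

lemma real_inner_C2_I_smul_self (z : C2) : inner ℝ z (Complex.I • z) = 0 := by
  rw [real_inner_C2, inner_smul_right, inner_self_eq_norm_sq_to_K]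
  simp [Complex.mul_re, ← Complex.ofReal_pow]

lemma hasGradientAt_radial {h h' : ℝ → ℝ} (hh : ∀ s, HasDerivAt h (h' s) s) (z : C2) :
    HasGradientAt (fun z : C2 => h (‖z‖ ^ 2)) ((2 * h' (‖z‖ ^ 2)) • z) z := by
  rw [hasGradientAt_iff_hasFDerivAt]
  refine ((hh (‖z‖ ^ 2)).comp_hasFDerivAt z (hasFDerivAt_id z).norm_sq).congr_fderiv ?_
  ext v
  change h' (‖z‖ ^ 2) • ((2 : ℕ) • inner ℝ z v) = inner ℝ ((2 * h' (‖z‖ ^ 2)) • z) v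
  rw [real_inner_smul_left, nsmul_eq_mul, smul_eq_mul]
  push_cast
  ring

/-- A Hamiltonian that vanishes near a point and is constant and larger than `π ρ²` outside a ball
of radius less than `ρ` has a nonconstant one-periodic orbit. -/
theorem exists_periodic_orbit {K : C2 → ℝ} {K' : C2 → C2} {z₀ : C2} {r₀ ρ₁ ρ m : ℝ}
    (hK : ∀ z, HasGradientAt K (K' z) z) (hK'c : Continuous K') (hK0 : ∀ z, 0 ≤ K z)
    (hr₀ : 0 < r₀) (hKz : ∀ z ∈ Metric.ball z₀ r₀, K z = 0) (hρ₁ : 0 < ρ₁) (hρ : ρ₁ < ρ)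
    (hKm : ∀ z, ρ₁ ≤ ‖z‖ → K z = m) (hm : π * ρ ^ 2 < m) :
    ∃ X : ℝ → C2, (∀ t, HasDerivAt X (Complex.I • K' (X t)) t) ∧ (∀ t, X (t + 1) = X t) ∧
      (∀ t, ‖X t‖ ≤ ρ₁) ∧ ∃ t, K' (X t) ≠ 0 := by
  have hpi := pi_pos
  have hρ0 : 0 < ρ := hρ₁.trans hρ
  obtain ⟨ε, hε, hε2, hεm⟩ : ∃ ε > 0, ε ≤ π / 2 ∧ (π + ε) * (ρ ^ 2 + (2 * ε) / 2) ≤ m := by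
    refine ⟨min (π / 2) ((m - π * ρ ^ 2) / (2 * π + ρ ^ 2)), ?_, min_le_left _ _, ?_⟩
    · exact lt_min (by positivity) (div_pos (by linarith) (by positivity))
    · set ε := min (π / 2) ((m - π * ρ ^ 2) / (2 * π + ρ ^ 2)) with hε
      have h1 : ε ≤ π / 2 := min_le_left _ _
      have h2 : ε ≤ (m - π * ρ ^ 2) / (2 * π + ρ ^ 2) := min_le_right _ _
      have h3 : 0 < ε := lt_min (by positivity) (div_pos (by linarith) (by positivity))
      rw [le_div_iff₀ (by positivity)] at h2
      nlinarith
  set A : ℝ := π + ε with hA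
  set κ : ℝ := 2 * ε with hκ
  have hκ0 : 0 < κ := by positivity
  have hA0 : 0 < A := by positivity
  have hKc : Continuous K := continuous_iff_continuousAt.2 fun z => (hK z).hasFDerivAt.continuousAt
  set h := radialProfile A (ρ ^ 2) κ with hh
  set h' := radialSlope A (ρ ^ 2) κ with hh'
  set H : C2 → ℝ := fun z => K z + h (‖z‖ ^ 2) with hHdef
  set H' : C2 → C2 := fun z => K' z + (2 * h' (‖z‖ ^ 2)) • z with hH'def
  set r : C2 → C2 := fun z => K' z + (2 * h' (‖z‖ ^ 2) - 2 * A) • z with hr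
  have hK'out : ∀ z, ρ₁ < ‖z‖ → K' z = 0 := by
    intro z hz
    have h1 : K =ᶠ[𝓝 z] fun _ => m := by
      filter_upwards [(isOpen_lt continuous_const continuous_norm).mem_nhds hz] with w hw
      exact hKm w hw.le
    exact (hK z).unique ((hasGradientAt_const z m).congr_of_eventuallyEq h1)
  have hH : ∀ z, HasGradientAt H (H' z) z := by
    intro z
    have h1 := (hK z).hasFDerivAt.add
      (hasGradientAt_radial (hasDerivAt_radialProfile (A := A) (a := ρ ^ 2) hκ0) z).hasFDerivAt
    rw [hasGradientAt_iff_hasFDerivAt, hH'def, map_add]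
    exact h1
  have hh'c : Continuous h' := continuous_radialSlope _ _ _
  have hrc : Continuous r := by
    rw [hr]
    have : Continuous fun z : C2 => 2 * h' (‖z‖ ^ 2) - 2 * A :=
      (continuous_const.mul (hh'c.comp (continuous_norm.pow 2))).fun_sub continuous_const
    exact hK'c.fun_add (this.smul continuous_id)
  have hrsupp : HasCompactSupport r := by
    refine HasCompactSupport.of_support_subset_isCompact
      (isCompact_closedBall (0 : C2) (ρ + κ + 1)) fun z hz => ?_
    rw [mem_closedBall_zero_iff]
    by_contra! hlt
    refine hz ?_
    have h1 : ρ ^ 2 + κ ≤ ‖z‖ ^ 2 := by nlinarith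
    rw [hr]
    simp only
    rw [hK'out z (by linarith), hh', radialSlope_of_ge hκ0 h1]
    simp
  have hruc : UniformContinuous r := hrsupp.uniformContinuous_of_continuous hrc
  obtain ⟨B, hB⟩ := hrsupp.exists_bound_of_continuous hrc
  have hH' : ∀ z, H' z = (2 * A) • z + r z := by
    intro z
    simp only [hH'def, hr, sub_smul]
    abel
  have hlow : ∀ z, A * ‖z‖ ^ 2 - A * (ρ ^ 2 + κ / 2) ≤ H z := by
    intro z
    have := le_radialProfile hA0.le hκ0 (a := ρ ^ 2) (‖z‖ ^ 2)
    have := hK0 z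
    simp only [hHdef]
    linarith
  have hnn : ∀ z, 0 ≤ H z := fun z => add_nonneg (hK0 z) (radialProfile_nonneg hA0.le hκ0 _)
  obtain ⟨Mk, hMk⟩ : ∃ Mk, ∀ z, K z ≤ Mk := by
    obtain ⟨b, hb⟩ := (isCompact_closedBall (0 : C2) ρ₁).bddAbove_image hKc.continuousOn
    refine ⟨max b m, fun z => ?_⟩
    rcases le_total ‖z‖ ρ₁ with hz | hz
    · exact (hb ⟨z, mem_closedBall_zero_iff.2 hz, rfl⟩).trans (le_max_left _ _)
    · exact (hKm z hz).le.trans (le_max_right _ _)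
  have hMk0 : 0 ≤ Mk := (hK0 0).trans (hMk 0)
  set C : ℝ := (Mk + 2 * A * ‖z₀‖ ^ 2) / r₀ ^ 4 + 2 * A / r₀ ^ 2 with hC
  have hC0 : 0 < C := by positivity
  have hquart : ∀ z, H (z₀ + z) ≤ C * ‖z‖ ^ 4 := by
    intro z
    rcases lt_or_ge ‖z‖ r₀ with hz | hz
    · have hb : z₀ + z ∈ Metric.ball z₀ r₀ := by simpa [Metric.mem_ball, dist_eq_norm] using hz
      have h1 : K (z₀ + z) = 0 := hKz _ hb
      have h2 : ‖z₀ + z‖ < ρ := by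
        by_contra! hge
        rw [hKm _ (hρ.le.trans hge)] at h1
        have : 0 < π * ρ ^ 2 := by positivity
        linarith
      have h3 : h (‖z₀ + z‖ ^ 2) = 0 :=
        radialProfile_of_le hκ0 (pow_le_pow_left₀ (norm_nonneg _) h2.le 2)
      simp only [hHdef]
      rw [h1, h3, add_zero]
      positivity
    · have h1 := hMk (z₀ + z)
      have h2 : h (‖z₀ + z‖ ^ 2) ≤ A * ‖z₀ + z‖ ^ 2 :=
        radialProfile_le hA0.le (by positivity) hκ0 (by positivity)
      have h3 : ‖z₀ + z‖ ^ 2 ≤ 2 * ‖z₀‖ ^ 2 + 2 * ‖z‖ ^ 2 := by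
        have := pow_le_pow_left₀ (norm_nonneg _) (norm_add_le z₀ z) 2
        nlinarith [sq_nonneg (‖z₀‖ - ‖z‖)]
      have h4 : Mk + 2 * A * ‖z₀‖ ^ 2 ≤ (Mk + 2 * A * ‖z₀‖ ^ 2) / r₀ ^ 4 * ‖z‖ ^ 4 := by
        rw [div_mul_eq_mul_div, le_div_iff₀ (by positivity)]
        gcongr
      have h5 : 2 * A * ‖z‖ ^ 2 ≤ 2 * A / r₀ ^ 2 * ‖z‖ ^ 4 := by
        rw [div_mul_eq_mul_div, le_div_iff₀ (by positivity)]
        have : r₀ ^ 2 ≤ ‖z‖ ^ 2 := pow_le_pow_left₀ hr₀.le hz 2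
        calc 2 * A * ‖z‖ ^ 2 * r₀ ^ 2 ≤ 2 * A * ‖z‖ ^ 2 * ‖z‖ ^ 2 := by gcongr
          _ = _ := by ring
      simp only [hHdef]
      rw [hC, add_mul]
      nlinarith
  obtain ⟨x, hx, hxpos⟩ := exists_weak_critical_loop hH hruc hB hH' hε hA hε2 hlow hnn hC0 hquart
  have hH'c : Continuous H' := by
    rw [funext hH']
    exact (continuous_id.fun_const_smul (2 * A)).fun_add hrc
  set X : ℝ → C2 := fun t => x (t : UnitAddCircle) with hX
  have hXd : ∀ t, HasDerivAt X (Complex.I • H' (X t)) t := fun t =>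
    hasDerivAt_C2_of_fourierCoeff (u := x) (v := ⟨fun t => H' (x t), hH'c.comp (map_continuous x)⟩)
      hx t
  obtain ⟨t₀, ht₀⟩ : ∃ t : ℝ, 0 < inner ℝ (X t) (H' (X t)) / 2 - H (X t) := by
    by_contra! hle
    refine hxpos.not_ge (integral_nonpos fun t => ?_)
    obtain ⟨τ, rfl⟩ := QuotientAddGroup.mk_surjective t
    exact hle τ
  have hout : ∀ z, ρ₁ < ‖z‖ → inner ℝ z (H' z) / 2 - H z ≤ 0 := by
    intro z hz
    simp only [hHdef, hH'def]
    rw [hK'out z hz, hKm z hz.le, zero_add, real_inner_smul_right, real_inner_self_eq_norm_sq]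
    have := mul_radialSlope_sub_le hA0.le (sq_nonneg ρ) hκ0 (‖z‖ ^ 2)
    linarith
  have ht₀ρ : ‖X t₀‖ ≤ ρ₁ := by
    by_contra! hlt
    exact (hout _ hlt).not_gt ht₀
  have hconf : ∀ t, ‖X t‖ ≤ ρ₁ := by
    set φ : ℝ → ℝ := fun t => max (‖X t‖ ^ 2 - ρ₁ ^ 2) 0 ^ 2 with hφ
    have hφd : ∀ t, HasDerivAt φ 0 t := by
      intro t
      have h1 := (hasDerivAt_sq_max (‖X t‖ ^ 2 - ρ₁ ^ 2)).comp t
        ((hXd t).norm_sq.sub_const (ρ₁ ^ 2))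
      refine h1.congr_deriv ?_
      rcases le_or_gt ‖X t‖ ρ₁ with hle | hlt
      · rw [max_eq_right (by nlinarith [norm_nonneg (X t)])]; simp
      · simp only [hH'def]
        rw [hK'out _ hlt, zero_add, smul_comm, real_inner_smul_right, real_inner_C2_I_smul_self]
        simp
    have hconst : ∀ t, φ t = φ t₀ := fun t =>
      is_const_of_deriv_eq_zero (fun t => (hφd t).differentiableAt) (fun t => (hφd t).deriv) t t₀
    have hφ0 : φ t₀ = 0 := by
      simp only [hφ]
      rw [max_eq_right (by nlinarith [norm_nonneg (X t₀)])]
      simp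
    intro t
    by_contra! hlt
    have h1 := (hconst t).trans hφ0
    simp only [hφ] at h1
    have h2 : 0 < ‖X t‖ ^ 2 - ρ₁ ^ 2 := by nlinarith
    rw [max_eq_left h2.le] at h1
    exact (pow_pos h2 2).ne' h1
  have hHK : ∀ t, H' (X t) = K' (X t) := by
    intro t
    have h1 : ‖X t‖ ^ 2 ≤ ρ ^ 2 := pow_le_pow_left₀ (norm_nonneg _) ((hconf t).trans hρ.le) 2
    simp only [hH'def]
    rw [hh', radialSlope_of_le hκ0 h1]
    simp
  refine ⟨X, fun t => ?_, fun t => ?_, hconf, t₀, fun h0 => ?_⟩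
  · rw [← hHK]
    exact hXd t
  · simp only [hX]
    rw [AddCircle.coe_add_period]
  · rw [← hHK] at h0
    rw [h0, inner_zero_right, zero_div, zero_sub] at ht₀
    linarith [hnn (X t₀)]

end HoferZehnder

section LineIntegral

variable {V : Type*} [NormedAddCommGroup V] [NormedSpace ℝ V]

lemma hasFDerivAt_integral_segment [CompleteSpace V] {F : R4 → V} (hF : ContDiff ℝ 1 F)
    (a b : ℝ) (A : R4 →L[ℝ] R4) (e x : R4) :
    HasFDerivAt (fun x => ∫ s in a..b, F (A x + s • e))
      (∫ s in a..b, (fderiv ℝ F (A x + s • e)).comp A) x := by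
  have hc : Continuous (Function.uncurry fun (y : R4) (s : ℝ) =>
      (fderiv ℝ F (A y + s • e)).comp A) := by
    have := hF.continuous_fderiv one_ne_zero
    unfold Function.uncurry
    fun_prop
  have hF' := hF.continuous
  obtain ⟨C, hC⟩ := ((isCompact_closedBall x (1 : ℝ)).prod
    (isCompact_uIcc (a := a) (b := b))).exists_bound_of_continuousOn hc.continuousOn
  refine intervalIntegral.hasFDerivAt_integral_of_dominated_of_fderiv_le
    (F' := fun y s => (fderiv ℝ F (A y + s • e)).comp A) (bound := fun _ => C)
    (Metric.closedBall_mem_nhds x one_pos) (Filter.Eventually.of_forall fun y => ?_) ?_ ?_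
    (Filter.Eventually.of_forall fun s hs y hy => hC (y, s) ⟨hy, Set.uIoc_subset_uIcc hs⟩)
    intervalIntegrable_const (Filter.Eventually.of_forall fun s _ y _ => ?_)
  · exact (by fun_prop : Continuous fun s : ℝ => F (A y + s • e)).aestronglyMeasurable
  · exact (by fun_prop : Continuous fun s : ℝ => F (A x + s • e)).intervalIntegrable _ _
  · exact (hc.comp (Continuous.prodMk_right x)).aestronglyMeasurable
  · exact ((hF.differentiable one_ne_zero) _).hasFDerivAt.comp y
      (A.hasFDerivAt.add_const (s • e))

lemma contDiff_integral_segment [CompleteSpace V] {F : R4 → V} (hF : ContDiff ℝ 1 F)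
    (a b : ℝ) (A : R4 →L[ℝ] R4) (e : R4) :
    ContDiff ℝ 1 (fun x => ∫ s in a..b, F (A x + s • e)) := by
  rw [contDiff_one_iff_fderiv]
  refine ⟨fun x => (hasFDerivAt_integral_segment hF a b A e x).differentiableAt, ?_⟩
  have : fderiv ℝ (fun x => ∫ s in a..b, F (A x + s • e)) =
      fun x => ∫ s in a..b, (fderiv ℝ F (A x + s • e)).comp A :=
    funext fun x => (hasFDerivAt_integral_segment hF a b A e x).fderiv
  rw [this]
  refine intervalIntegral.continuous_parametric_intervalIntegral_of_continuous' ?_ a b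
  have := hF.continuous_fderiv one_ne_zero
  unfold Function.uncurry
  fun_prop

lemma integral_fderiv_segment {F : R4 → V} [CompleteSpace V] (hF : ContDiff ℝ 1 F)
    (a b : ℝ) (y e : R4) :
    ∫ s in a..b, fderiv ℝ F (y + s • e) e = F (y + b • e) - F (y + a • e) := by
  refine intervalIntegral.integral_eq_sub_of_hasDerivAt (f := fun s : ℝ => F (y + s • e))
    (fun s _ => ?_) ?_
  · have h1 : HasDerivAt (fun s : ℝ => y + s • e) e s := by
      simpa using ((hasDerivAt_id s).smul_const e).const_add y
    exact ((hF.differentiable one_ne_zero) _).hasFDerivAt.comp_hasDerivAt s h1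
  · have := hF.continuous_fderiv one_ne_zero
    exact (by fun_prop : Continuous fun s : ℝ => fderiv ℝ F (y + s • e) e).intervalIntegrable _ _

end LineIntegral

/-- The square of the distance from `x` to the line spanned by the unit vector `e`. -/
def distSqLine (e x : R4) : ℝ := ‖x‖ ^ 2 - inner ℝ e x ^ 2

lemma distSqLine_nonneg {e : R4} (he : ‖e‖ ≤ 1) (x : R4) : 0 ≤ distSqLine e x := by
  rw [distSqLine, sub_nonneg, sq_le_sq, abs_of_nonneg (norm_nonneg x)]
  exact (abs_real_inner_le_norm e x).trans (mul_le_of_le_one_left (norm_nonneg x) he)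

lemma exists_ortho_three (a b c : R4) :
    ∃ w : R4, ‖w‖ = 1 ∧ inner ℝ a w = 0 ∧ inner ℝ b w = 0 ∧ inner ℝ c w = 0 := by
  have hfin : Module.finrank ℝ (Submodule.span ℝ (Set.range ![a, b, c])) ≤ 3 := by
    exact finrank_range_le_card (R := ℝ) ![a, b, c]
  have hsum := Submodule.finrank_add_finrank_orthogonal (Submodule.span ℝ (Set.range ![a, b, c]))
  rw [finrank_euclideanSpace_fin] at hsum
  have hpos : 0 < Module.finrank ℝ (Submodule.span ℝ (Set.range ![a, b, c]))ᗮ := by omega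
  have := Module.finrank_pos_iff.1 hpos
  obtain ⟨⟨w, hw⟩, hw0⟩ := exists_ne (0 : (Submodule.span ℝ (Set.range ![a, b, c]))ᗮ)
  have hw0' : w ≠ 0 := fun h => hw0 (Subtype.ext h)
  have hmem : ∀ i, inner ℝ (![a, b, c] i) (‖w‖⁻¹ • w) = 0 := fun i => by
    rw [inner_smul_right, (Submodule.mem_orthogonal _ _).1 hw _
      (Submodule.subset_span (Set.mem_range_self i)), mul_zero]
  exact ⟨‖w‖⁻¹ • w, norm_smul_inv_norm hw0', hmem 0, hmem 1, hmem 2⟩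

lemma eq_of_fderiv_eq_zero_of_distSqLine {f : R4 → ℝ} (hf : Differentiable ℝ f) {e : R4}
    (he : ‖e‖ ≤ 1) {r : ℝ} (h0 : ∀ x, r ^ 2 ≤ distSqLine e x → fderiv ℝ f x = 0) {a b : R4}
    (ha : r ^ 2 ≤ distSqLine e a) (hb : r ^ 2 ≤ distSqLine e b) : f a = f b := by
  have hseg : ∀ p q : R4, (∀ t ∈ Set.Icc (0 : ℝ) 1, r ^ 2 ≤ distSqLine e (p + t • (q - p))) →
      f p = f q := by
    intro p q h
    have hd : ∀ t : ℝ, HasDerivAt (fun t : ℝ => f (p + t • (q - p)))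
        (fderiv ℝ f (p + t • (q - p)) (q - p)) t := fun t => by
      have h1 : HasDerivAt (fun t : ℝ => p + t • (q - p)) (q - p) t := by
        simpa using ((hasDerivAt_id t).smul_const (q - p)).const_add p
      exact (hf _).hasFDerivAt.comp_hasDerivAt t h1
    have := constant_of_has_deriv_right_zero (a := 0) (b := 1)
      (fun t _ => (hd t).continuousAt.continuousWithinAt) (fun t ht => by
        have := (hd t).hasDerivWithinAt (s := Set.Ici t)
        rwa [h0 _ (h t ⟨ht.1, ht.2.le⟩), zero_apply] at this) 1 (by simp)
    simpa using this.symm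
  obtain ⟨w, hw, hwe, hwa, hwb⟩ := exists_ortho_three e a b
  have key : ∀ p : R4, inner ℝ p w = 0 → ∀ t : ℝ,
      distSqLine e (p + t • w) = distSqLine e p + t ^ 2 := by
    intro p hp t
    rw [distSqLine, distSqLine, norm_add_sq_real, inner_smul_right, hp, norm_smul, hw,
      inner_add_right, inner_smul_right, hwe, Real.norm_eq_abs, mul_one, sq_abs]
    ring
  have hup : ∀ p : R4, inner ℝ p w = 0 → r ^ 2 ≤ distSqLine e p → f p = f (p + r • w) := by
    intro p hp hpr
    refine hseg _ _ fun t ht => ?_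
    rw [add_sub_cancel_left, smul_smul, key p hp]
    nlinarith [sq_nonneg (t * r)]
  rw [hup a hwa ha, hup b hwb hb]
  refine hseg _ _ fun t _ => ?_
  have h1 : a + r • w + t • (b + r • w - (a + r • w)) = (a + t • (b - a)) + r • w := by module
  rw [h1, key _ (by simp [inner_add_left, inner_smul_left, inner_sub_left, hwa, hwb])]
  linarith [distSqLine_nonneg he (a + t • (b - a))]

lemma exists_compactly_supported_primitive {β : R4 → R4 →L[ℝ] ℝ} (hβ : Differentiable ℝ β)
    (hcl : ∀ x u v, fderiv ℝ β x u v = fderiv ℝ β x v u) {ρ : ℝ} (hρ : 0 ≤ ρ)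
    (hsupp : ∀ x, ρ ≤ ‖x‖ → β x = 0) :
    ∃ G : R4 → ℝ, (∀ x, HasFDerivAt G (β x) x) ∧ ∀ x, ρ ≤ ‖x‖ → G x = 0 := by
  obtain ⟨f, hf⟩ := convex_univ.exists_forall_hasFDerivAt_of_fderiv_symmetric isOpen_univ
    hβ.differentiableOn (fun a _ => hcl a)
  have hd : ∀ x : R4, distSqLine 0 x = ‖x‖ ^ 2 := fun x => by simp [distSqLine]
  obtain ⟨p, hp, -⟩ := exists_ortho_three 0 0 0
  refine ⟨fun x => f x - f (ρ • p), fun x => (hf x trivial).sub_const _, fun x hx => ?_⟩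
  rw [sub_eq_zero]
  refine eq_of_fderiv_eq_zero_of_distSqLine (e := 0) (r := ρ)
    (fun x => (hf x trivial).differentiableAt) (by simp)
    (fun x hx => ?_) ?_ ?_
  · rw [hd] at hx
    rw [(hf x trivial).fderiv, hsupp x (le_of_sq_le_sq hx (norm_nonneg x))]
  · rw [hd]; gcongr
  · rw [hd, norm_smul, hp, mul_one, Real.norm_eq_abs, sq_abs]

/-- The projection of ℝ⁴ along `e`, orthogonal when `e` is a unit vector. -/
def projAlong (e : R4) : R4 →L[ℝ] R4 := ContinuousLinearMap.id ℝ R4 - (innerSL ℝ e).smulRight e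

lemma projAlong_apply (e x : R4) : projAlong e x = x - inner ℝ e x • e := by
  simp [projAlong]

lemma norm_sq_projAlong_add {e : R4} (he : ‖e‖ = 1) (x : R4) (s : ℝ) :
    ‖projAlong e x + s • e‖ ^ 2 = distSqLine e x + s ^ 2 := by
  have h1 : inner ℝ (projAlong e x) (s • e) = 0 := by
    rw [projAlong_apply, inner_smul_right, inner_sub_left, real_inner_smul_left,
      real_inner_self_eq_norm_sq, he, real_inner_comm]
    ring
  rw [norm_add_sq_real, h1, norm_smul, he, projAlong_apply, norm_sub_sq_real, norm_smul, he,
    real_inner_smul_right, real_inner_comm e x, distSqLine, Real.norm_eq_abs, Real.norm_eq_abs,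
    mul_one, mul_one, sq_abs, sq_abs]
  ring

section TwoForm

set_option maxSynthPendingDepth 3

variable {η : R4 → R4 →L[ℝ] R4 →L[ℝ] ℝ}

lemma contDiff_apply_vector (hη : ContDiff ℝ 1 η) (e : R4) : ContDiff ℝ 1 (fun y => η y e) :=
  hη.clm_apply contDiff_const

lemma fderiv_apply_vector (hη : ContDiff ℝ 1 η) (e y u : R4) :
    fderiv ℝ (fun y => η y e) y u = fderiv ℝ η y u e := by
  rw [fderiv_clm_apply (hη.differentiable one_ne_zero y) (differentiableAt_const e)]
  simp

lemma integral_fderiv_antisymm (hη : ContDiff ℝ 1 η) (halt : ∀ x u v, η x u v = - η x v u)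
    (hcl : ∀ x u v w, fderiv ℝ η x u v w + fderiv ℝ η x v w u + fderiv ℝ η x w u v = 0)
    (a b : ℝ) (y e u v : R4) :
    (∫ s in a..b, fderiv ℝ (fun y => η y e) (y + s • e)) u v
      - (∫ s in a..b, fderiv ℝ (fun y => η y e) (y + s • e)) v u
      = η (y + b • e) u v - η (y + a • e) u v := by
  have hc := (contDiff_apply_vector hη e).continuous_fderiv one_ne_zero
  have h_int : IntervalIntegrable (fun s : ℝ => fderiv ℝ (fun y => η y e) (y + s • e))
      MeasureTheory.volume a b := (by fun_prop : Continuous _).intervalIntegrable _ _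
  have hval : ∀ p q : R4, (∫ s in a..b, fderiv ℝ (fun y => η y e) (y + s • e)) p q
      = ∫ s in a..b, fderiv ℝ η (y + s • e) p e q := by
    intro p q
    have h1 := ContinuousLinearMap.intervalIntegral_apply h_int p
    rw [h1]
    have h2 : (∫ s in a..b, fderiv ℝ (fun y => η y e) (y + s • e) p) q =
        ∫ s in a..b, fderiv ℝ (fun y => η y e) (y + s • e) p q :=
      ContinuousLinearMap.intervalIntegral_apply
        ((by fun_prop : Continuous fun s : ℝ =>
          fderiv ℝ (fun y => η y e) (y + s • e) p).intervalIntegrable _ _) q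
    rw [h2]
    simp only [fderiv_apply_vector hη]
  have hc2 := hη.continuous_fderiv one_ne_zero
  have hii : ∀ p q : R4, IntervalIntegrable (fun s : ℝ => fderiv ℝ η (y + s • e) p e q)
      MeasureTheory.volume a b := fun p q =>
    (by fun_prop : Continuous fun s : ℝ => fderiv ℝ η (y + s • e) p e q).intervalIntegrable _ _
  rw [hval, hval, ← intervalIntegral.integral_sub (hii u v) (hii v u)]
  have hantisymm : ∀ x p u v, fderiv ℝ η x p u v = - fderiv ℝ η x p v u := by
    intro x p u v
    have h1 : ∀ u v, fderiv ℝ (fun x => η x u v) x p = fderiv ℝ η x p u v := by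
      intro u v
      rw [fderiv_clm_apply ((contDiff_apply_vector hη u).differentiable one_ne_zero x)
        (differentiableAt_const v)]
      simp [fderiv_apply_vector hη]
    rw [← h1, ← h1, ← neg_apply, ← fderiv_neg]
    congr 2
    exact funext fun y => halt y u v
  have h3 : ∀ s : ℝ, fderiv ℝ η (y + s • e) u e v - fderiv ℝ η (y + s • e) v e u
      = fderiv ℝ η (y + s • e) e u v := by
    intro s
    have := hcl (y + s • e) u v e
    rw [hantisymm _ u e v]
    linarith
  simp only [h3]
  have hF : ContDiff ℝ 1 (fun y => η y u v) := (contDiff_apply_vector hη u).clm_apply contDiff_const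
  rw [← integral_fderiv_segment hF a b y e]
  congr 1
  ext s
  rw [fderiv_clm_apply ((contDiff_apply_vector hη u).differentiable one_ne_zero _)
        (differentiableAt_const v)]
  simp [fderiv_apply_vector hη]

end TwoForm

section TwoFormPrimitive

set_option maxSynthPendingDepth 3

lemma contDiff_two_of_hasFDerivAt {f : R4 → ℝ} {κ : R4 → R4 →L[ℝ] ℝ}
    (hf : ∀ x, HasFDerivAt f (κ x) x) (hκ : ContDiff ℝ 1 κ) : ContDiff ℝ 2 f := by
  have h : fderiv ℝ f = κ := funext fun x => (hf x).fderiv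
  have : ContDiff ℝ (1 + 1) f :=
    contDiff_succ_iff_fderiv.2 ⟨fun x => (hf x).differentiableAt, by simp, by rwa [h]⟩
  rwa [one_add_one_eq_two] at this

variable {η : R4 → R4 →L[ℝ] R4 →L[ℝ] ℝ}

lemma exists_fiber_integral_primitive (hη : ContDiff ℝ 1 η)
    (halt : ∀ x u v, η x u v = - η x v u)
    (hcl : ∀ x u v w, fderiv ℝ η x u v w + fderiv ℝ η x v w u + fderiv ℝ η x w u v = 0)
    {ρ₁ : ℝ} (hρ₁ : 0 < ρ₁) (hsupp : ∀ x, ρ₁ ≤ ‖x‖ → η x = 0) {e : R4} (he : ‖e‖ = 1)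
    {L : ℝ} (hL : ρ₁ ≤ L) :
    ∃ f : R4 → ℝ, ContDiff ℝ 2 f ∧
      (∀ x, fderiv ℝ f x = (∫ s in (-L)..L, η (projAlong e x + s • e) e).comp (projAlong e)) ∧
      ∀ x, ρ₁ ^ 2 ≤ distSqLine e x → f x = 0 := by
  set P := projAlong e with hP
  have hF : ContDiff ℝ 1 (fun y => η y e) := contDiff_apply_vector hη e
  set κ : R4 → R4 →L[ℝ] ℝ := fun x => (∫ s in (-L)..L, η (P x + s • e) e).comp P with hκ
  have hκc : ContDiff ℝ 1 κ := (contDiff_integral_segment hF (-L) L P e).clm_comp contDiff_const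
  have hfar : ∀ x (s : ℝ), ρ₁ ^ 2 ≤ distSqLine e x + s ^ 2 → η (P x + s • e) = 0 := by
    intro x s h
    rw [← norm_sq_projAlong_add he] at h
    exact hsupp _ (le_of_sq_le_sq h (norm_nonneg _))
  have hDκ : ∀ x u v, fderiv ℝ κ x u v =
      (∫ s in (-L)..L, fderiv ℝ (fun y => η y e) (P x + s • e)) (P u) (P v) := by
    intro x u v
    have h1 := ((hasFDerivAt_integral_segment hF (-L) L P e x).clm_comp
      (hasFDerivAt_const P x)).fderiv
    rw [hκ, h1]
    have hc := hF.continuous_fderiv one_ne_zero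
    have h2 : (∫ s in (-L)..L, (fderiv ℝ (fun y => η y e) (P x + s • e)).comp P) u =
        ∫ s in (-L)..L, fderiv ℝ (fun y => η y e) (P x + s • e) (P u) :=
      ContinuousLinearMap.intervalIntegral_apply
        ((by fun_prop : Continuous fun s : ℝ =>
          (fderiv ℝ (fun y => η y e) (P x + s • e)).comp P).intervalIntegrable _ _) u
    have h3 : (∫ s in (-L)..L, fderiv ℝ (fun y => η y e) (P x + s • e)) (P u) =
        ∫ s in (-L)..L, fderiv ℝ (fun y => η y e) (P x + s • e) (P u) :=
      ContinuousLinearMap.intervalIntegral_apply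
        ((by fun_prop : Continuous fun s : ℝ =>
          fderiv ℝ (fun y => η y e) (P x + s • e)).intervalIntegrable _ _) (P u)
    simp [h2, h3]
  have hκcl : ∀ x u v, fderiv ℝ κ x u v = fderiv ℝ κ x v u := by
    intro x u v
    rw [← sub_eq_zero, hDκ, hDκ, integral_fderiv_antisymm hη halt hcl]
    have h0 := distSqLine_nonneg he.le x
    rw [hfar x L (by nlinarith), hfar x (-L) (by nlinarith)]
    simp
  obtain ⟨f, hf⟩ := convex_univ.exists_forall_hasFDerivAt_of_fderiv_symmetric isOpen_univ
    (hκc.differentiable one_ne_zero).differentiableOn (fun a _ => hκcl a)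
  obtain ⟨w, hw, hwe, -⟩ := exists_ortho_three e 0 0
  refine ⟨fun x => f x - f (ρ₁ • w), contDiff_two_of_hasFDerivAt
    (fun x => (hf x trivial).sub_const _) hκc, fun x => ((hf x trivial).sub_const _).fderiv,
    fun x hx => sub_eq_zero.2 ?_⟩
  refine eq_of_fderiv_eq_zero_of_distSqLine (e := e) (r := ρ₁)
    (fun x => (hf x trivial).differentiableAt) he.le (fun x hx => ?_) hx ?_
  · rw [(hf x trivial).fderiv, hκ]
    have : ∀ s : ℝ, η (P x + s • e) = 0 := fun s => hfar x s (by nlinarith [sq_nonneg s])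
    simp [this]
  · rw [distSqLine, inner_smul_right, hwe, norm_smul, hw, Real.norm_eq_abs, mul_one, sq_abs]
    simp

lemma exists_local_primitive_two_form (hη : ContDiff ℝ 1 η)
    (halt : ∀ x u v, η x u v = - η x v u)
    (hcl : ∀ x u v w, fderiv ℝ η x u v w + fderiv ℝ η x v w u + fderiv ℝ η x w u v = 0)
    {ρ₁ ρ₂ ρ : ℝ} (hρ₁ : 0 < ρ₁) (hρ₂ : ρ₁ < ρ₂) (hρ : ρ₂ < ρ)
    (hsupp : ∀ x, ρ₁ ≤ ‖x‖ → η x = 0) :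
    ∃ σ : R4 → R4 →L[ℝ] ℝ, ContDiff ℝ 1 σ ∧ (∀ x, ρ₂ < ‖x‖ → ‖x‖ < ρ → σ x = 0) ∧
      ∀ x, ‖x‖ < ρ → ∀ u v, fderiv ℝ σ x u v - fderiv ℝ σ x v u = η x u v := by
  obtain ⟨e, he, -⟩ := exists_ortho_three 0 0 0
  set L := ρ + ρ₁ with hL
  obtain ⟨f, hf, hdf, hf0⟩ := exists_fiber_integral_primitive hη halt hcl hρ₁ hsupp he
    (L := L) (by linarith)
  have hF : ContDiff ℝ 1 (fun y => η y e) := contDiff_apply_vector hη e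
  set h := √(ρ₂ ^ 2 - ρ₁ ^ 2) with hh
  have hhpos : 0 < h := Real.sqrt_pos.2 (by nlinarith)
  have hhsq : h ^ 2 = ρ₂ ^ 2 - ρ₁ ^ 2 := Real.sq_sqrt (by nlinarith)
  set χ : R4 → ℝ := fun x => Real.smoothTransition ((inner ℝ e x + h) / (2 * h)) with hχ
  have hχc : ContDiff ℝ 2 χ := by
    refine Real.smoothTransition.contDiff.comp ?_
    exact ((contDiff_const.inner ℝ contDiff_id).add contDiff_const).div_const _
  have hψ : ContDiff ℝ 2 (fun x => χ x * f x) := hχc.mul hf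
  have hdψ : ContDiff ℝ 1 (fderiv ℝ fun x => χ x * f x) :=
    hψ.fderiv_right (by rw [one_add_one_eq_two])
  have hσm : ContDiff ℝ 1 (fun x => ∫ s in (-L)..0, η (x + s • e) e) :=
    contDiff_integral_segment hF (-L) 0 (ContinuousLinearMap.id ℝ R4) e
  refine ⟨fun x => (∫ s in (-L)..0, η (x + s • e) e) - fderiv ℝ (fun x => χ x * f x) x,
    hσm.sub hdψ, ?_, ?_⟩
  · intro x hx2 hx
    have hd0 := distSqLine_nonneg he.le x
    have hdx : distSqLine e x = ‖x‖ ^ 2 - inner ℝ e x ^ 2 := rfl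
    have hx1 : |inner ℝ e x| ≤ ‖x‖ := by simpa [he] using abs_real_inner_le_norm e x
    rw [abs_le] at hx1
    have hxsq : ρ₂ ^ 2 < ‖x‖ ^ 2 := pow_lt_pow_left₀ hx2 (by linarith) two_ne_zero
    have hfar : ∀ s : ℝ, ρ₁ ^ 2 ≤ distSqLine e x + s ^ 2 → η (projAlong e x + s • e) = 0 := by
      intro s h
      rw [← norm_sq_projAlong_add he] at h
      exact hsupp _ (le_of_sq_le_sq h (norm_nonneg _))
    have hshift : ∫ s in (-L)..0, η (x + s • e) e =
        ∫ s in (inner ℝ e x - L)..(inner ℝ e x), η (projAlong e x + s • e) e := by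
      have h1 := intervalIntegral.integral_comp_add_left (a := -L) (b := 0)
        (fun s : ℝ => η (projAlong e x + s • e) e) (inner ℝ e x)
      rw [add_zero, ← sub_eq_add_neg] at h1
      rw [← h1]
      congr 1
      ext1 s
      rw [projAlong_apply]
      congr 2
      module
    have hprod : fderiv ℝ (fun x => χ x * f x) x = χ x • fderiv ℝ f x + f x • fderiv ℝ χ x :=
      fderiv_fun_mul (hχc.differentiable two_ne_zero x) (hf.differentiable two_ne_zero x)
    have hzero : ∀ a b : ℝ, (∀ s ∈ Set.uIcc a b, ρ₁ ^ 2 ≤ distSqLine e x + s ^ 2) →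
        ∫ s in a..b, η (projAlong e x + s • e) e = 0 := by
      intro a b hab
      rw [intervalIntegral.integral_congr (g := fun _ => 0) fun s hs => by
        simp [hfar s (hab s hs)]]
      simp
    have hcη := hη.continuous
    have hii : ∀ a b : ℝ, IntervalIntegrable (fun s : ℝ => η (projAlong e x + s • e) e)
        MeasureTheory.volume a b := fun a b =>
      (by fun_prop : Continuous fun s : ℝ => η (projAlong e x + s • e) e).intervalIntegrable _ _
    change (∫ s in (-L)..0, η (x + s • e) e) - fderiv ℝ (fun x => χ x * f x) x = 0
    rw [hshift, hprod, hdf]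
    rcases le_or_gt (ρ₁ ^ 2) (distSqLine e x) with hd | hd
    · rw [hzero _ _ fun s _ => by nlinarith [sq_nonneg s],
        hzero _ _ fun s _ => by nlinarith [sq_nonneg s], hf0 x hd]
      simp
    · have hx1h : h ^ 2 < inner ℝ e x ^ 2 := by linarith
      have hχ' : ∀ y, χ y = Real.smoothTransition ((inner ℝ e y + h) / (2 * h)) := fun y => rfl
      rcases lt_or_ge 0 (inner ℝ e x) with hpos | hneg
      · have hlt : h < inner ℝ e x := lt_of_pow_lt_pow_left₀ 2 hpos.le hx1h
        have hev : χ =ᶠ[nhds x] fun _ => 1 := by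
          filter_upwards [(continuous_const.inner continuous_id).continuousAt.eventually
            (lt_mem_nhds hlt)] with y hy
          rw [hχ', Real.smoothTransition.one_of_one_le]
          rw [le_div_iff₀ (by linarith)]
          change h < inner ℝ e y at hy
          linarith
        rw [hev.fderiv_eq, hev.eq_of_nhds]
        have h1 := intervalIntegral.integral_interval_sub_interval_comm' (hii (inner ℝ e x - L)
          (inner ℝ e x)) (hii (-L) L) (hii _ _)
        rw [hzero L (inner ℝ e x), hzero (-L) (inner ℝ e x - L), sub_zero, sub_eq_zero] at h1
        · rw [h1]
          ext v
          have hee : ∀ y, η y e e = 0 := fun y => by linarith [halt y e e]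
          have h2 : ∀ w, (∫ s in (-L)..L, η (projAlong e x + s • e) e) w =
            ∫ s in (-L)..L, η (projAlong e x + s • e) e w := fun w =>
              ContinuousLinearMap.intervalIntegral_apply (hii _ _) w
          simp [h2, projAlong_apply e v, hee]
        · intro s hs
          rw [Set.uIcc_of_le (by linarith)] at hs
          nlinarith [hs.1, hs.2]
        · intro s hs
          rw [Set.uIcc_of_ge (by linarith)] at hs
          nlinarith [hs.1, hs.2]
      · have hlt : inner ℝ e x < -h := by nlinarith
        have hev : χ =ᶠ[nhds x] fun _ => 0 := by
          filter_upwards [(continuous_const.inner continuous_id).continuousAt.eventually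
            (gt_mem_nhds hlt)] with y hy
          rw [hχ', Real.smoothTransition.zero_of_nonpos]
          change inner ℝ e y < -h at hy
          exact div_nonpos_of_nonpos_of_nonneg (by linarith) (by linarith)
        rw [hev.fderiv_eq, hev.eq_of_nhds, hzero]
        · simp
        · intro s hs
          rw [Set.uIcc_of_le (by linarith)] at hs
          nlinarith [hs.1, hs.2]
  · intro x hx u v
    have h1 : HasFDerivAt (fun x => ∫ s in (-L)..0, η (x + s • e) e)
        (∫ s in (-L)..0, fderiv ℝ (fun y => η y e) (x + s • e)) x :=
      hasFDerivAt_integral_segment hF (-L) 0 (ContinuousLinearMap.id ℝ R4) e x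
    have h2 := hdψ.differentiable one_ne_zero x
    have hsym : fderiv ℝ (fderiv ℝ fun x => χ x * f x) x u v =
        fderiv ℝ (fderiv ℝ fun x => χ x * f x) x v u :=
      (hψ.contDiffAt.isSymmSndFDerivAt (by simp)) u v
    rw [(h1.fun_sub h2.hasFDerivAt).fderiv]
    simp only [sub_apply, hsym, sub_sub_sub_cancel_right]
    rw [integral_fderiv_antisymm hη halt hcl, hsupp (x + (-L) • e)]
    · simp
    · have h3 := norm_sub_norm_le ((-L) • e) (-x)
      rw [norm_smul, he, norm_neg, norm_neg, Real.norm_eq_abs, abs_of_pos (by linarith),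
        sub_neg_eq_add, add_comm ((-L) • e)] at h3
      linarith

/-- The compactly supported Poincaré lemma for closed two-forms on ℝ⁴. -/
theorem exists_compactly_supported_primitive_two_form (hη : ContDiff ℝ 1 η)
    (halt : ∀ x u v, η x u v = - η x v u)
    (hcl : ∀ x u v w, fderiv ℝ η x u v w + fderiv ℝ η x v w u + fderiv ℝ η x w u v = 0)
    {ρ₁ ρ₂ : ℝ} (hρ₁ : 0 < ρ₁) (hρ₂ : ρ₁ < ρ₂) (hsupp : ∀ x, ρ₁ ≤ ‖x‖ → η x = 0) :
    ∃ σ : R4 → R4 →L[ℝ] ℝ, ContDiff ℝ 1 σ ∧ (∀ x, ρ₂ < ‖x‖ → σ x = 0) ∧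
      ∀ x u v, fderiv ℝ σ x u v - fderiv ℝ σ x v u = η x u v := by
  obtain ⟨σ, hσ, hσ0, hdσ⟩ := exists_local_primitive_two_form hη halt hcl hρ₁ hρ₂
    (lt_add_one ρ₂) hsupp
  classical
  set τ : R4 → R4 →L[ℝ] ℝ := fun x => if ‖x‖ < ρ₂ + 1 then σ x else 0 with hτ
  have hin : ∀ x, ‖x‖ < ρ₂ + 1 → τ =ᶠ[nhds x] σ := fun x hx => by
    filter_upwards [continuous_norm.continuousAt.eventually (gt_mem_nhds hx)] with y hy
    exact if_pos hy
  have hout' : ∀ x, ρ₂ < ‖x‖ → τ x = 0 := fun x hx => by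
    by_cases h : ‖x‖ < ρ₂ + 1
    · rw [hτ]; simp only [h, if_true]; exact hσ0 x hx h
    · exact if_neg h
  have hout : ∀ x, ρ₂ < ‖x‖ → τ =ᶠ[nhds x] fun _ => 0 := fun x hx => by
    filter_upwards [continuous_norm.continuousAt.eventually (lt_mem_nhds hx)] with y hy
    exact hout' y hy
  refine ⟨τ, contDiff_iff_contDiffAt.2 fun x => ?_, hout', fun x u v => ?_⟩
  · rcases lt_or_ge ‖x‖ (ρ₂ + 1) with hx | hx
    · exact hσ.contDiffAt.congr_of_eventuallyEq (hin x hx)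
    · exact contDiffAt_const.congr_of_eventuallyEq (hout x (by linarith))
  · rcases lt_or_ge ‖x‖ (ρ₂ + 1) with hx | hx
    · rw [(hin x hx).fderiv_eq, hdσ x hx]
    · rw [(hout x (by linarith)).fderiv_eq, hsupp x (by linarith)]
      simp

end TwoFormPrimitive

section Flow

variable {E : Type*} [NormedAddCommGroup E] [NormedSpace ℝ E]

lemma exists_global_solution [CompleteSpace E] {f : ℝ → E → E} {K C : NNReal}
    (hK : ∀ t, LipschitzWith K (f t)) (hc : ∀ x, Continuous fun t => f t x)
    (hC : ∀ t x, ‖f t x‖ ≤ C) (t₀ : ℝ) (x₀ : E) :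
    ∃ γ : ℝ → E, γ t₀ = x₀ ∧ ∀ t, HasDerivAt γ (f t (γ t)) t := by
  have hloc : ∀ n : ℕ, ∃ α : ℝ → E, α t₀ = x₀ ∧
      ∀ t ∈ Set.Ioo (t₀ - n) (t₀ + n), HasDerivAt α (f t (α t)) t := by
    intro n
    have hpl : IsPicardLindelof f (tmin := t₀ - n) (tmax := t₀ + n)
        ⟨t₀, by simp, by simp⟩ x₀ (C * n) 0 C K := by
      refine ⟨fun t _ => (hK t).lipschitzOnWith, fun x _ => (hc x).continuousOn,
        fun t _ x _ => hC t x, ?_⟩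
      simp
    obtain ⟨α, h0, hα⟩ := hpl.exists_eq_forall_mem_Icc_hasDerivWithinAt
      (Metric.mem_closedBall_self le_rfl)
    exact ⟨α, h0, fun t ht => (hα t ⟨ht.1.le, ht.2.le⟩).hasDerivAt (Icc_mem_nhds ht.1 ht.2)⟩
  choose α h0 hα using hloc
  have hmem : ∀ (n : ℕ) (t : ℝ), |t - t₀| < n → t ∈ Set.Ioo (t₀ - n) (t₀ + n) := by
    intro n t h
    rw [abs_lt] at h
    constructor <;> linarith
  have huniq : ∀ (n m : ℕ) (t : ℝ), |t - t₀| < n → n ≤ m → α n t = α m t := by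
    intro n m t ht hnm
    have hpos : (0 : ℝ) < n := (abs_nonneg _).trans_lt ht
    have hnm' : (n : ℝ) ≤ m := by exact_mod_cast hnm
    exact ODE_solution_unique_of_mem_Ioo (v := f) (s := fun _ => Set.univ) (K := K)
      (fun t _ => (hK t).lipschitzOnWith) (t₀ := t₀) (hmem n t₀ (by simpa using hpos))
      (fun s hs => ⟨hα n s hs, trivial⟩)
      (fun s hs => ⟨hα m s ⟨by linarith [hs.1], by linarith [hs.2]⟩, trivial⟩)
      ((h0 n).trans (h0 m).symm) (hmem n t ht)
  have hN : ∀ t : ℝ, |t - t₀| < (⌊|t - t₀|⌋₊ + 1 : ℕ) := fun t => by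
    exact_mod_cast Nat.lt_floor_add_one _
  refine ⟨fun t => α (⌊|t - t₀|⌋₊ + 1) t, h0 _, fun t => ?_⟩
  obtain ⟨n, hn⟩ := exists_nat_gt (|t - t₀| + 1)
  have hev : (fun s => α (⌊|s - t₀|⌋₊ + 1) s) =ᶠ[nhds t] α n := by
    have hcont : Continuous fun s : ℝ => |s - t₀| + 1 := by fun_prop
    filter_upwards [hcont.continuousAt.eventually (gt_mem_nhds hn)] with s hs
    refine huniq _ _ s (hN s) ?_
    have := Nat.floor_le (abs_nonneg (s - t₀))
    exact_mod_cast (by push_cast; linarith : ((⌊|s - t₀|⌋₊ + 1 : ℕ) : ℝ) ≤ n)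
  have h := (hα n t (hmem n t (by linarith))).congr_of_eventuallyEq hev
  have hval : α (⌊|t - t₀|⌋₊ + 1) t = α n t := hev.eq_of_nhds
  rw [← hval] at h
  exact h

lemma eq_of_solutions {f : ℝ → E → E} {K : NNReal} (hK : ∀ t, LipschitzWith K (f t))
    {γ₁ γ₂ : ℝ → E} (h₁ : ∀ t, HasDerivAt γ₁ (f t (γ₁ t)) t)
    (h₂ : ∀ t, HasDerivAt γ₂ (f t (γ₂ t)) t) {t₀ : ℝ} (h : γ₁ t₀ = γ₂ t₀) : γ₁ = γ₂ :=
  ODE_solution_unique_univ (v := f) (s := fun _ => Set.univ) (K := K)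
    (fun t => (hK t).lipschitzOnWith) (fun t => ⟨h₁ t, trivial⟩) (fun t => ⟨h₂ t, trivial⟩) h

lemma dist_solutions_le {f : ℝ → E → E} {K : NNReal} (hK : ∀ t, LipschitzWith K (f t))
    {γ₁ γ₂ : ℝ → E} (h₁ : ∀ t, HasDerivAt γ₁ (f t (γ₁ t)) t)
    (h₂ : ∀ t, HasDerivAt γ₂ (f t (γ₂ t)) t) {t : ℝ} (ht : 0 ≤ t) :
    dist (γ₁ t) (γ₂ t) ≤ dist (γ₁ 0) (γ₂ 0) * exp (K * t) := by
  have := dist_le_of_trajectories_ODE (v := f) (K := K) (a := 0) (b := t) hK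
    (fun s _ => (h₁ s).continuousAt.continuousWithinAt) (fun s _ => (h₁ s).hasDerivWithinAt)
    (fun s _ => (h₂ s).continuousAt.continuousWithinAt) (fun s _ => (h₂ s).hasDerivWithinAt)
    le_rfl t ⟨ht, le_rfl⟩
  simpa using this

/-- Existence of the solution of a linear equation on the unit time interval. -/
lemma exists_linear_solution [FiniteDimensional ℝ E] {A : ℝ → E →L[ℝ] E} (hA : Continuous A)
    {k : ℝ} (hk : ∀ t, ‖A t‖ ≤ k) (w₀ : E) :
    ∃ w : ℝ → E, w 0 = w₀ ∧ ∀ t ∈ Set.Icc (0 : ℝ) 1, HasDerivAt w (A t (w t)) t := by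
  have hk0 : 0 ≤ k := (norm_nonneg _).trans (hk 0)
  set R := ‖w₀‖ * exp k + 1 with hR
  have hR0 : 0 < R := by positivity
  let χ : ContDiffBump (0 : E) := ⟨R, R + 1, hR0, lt_add_one R⟩
  set c : E → E := fun w => χ w • w with hcdef
  have hcs : HasCompactSupport c := χ.hasCompactSupport.smul_right
  have hcd : ContDiff ℝ 1 c := χ.contDiff.smul contDiff_id
  obtain ⟨K, hK⟩ := hcd.lipschitzWith_of_hasCompactSupport hcs one_ne_zero
  obtain ⟨C, hC⟩ := hcs.exists_bound_of_continuous hcd.continuous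
  have hC0 : 0 ≤ C := (norm_nonneg _).trans (hC 0)
  have hAK : ∀ t, LipschitzWith (k.toNNReal * K) fun w => A t (c w) := fun t =>
    ((A t).lipschitz.weaken (by
      rw [← NNReal.coe_le_coe, coe_nnnorm, Real.coe_toNNReal k hk0]; exact hk t)).comp hK
  obtain ⟨w, hw0, hw⟩ := exists_global_solution (f := fun t w => A t (c w)) hAK
    (fun x => hA.clm_apply continuous_const) (C := k.toNNReal * C.toNNReal)
    (fun t x => by
      push_cast
      rw [Real.coe_toNNReal k hk0, Real.coe_toNNReal C hC0]
      exact ((A t).le_opNorm _).trans (mul_le_mul (hk t) (hC x) (norm_nonneg _) hk0)) 0 w₀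
  refine ⟨w, hw0, fun t ht => ?_⟩
  have hcn : ∀ x, ‖c x‖ ≤ ‖x‖ := fun x => by
    rw [hcdef]
    simp only [norm_smul, Real.norm_eq_abs, abs_of_nonneg χ.nonneg]
    exact mul_le_of_le_one_left (norm_nonneg x) χ.le_one
  have hb : ‖w t‖ ≤ ‖w₀‖ * exp k := by
    have := norm_le_gronwallBound_of_norm_deriv_right_le (f := w) (f' := fun t => A t (c (w t)))
      (δ := ‖w₀‖) (K := k) (ε := 0) (a := 0) (b := 1)
      (fun s _ => (hw s).continuousAt.continuousWithinAt) (fun s _ => (hw s).hasDerivWithinAt)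
      (by rw [hw0]) (fun s _ => by
        rw [add_zero]
        exact ((A s).le_opNorm _).trans (mul_le_mul (hk s) (hcn _) (norm_nonneg _) hk0)) t ht
    rw [gronwallBound_ε0] at this
    refine this.trans (mul_le_mul_of_nonneg_left (exp_le_exp.2 ?_) (norm_nonneg _))
    nlinarith [ht.2]
  have h := hw t
  have h1 : c (w t) = w t := by
    have : χ (w t) = 1 := χ.one_of_mem_closedBall (by
      rw [mem_closedBall_zero_iff]
      change ‖w t‖ ≤ R
      linarith)
    rw [hcdef]
    simp only [this, one_smul]
  rwa [h1] at h

end Flow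

section FlowDerivative

set_option maxSynthPendingDepth 3

/-- A bounded time-dependent vector field on ℝ⁴ which is C¹ in space, uniformly `K`-Lipschitz. -/
structure IsRegularField (X : ℝ → R4 → R4) (K : NNReal) : Prop where
  continuous_uncurry : Continuous (Function.uncurry X)
  differentiable : ∀ s, Differentiable ℝ (X s)
  continuous_fderiv : Continuous fun p : ℝ × R4 => fderiv ℝ (X p.1) p.2
  norm_fderiv_le : ∀ s x, ‖fderiv ℝ (X s) x‖ ≤ K
  bounded : ∃ C : NNReal, ∀ s x, ‖X s x‖ ≤ C

lemma gronwallBound_zero_left (K ε x : ℝ) :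
    gronwallBound 0 K ε x = ε * gronwallBound 0 K 1 x := by
  unfold gronwallBound
  split_ifs <;> ring

namespace IsRegularField

variable {X : ℝ → R4 → R4} {K : NNReal}

lemma lipschitz (hX : IsRegularField X K) (s : ℝ) : LipschitzWith K (X s) :=
  lipschitzWith_of_nnnorm_fderiv_le (hX.differentiable s) fun x => by
    rw [← NNReal.coe_le_coe]; exact hX.norm_fderiv_le s x

lemma exists_solution (hX : IsRegularField X K) (t₀ : ℝ) (x : R4) :
    ∃ γ : ℝ → R4, γ t₀ = x ∧ ∀ t, HasDerivAt γ (X t (γ t)) t := by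
  obtain ⟨C, hC⟩ := hX.bounded
  exact exists_global_solution hX.lipschitz
    (fun x => hX.continuous_uncurry.comp (Continuous.prodMk_left x)) hC t₀ x

lemma eventually_norm_fderiv_sub_le (hX : IsRegularField X K) {γ : ℝ → R4} (hγ : Continuous γ)
    {ε : ℝ} (hε : 0 < ε) :
    ∃ d > 0, ∀ s ∈ Set.Icc (0 : ℝ) 1, ∀ y, ‖y - γ s‖ < d →
      ‖fderiv ℝ (X s) y - fderiv ℝ (X s) (γ s)‖ ≤ ε := by
  have hc : Continuous fun p : ℝ × R4 =>
      ‖fderiv ℝ (X p.1) (γ p.1 + p.2) - fderiv ℝ (X p.1) (γ p.1)‖ := by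
    have h1 := hX.continuous_fderiv.comp
      (by fun_prop : Continuous fun p : ℝ × R4 => (p.1, γ p.1 + p.2))
    have h2 := hX.continuous_fderiv.comp
      (by fun_prop : Continuous fun p : ℝ × R4 => (p.1, γ p.1))
    exact (h1.sub h2).norm
  have h := isCompact_Icc (a := (0 : ℝ)) (b := 1) |>.eventually_forall_of_forall_eventually
    (x₀ := (0 : R4)) (P := fun h s =>
      ‖fderiv ℝ (X s) (γ s + h) - fderiv ℝ (X s) (γ s)‖ < ε)
    (fun s _ => by
      have := (hc.comp continuous_swap).continuousAt (x := ((0 : R4), s))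
      exact this.eventually (gt_mem_nhds (by simpa using hε)))
  obtain ⟨d, hd, hball⟩ := Metric.eventually_nhds_iff.1 h
  refine ⟨d, hd, fun s hs y hy => ?_⟩
  have := hball (y := y - γ s) (by simpa using hy) s hs
  rw [add_sub_cancel] at this
  exact this.le

lemma norm_taylor_le (hX : IsRegularField X K) {s ε d : ℝ} {a b : R4}
    (h : ∀ y, ‖y - a‖ < d → ‖fderiv ℝ (X s) y - fderiv ℝ (X s) a‖ ≤ ε) (hb : ‖b - a‖ < d) :
    ‖X s b - X s a - fderiv ℝ (X s) a (b - a)‖ ≤ ε * ‖b - a‖ := by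
  have hd : 0 < d := (norm_nonneg _).trans_lt hb
  exact (convex_ball a d).norm_image_sub_le_of_norm_fderiv_le'
    (fun x _ => hX.differentiable s x) (fun y hy => h y (mem_ball_iff_norm.1 hy))
    (Metric.mem_ball_self hd) (mem_ball_iff_norm.2 hb)

/-- The flow of a regular field is C¹ at time one, its derivative solving the linearised
equation. -/
theorem exists_flow (hX : IsRegularField X K) :
    ∃ (φ : ℝ → R4 → R4) (W : ℝ → R4 → R4 →L[ℝ] R4),
      (∀ x, φ 0 x = x) ∧ (∀ x t, HasDerivAt (fun t => φ t x) (X t (φ t x)) t) ∧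
      (∀ x, W 0 x = ContinuousLinearMap.id ℝ R4) ∧
      (∀ x, ∀ t ∈ Set.Icc (0 : ℝ) 1, HasDerivAt (fun t => W t x)
        ((fderiv ℝ (X t) (φ t x)).comp (W t x)) t) ∧
      (∀ x, HasFDerivAt (φ 1) (W 1 x) x) ∧ Continuous (W 1) := by
  choose φ hφ0 hφ using fun x => hX.exists_solution 0 x
  have hφc : ∀ x, Continuous (φ x) := fun x =>
    continuous_iff_continuousAt.2 fun t => (hφ x t).continuousAt
  have hAc : ∀ x, Continuous fun t => fderiv ℝ (X t) (φ x t) := fun x =>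
    hX.continuous_fderiv.comp (continuous_id.prodMk (hφc x))
  have hcomp : ∀ L : R4 →L[ℝ] R4, ‖ContinuousLinearMap.compL ℝ R4 R4 R4 L‖ ≤ ‖L‖ := fun L => by
    refine ContinuousLinearMap.opNorm_le_bound _ (norm_nonneg _) fun M => ?_
    exact L.opNorm_comp_le M
  choose W hW0 hW using fun x => exists_linear_solution
    (E := R4 →L[ℝ] R4) (A := fun t => ContinuousLinearMap.compL ℝ R4 R4 R4
      (fderiv ℝ (X t) (φ x t)))
    ((ContinuousLinearMap.compL ℝ R4 R4 R4).continuous.comp (hAc x)) (k := K)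
    (fun t => (hcomp _).trans (hX.norm_fderiv_le t _)) (ContinuousLinearMap.id ℝ R4)
  have hdist : ∀ x y, ∀ t ∈ Set.Icc (0 : ℝ) 1, ‖φ y t - φ x t‖ ≤ ‖y - x‖ * exp K := by
    intro x y t ht
    have := dist_solutions_le hX.lipschitz (hφ y) (hφ x) ht.1
    rw [dist_eq_norm, dist_eq_norm, hφ0, hφ0] at this
    refine this.trans (mul_le_mul_of_nonneg_left (exp_le_exp.2 ?_) (norm_nonneg _))
    exact mul_le_of_le_one_right K.coe_nonneg ht.2
  have hWb : ∀ x, ∀ t ∈ Set.Icc (0 : ℝ) 1, ‖W x t‖ ≤ exp K := by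
    intro x t ht
    have := norm_le_gronwallBound_of_norm_deriv_right_le (f := W x)
      (f' := fun t => (fderiv ℝ (X t) (φ x t)).comp (W x t)) (δ := 1) (K := K) (ε := 0)
      (a := 0) (b := 1)
      (fun s hs => (hW x s hs).continuousAt.continuousWithinAt)
      (fun s hs => (hW x s ⟨hs.1, hs.2.le⟩).hasDerivWithinAt)
      (by rw [hW0]; exact ContinuousLinearMap.norm_id_le) (fun s _ => by
        rw [add_zero]
        exact (ContinuousLinearMap.opNorm_comp_le _ _).trans
          (mul_le_mul_of_nonneg_right (hX.norm_fderiv_le s _) (norm_nonneg _))) t ht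
    rw [gronwallBound_ε0, one_mul] at this
    refine this.trans (exp_le_exp.2 ?_)
    rw [sub_zero]
    exact mul_le_of_le_one_right K.coe_nonneg ht.2
  set B := gronwallBound 0 K 1 1 with hB
  have hB0 : 0 ≤ B := by
    have := gronwallBound_mono (δ := 0) (ε := 1) (K := K) le_rfl zero_le_one K.coe_nonneg
      (zero_le_one : (0 : ℝ) ≤ 1)
    rwa [gronwallBound_x0] at this
  refine ⟨fun t x => φ x t, fun t x => W x t, hφ0, hφ, hW0, hW, fun x => ?_, ?_⟩
  · rw [hasFDerivAt_iff_isLittleO_nhds_zero, Asymptotics.isLittleO_iff]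
    intro c hc
    set ε := c / (exp K * (B + 1)) with hε
    have hε0 : 0 < ε := by positivity
    obtain ⟨d, hd, hdε⟩ := hX.eventually_norm_fderiv_sub_le (hφc x) hε0
    filter_upwards [Metric.ball_mem_nhds (0 : R4) (div_pos hd (exp_pos (K : ℝ)))] with h hh
    rw [mem_ball_zero_iff, lt_div_iff₀ (exp_pos _)] at hh
    have hdx : ∀ t ∈ Set.Icc (0 : ℝ) 1, ‖φ (x + h) t - φ x t‖ ≤ ‖h‖ * exp K := fun t ht => by
      simpa using hdist x (x + h) t ht
    have hder : ∀ t ∈ Set.Icc (0 : ℝ) 1, HasDerivAt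
        (fun t => φ (x + h) t - φ x t - W x t h)
        (X t (φ (x + h) t) - X t (φ x t) - fderiv ℝ (X t) (φ x t) (W x t h)) t := fun t ht => by
      have := (hW x t ht).clm_apply (hasDerivAt_const t h)
      simpa using ((hφ (x + h) t).fun_sub (hφ x t)).fun_sub this
    have := norm_le_gronwallBound_of_norm_deriv_right_le (δ := 0) (K := K)
      (ε := ε * (‖h‖ * exp K)) (a := 0) (b := 1)
      (fun s hs => (hder s hs).continuousAt.continuousWithinAt)
      (fun s hs => (hder s ⟨hs.1, hs.2.le⟩).hasDerivWithinAt) (by simp [hφ0, hW0])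
      (fun s hs => by
        have hs' : s ∈ Set.Icc (0 : ℝ) 1 := ⟨hs.1, hs.2.le⟩
        have h1 := hX.norm_taylor_le (hdε s hs') ((hdx s hs').trans_lt hh)
        have h2 : X s (φ (x + h) s) - X s (φ x s) - fderiv ℝ (X s) (φ x s) (W x s h) =
            fderiv ℝ (X s) (φ x s) (φ (x + h) s - φ x s - W x s h) +
            (X s (φ (x + h) s) - X s (φ x s)
              - fderiv ℝ (X s) (φ x s) (φ (x + h) s - φ x s)) := by
          simp only [map_sub]; abel
        rw [h2]
        refine (norm_add_le _ _).trans (add_le_add (((fderiv ℝ (X s) (φ x s)).le_opNorm _).trans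
          (mul_le_mul_of_nonneg_right (hX.norm_fderiv_le s _) (norm_nonneg _))) ?_)
        exact h1.trans (mul_le_mul_of_nonneg_left (hdx s hs') hε0.le)) 1 (by simp)
    rw [gronwallBound_zero_left, sub_zero, ← hB] at this
    refine this.trans ?_
    have h3 : ε * (‖h‖ * exp K) * B = c * ‖h‖ * (B / (B + 1)) := by
      rw [hε]; field_simp
    rw [h3]
    exact mul_le_of_le_one_right (by positivity) ((div_le_one (by linarith)).2 (by linarith))
  · rw [Metric.continuous_iff]
    intro x c hc
    set ε := c / (exp K * (B + 1)) with hε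
    have hε0 : 0 < ε := by positivity
    obtain ⟨d, hd, hdε⟩ := hX.eventually_norm_fderiv_sub_le (hφc x) hε0
    refine ⟨d / exp K, div_pos hd (exp_pos _), fun y hy => ?_⟩
    rw [dist_eq_norm, lt_div_iff₀ (exp_pos _)] at hy
    have hder : ∀ t ∈ Set.Icc (0 : ℝ) 1, HasDerivAt (fun t => W y t - W x t)
        ((fderiv ℝ (X t) (φ y t)).comp (W y t) - (fderiv ℝ (X t) (φ x t)).comp (W x t)) t :=
      fun t ht => (hW y t ht).fun_sub (hW x t ht)
    have := norm_le_gronwallBound_of_norm_deriv_right_le (δ := 0) (K := K)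
      (ε := ε * exp K) (a := 0) (b := 1)
      (fun s hs => (hder s hs).continuousAt.continuousWithinAt)
      (fun s hs => (hder s ⟨hs.1, hs.2.le⟩).hasDerivWithinAt) (by simp [hW0])
      (fun s hs => by
        have hs' : s ∈ Set.Icc (0 : ℝ) 1 := ⟨hs.1, hs.2.le⟩
        have h2 : (fderiv ℝ (X s) (φ y s)).comp (W y s) - (fderiv ℝ (X s) (φ x s)).comp (W x s) =
            (fderiv ℝ (X s) (φ y s)).comp (W y s - W x s) +
            (fderiv ℝ (X s) (φ y s) - fderiv ℝ (X s) (φ x s)).comp (W x s) := by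
          ext v; simp
        rw [h2]
        refine (norm_add_le _ _).trans (add_le_add
          ((ContinuousLinearMap.opNorm_comp_le _ _).trans
          (mul_le_mul_of_nonneg_right (hX.norm_fderiv_le s _) (norm_nonneg _)))
          ((ContinuousLinearMap.opNorm_comp_le _ _).trans (mul_le_mul
            (hdε s hs' _ ((hdist x y s hs').trans_lt hy)) (hWb x s hs') (norm_nonneg _)
            hε0.le))) ) 1 (by simp)
    rw [gronwallBound_zero_left, sub_zero, ← hB] at this
    rw [dist_eq_norm]
    refine this.trans_lt ?_
    have h3 : ε * exp K * B = c * (B / (B + 1)) := by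
      rw [hε]; field_simp
    rw [h3]
    exact mul_lt_of_lt_one_right hc ((div_lt_one (by linarith)).2 (by linarith))

end IsRegularField

end FlowDerivative

section Moser

set_option maxSynthPendingDepth 3

/-- The standard symplectic form as a continuous bilinear map. -/
def omegaL : R4 →L[ℝ] R4 →L[ℝ] ℝ :=
  (EuclideanSpace.proj 0 : R4 →L[ℝ] ℝ).smulRight (EuclideanSpace.proj 1 : R4 →L[ℝ] ℝ)
    - (EuclideanSpace.proj 1 : R4 →L[ℝ] ℝ).smulRight (EuclideanSpace.proj 0 : R4 →L[ℝ] ℝ)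
    + (EuclideanSpace.proj 2 : R4 →L[ℝ] ℝ).smulRight (EuclideanSpace.proj 3 : R4 →L[ℝ] ℝ)
    - (EuclideanSpace.proj 3 : R4 →L[ℝ] ℝ).smulRight (EuclideanSpace.proj 2 : R4 →L[ℝ] ℝ)

@[simp] lemma omegaL_apply (u v : R4) : omegaL u v = omegaSt u v := by
  simp [omegaL, omegaSt]

lemma omegaSt_antisymm (u v : R4) : omegaSt u v = - omegaSt v u := by
  unfold omegaSt; ring

lemma isInvertible_of_forall_eq_zero {A : R4 →L[ℝ] R4 →L[ℝ] ℝ}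
    (hA : ∀ u, (∀ v, A u v = 0) → u = 0) : A.IsInvertible := by
  have hinj : Function.Injective (A : R4 →ₗ[ℝ] R4 →L[ℝ] ℝ) := by
    rw [← LinearMap.ker_eq_bot, LinearMap.ker_eq_bot']
    intro u hu
    refine hA u fun v => ?_
    have : A u = 0 := hu
    rw [this]; rfl
  have hfr : Module.finrank ℝ R4 = Module.finrank ℝ (R4 →L[ℝ] ℝ) :=
    (InnerProductSpace.toDual ℝ R4).toLinearEquiv.finrank_eq
  have : FiniteDimensional ℝ (R4 →L[ℝ] ℝ) := inferInstance
  exact ⟨(LinearEquiv.ofInjectiveOfFinrankEq (A : R4 →ₗ[ℝ] R4 →L[ℝ] ℝ) hinj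
    hfr).toContinuousLinearEquiv, by ext u v; rfl⟩


/-- Clamping to the unit interval. -/
def clampUnit (s : ℝ) : ℝ := max 0 (min s 1)

lemma clampUnit_mem (s : ℝ) : clampUnit s ∈ Set.Icc (0 : ℝ) 1 :=
  ⟨le_max_left _ _, max_le zero_le_one (min_le_right _ _)⟩

lemma clampUnit_of_mem {s : ℝ} (hs : s ∈ Set.Icc (0 : ℝ) 1) : clampUnit s = s := by
  rw [clampUnit, min_eq_left hs.2, max_eq_right hs.1]

lemma continuous_clampUnit : Continuous clampUnit := by unfold clampUnit; fun_prop

/-- A family of vector fields which is jointly C¹ near `[0, 1] × ℝ⁴` and vanishes outside a ball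
gives a regular field after clamping time. -/
lemma isRegularField_clampUnit {X : ℝ × R4 → R4}
    (hX : ∀ s ∈ Set.Icc (0 : ℝ) 1, ∀ x, ContDiffAt ℝ 1 X (s, x)) {ρ : ℝ}
    (h0 : ∀ s x, ρ < ‖x‖ → X (s, x) = 0) :
    ∃ K, IsRegularField (fun s x => X (clampUnit s, x)) K := by
  have hc : Continuous fun p : ℝ × R4 => (clampUnit p.1, p.2) :=
    (continuous_clampUnit.comp continuous_fst).prodMk continuous_snd
  have hXc : Continuous fun p : ℝ × R4 => X (clampUnit p.1, p.2) :=
    continuous_iff_continuousAt.2 fun p => ContinuousAt.comp (g := X)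
      (f := fun p : ℝ × R4 => (clampUnit p.1, p.2))
      (hX _ (clampUnit_mem p.1) p.2).continuousAt hc.continuousAt
  have hder : ∀ s x, HasFDerivAt (fun x => X (clampUnit s, x))
      ((fderiv ℝ X (clampUnit s, x)).comp (ContinuousLinearMap.inr ℝ ℝ R4)) x := fun s x =>
    ((hX _ (clampUnit_mem s) x).differentiableAt one_ne_zero).hasFDerivAt.comp x
      (hasFDerivAt_prodMk_right (clampUnit s) x)
  have hDc : Continuous fun p : ℝ × R4 =>
      fderiv ℝ (fun x => X (clampUnit p.1, x)) p.2 := by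
    have h1 : Continuous fun p : ℝ × R4 => fderiv ℝ X (clampUnit p.1, p.2) :=
      continuous_iff_continuousAt.2 fun p => ContinuousAt.comp (g := fderiv ℝ X)
        (f := fun p : ℝ × R4 => (clampUnit p.1, p.2))
        ((hX _ (clampUnit_mem p.1) p.2).fderiv_right (m := 0) (by norm_num)).continuousAt
        hc.continuousAt
    have h2 : (fun p : ℝ × R4 => fderiv ℝ (fun x => X (clampUnit p.1, x)) p.2) =
        fun p => (fderiv ℝ X (clampUnit p.1, p.2)).comp (ContinuousLinearMap.inr ℝ ℝ R4) :=
      funext fun p => (hder p.1 p.2).fderiv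
    rw [h2]
    exact h1.clm_comp continuous_const
  have hD0 : ∀ s x, ρ < ‖x‖ → fderiv ℝ (fun x => X (clampUnit s, x)) x = 0 := fun s x hx => by
    have : (fun x => X (clampUnit s, x)) =ᶠ[nhds x] fun _ => (0 : R4) := by
      filter_upwards [(isOpen_lt continuous_const continuous_norm).mem_nhds hx] with y hy
      exact h0 _ y hy
    rw [this.fderiv_eq]; simp
  have hcpt : IsCompact (Set.Icc (0 : ℝ) 1 ×ˢ Metric.closedBall (0 : R4) ρ) :=
    isCompact_Icc.prod (isCompact_closedBall _ _)
  obtain ⟨C₁, hC₁⟩ := (hcpt.image hXc).isBounded.exists_norm_le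
  obtain ⟨C₂, hC₂⟩ := (hcpt.image hDc).isBounded.exists_norm_le
  have hcl : ∀ s, clampUnit (clampUnit s) = clampUnit s := fun s =>
    clampUnit_of_mem (clampUnit_mem s)
  refine ⟨C₂.toNNReal, hXc, fun s x => (hder s x).differentiableAt, hDc, fun s x => ?_,
    C₁.toNNReal, fun s x => ?_⟩
  · rcases lt_or_ge ρ ‖x‖ with h | h
    · rw [hD0 s x h, norm_zero]; exact NNReal.coe_nonneg _
    · have := hC₂ _ (Set.mem_image_of_mem _ (show (clampUnit s, x) ∈ _ from
        ⟨clampUnit_mem s, by simpa using h⟩))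
      simp only [hcl] at this
      exact this.trans (Real.le_coe_toNNReal _)
  · rcases lt_or_ge ρ ‖x‖ with h | h
    · simp only [h0 _ x h, norm_zero]; exact NNReal.coe_nonneg _
    · have := hC₁ _ (Set.mem_image_of_mem _ (show (clampUnit s, x) ∈ _ from
        ⟨clampUnit_mem s, by simpa using h⟩))
      simp only [hcl] at this
      exact this.trans (Real.le_coe_toNNReal _)

variable {η : R4 → R4 →L[ℝ] R4 →L[ℝ] ℝ}

/-- Moser's trick: a compactly supported closed perturbation of the standard symplectic form,
nondegenerate along the segment, is the push-forward of the standard form. -/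
theorem exists_moser (hη : ContDiff ℝ 1 η) (halt : ∀ x u v, η x u v = - η x v u)
    (hcl : ∀ x u v w, fderiv ℝ η x u v w + fderiv ℝ η x v w u + fderiv ℝ η x w u v = 0)
    {ρ₁ ρ₂ : ℝ} (hρ₁ : 0 < ρ₁) (hρ₂ : ρ₁ < ρ₂) (hsupp : ∀ x, ρ₁ ≤ ‖x‖ → η x = 0)
    (hnd : ∀ s ∈ Set.Icc (0 : ℝ) 1, ∀ x u, (∀ v, omegaSt u v + s * η x u v = 0) → u = 0) :
    ∃ (ψ : R4 → R4) (W : R4 → R4 →L[ℝ] R4), (∀ x, HasFDerivAt ψ (W x) x) ∧ Continuous W ∧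
      Function.Surjective ψ ∧ (∀ x, ρ₂ < ‖x‖ → ψ x = x) ∧
      ∀ x u v, omegaSt (W x u) (W x v) + η (ψ x) (W x u) (W x v) = omegaSt u v := by
  obtain ⟨σ, hσ, hσ0, hdσ⟩ := exists_compactly_supported_primitive_two_form hη halt hcl hρ₁ hρ₂
    hsupp
  set A : ℝ × R4 → R4 →L[ℝ] R4 →L[ℝ] ℝ := fun p => omegaL + p.1 • η p.2 with hA
  have hAi : ∀ s ∈ Set.Icc (0 : ℝ) 1, ∀ x, (A (s, x)).IsInvertible := fun s hs x =>
    isInvertible_of_forall_eq_zero fun u hu => hnd s hs x u fun v => by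
      simpa [hA, smul_eq_mul] using hu v
  set X : ℝ × R4 → R4 := fun p => - (A p).inverse (σ p.2) with hXdef
  have hAd : ContDiff ℝ 1 A :=
    contDiff_const.add (contDiff_fst.smul (hη.comp contDiff_snd))
  have hXd : ∀ s ∈ Set.Icc (0 : ℝ) 1, ∀ x, ContDiffAt ℝ 1 X (s, x) := fun s hs x => by
    obtain ⟨e, he⟩ := hAi s hs x
    have h1 : ContDiffAt ℝ 1 (fun p => (A p).inverse) (s, x) := by
      have := contDiffAt_map_inverse (n := 1) e
      rw [he] at this
      exact this.comp (s, x) hAd.contDiffAt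
    exact (h1.clm_apply (hσ.comp contDiff_snd).contDiffAt).neg
  have hX0 : ∀ s x, ρ₂ < ‖x‖ → X (s, x) = 0 := fun s x hx => by
    simp [hXdef, hσ0 x hx]
  obtain ⟨K, hreg⟩ := isRegularField_clampUnit hXd hX0
  obtain ⟨φ, W, hφ0, hφ, hW0, hW, hφW, hWc⟩ := hreg.exists_flow
  refine ⟨φ 1, W 1, hφW, hWc, fun y => ?_, fun x hx => ?_, fun x u v => ?_⟩
  · obtain ⟨γ, hγ1, hγ⟩ := hreg.exists_solution 1 y
    refine ⟨γ 0, ?_⟩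
    have := eq_of_solutions hreg.lipschitz (hφ (γ 0)) hγ (t₀ := 0) (hφ0 _)
    rw [← hγ1]; exact congrFun this 1
  · have := eq_of_solutions hreg.lipschitz (hφ x) (γ₂ := fun _ => x) (t₀ := 0)
      (fun t => by
        have h := hasDerivAt_const t x
        simp only [hX0 _ x hx]
        exact h) (hφ0 _)
    exact congrFun this 1
  have hσX : ∀ s ∈ Set.Icc (0 : ℝ) 1, ∀ y b,
      omegaSt (X (s, y)) b + s * η y (X (s, y)) b = - σ y b := fun s hs y b => by
    obtain ⟨e, he⟩ := hAi s hs y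
    have : A (s, y) (X (s, y)) = - σ y := by
      simp only [hXdef, map_neg, ← he, ContinuousLinearMap.inverse_equiv]
      simp
    have := congrArg (fun L : R4 →L[ℝ] ℝ => L b) this
    simpa [hA, smul_eq_mul] using this
  have hdX : ∀ s ∈ Set.Icc (0 : ℝ) 1, ∀ y a b,
      omegaSt (fderiv ℝ (fun x => X (clampUnit s, x)) y a) b
        + s * (fderiv ℝ η y a (X (s, y)) b
          + η y (fderiv ℝ (fun x => X (clampUnit s, x)) y a) b)
        = - fderiv ℝ σ y a b := fun s hs y a b => by
    have hXy := (hreg.differentiable s y).hasFDerivAt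
    simp only [clampUnit_of_mem hs] at hXy ⊢
    have hηy := (hη.differentiable one_ne_zero y).hasFDerivAt
    have hσy := (hσ.differentiable one_ne_zero y).hasFDerivAt
    have h1 := (omegaL.hasFDerivAt.comp y hXy).clm_apply (hasFDerivAt_const b y)
    have h2 := ((hηy.clm_apply hXy).clm_apply (hasFDerivAt_const b y)).const_smul s
    have h3 := (hσy.clm_apply (hasFDerivAt_const b y)).neg
    have heq : (fun z => omegaL (X (s, z)) b + s • η z (X (s, z)) b) = fun z => - σ z b := by
      funext z
      simpa [smul_eq_mul] using hσX s hs z b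
    have h4 := (h1.fun_add h2)
    have h5 := h4.unique (f := fun z => omegaL (X (s, z)) b + s • η z (X (s, z)) b)
      (by rw [heq]; exact h3)
    have h6 := congrArg (fun L : R4 →L[ℝ] ℝ => L a) h5
    simp [smul_eq_mul] at h6
    linarith
  have hdalt : ∀ y a u v, fderiv ℝ η y a u v = - fderiv ℝ η y a v u := fun y a u v => by
    have hηy := (hη.differentiable one_ne_zero y).hasFDerivAt
    have h1 := ((hηy.clm_apply (hasFDerivAt_const u y)).clm_apply (hasFDerivAt_const v y))
    have h2 := ((hηy.clm_apply (hasFDerivAt_const v y)).clm_apply (hasFDerivAt_const u y)).neg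
    have h3 := h1.unique (f := fun z => η z u v)
      (by rw [show (fun z => η z u v) = fun z => - η z v u from funext fun z => halt z u v]
          exact h2)
    have h6 := congrArg (fun L : R4 →L[ℝ] ℝ => L a) h3
    simpa using h6
  set F : ℝ → ℝ := fun t =>
    omegaSt (W t x u) (W t x v) + t * η (φ t x) (W t x u) (W t x v) with hF
  have hFd : ∀ t ∈ Set.Icc (0 : ℝ) 1, HasDerivAt F 0 t := fun t ht => by
    have hWt := hW x t ht
    have hφt := hφ x t
    have hWu := hWt.clm_apply (hasDerivAt_const t u)
    have hWv := hWt.clm_apply (hasDerivAt_const t v)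
    have hηt := (hη.differentiable one_ne_zero (φ t x)).hasFDerivAt.comp_hasDerivAt t hφt
    have h1 := ((omegaL.hasFDerivAt.comp_hasDerivAt t hWu).clm_apply hWv)
    have h2 := (hasDerivAt_id t).mul ((hηt.clm_apply hWu).clm_apply hWv)
    have h3 := h1.fun_add h2
    have h4 : F = fun t => omegaL (W t x u) (W t x v)
        + t * η (φ t x) (W t x u) (W t x v) := by
      funext t; simp [hF]
    rw [h4]
    refine h3.congr_deriv ?_
    set y := φ t x with hy
    set a := W t x u with ha
    set b := W t x v with hb
    have e1 := hdX t ht y a b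
    have e2 := hdX t ht y b a
    have e3 := hdσ y a b
    have e4 := hcl y a b (X (t, y))
    have e5 := hdalt y a (X (t, y)) b
    simp only [clampUnit_of_mem ht] at e1 e2
    rw [omegaSt_antisymm, halt y _ a] at e2
    simp [clampUnit_of_mem ht, ← hy, ← ha, ← hb]
    linear_combination e1 - e2 - e3 + t * e4 - t * e5
  have hconst := constant_of_has_deriv_right_zero (f := F) (a := 0) (b := 1)
    (fun t ht => (hFd t ht).continuousAt.continuousWithinAt)
    (fun t ht => (hFd t ⟨ht.1, ht.2.le⟩).hasDerivWithinAt) 1 ⟨zero_le_one, le_rfl⟩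
  simpa [hF, hW0] using hconst

end Moser

section Conformal

set_option maxSynthPendingDepth 3

/-- The form `d(E λ) - ω` where `λ = ω(V, ·)`, when `V` is Liouville on the support of `dE`. -/
def conformalForm (E : R4 → ℝ) (V : R4 → R4) (x : R4) : R4 →L[ℝ] R4 →L[ℝ] ℝ :=
  (E x - 1) • omegaL + (fderiv ℝ E x).smulRight (omegaL (V x))
    - (omegaL (V x)).smulRight (fderiv ℝ E x)

lemma conformalForm_apply (E : R4 → ℝ) (V : R4 → R4) (x u v : R4) :
    conformalForm E V x u v = (E x - 1) * omegaSt u v + fderiv ℝ E x u * omegaSt (V x) v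
      - omegaSt (V x) u * fderiv ℝ E x v := by
  simp [conformalForm, smul_eq_mul]

lemma eq_zero_of_omegaSt_eq_zero {u : R4} (h : ∀ v, omegaSt u v = 0) : u = 0 := by
  have h0 := h (EuclideanSpace.single 0 1)
  have h1 := h (EuclideanSpace.single 1 1)
  have h2 := h (EuclideanSpace.single 2 1)
  have h3 := h (EuclideanSpace.single 3 1)
  simp [omegaSt] at h0 h1 h2 h3
  ext i; fin_cases i <;> simp [h0, h1, h2, h3]

/-- Moser's trick for the conformal deformation `d(E λ)` of the standard symplectic form. -/
theorem exists_moser_conformal {E : R4 → ℝ} {V : R4 → R4} (hE : ContDiff ℝ 2 E)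
    (hV : ContDiff ℝ 1 V) (hEpos : ∀ x, 0 < E x) {ρ₁ ρ₂ : ℝ} (hρ₁ : 0 < ρ₁) (hρ₂ : ρ₁ < ρ₂)
    (hE1 : ∀ x, ρ₁ ≤ ‖x‖ → E x = 1) (hdE : ∀ x, ρ₁ ≤ ‖x‖ → fderiv ℝ E x = 0)
    (hL : ∀ x, fderiv ℝ E x ≠ 0 → ∀ u v,
      omegaSt (fderiv ℝ V x u) v + omegaSt u (fderiv ℝ V x v) = omegaSt u v)
    (hp : ∀ x, 0 ≤ fderiv ℝ E x (V x)) :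
    ∃ (ψ : R4 → R4) (W : R4 → R4 →L[ℝ] R4), (∀ x, HasFDerivAt ψ (W x) x) ∧ Continuous W ∧
      Function.Surjective ψ ∧ (∀ x, ρ₂ < ‖x‖ → ψ x = x) ∧
      ∀ x u v, E (ψ x) * omegaSt (W x u) (W x v)
        + fderiv ℝ E (ψ x) (W x u) * omegaSt (V (ψ x)) (W x v)
        - omegaSt (V (ψ x)) (W x u) * fderiv ℝ E (ψ x) (W x v) = omegaSt u v := by
  have hdEc : ContDiff ℝ 1 (fderiv ℝ E) := hE.fderiv_right (by norm_num)
  have hη : ContDiff ℝ 1 (conformalForm E V) := by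
    unfold conformalForm
    have hE' : ContDiff ℝ 1 E := hE.of_le (by norm_num)
    have h1 : ContDiff ℝ 1 fun x => omegaL (V x) := omegaL.contDiff.comp hV
    exact (((hE'.sub contDiff_const).smul contDiff_const).add (hdEc.smulRight h1)).sub
      (h1.smulRight hdEc)
  have hder : ∀ x u v w, fderiv ℝ (conformalForm E V) x u v w =
      fderiv ℝ E x u * omegaSt v w
      + (fderiv ℝ (fderiv ℝ E) x u v * omegaSt (V x) w
        + fderiv ℝ E x v * omegaSt (fderiv ℝ V x u) w)
      - (omegaSt (fderiv ℝ V x u) v * fderiv ℝ E x w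
        + omegaSt (V x) v * fderiv ℝ (fderiv ℝ E) x u w) := fun x u v w => by
    have h1 := ((hη.differentiable one_ne_zero x).hasFDerivAt.clm_apply
      (hasFDerivAt_const v x)).clm_apply (hasFDerivAt_const w x)
    have hEx := (hE.differentiable two_ne_zero x).hasFDerivAt
    have hVx := omegaL.hasFDerivAt.comp x (hV.differentiable one_ne_zero x).hasFDerivAt
    have hdx := (hdEc.differentiable one_ne_zero x).hasFDerivAt
    have hd : ∀ v, HasFDerivAt (fun y => fderiv ℝ E y v) _ x :=
      fun v => hdx.clm_apply (hasFDerivAt_const v x)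
    have hVd : ∀ v, HasFDerivAt (fun y => omegaL (V y) v) _ x :=
      fun v => hVx.clm_apply (hasFDerivAt_const v x)
    have h2 := (((hEx.sub_const 1).mul_const (omegaSt v w)).fun_add
      ((hd v).fun_mul (hVd w))).fun_sub ((hVd v).fun_mul (hd w))
    have h3 := h1.unique (f := fun y => conformalForm E V y v w) (by
      rw [show (fun y => conformalForm E V y v w) = _ from
        funext fun y => conformalForm_apply E V y v w]
      simpa only [omegaL_apply] using h2)
    have h6 := congrArg (fun L : R4 →L[ℝ] ℝ => L u) h3
    simp [smul_eq_mul] at h6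
    rw [h6]; ring
  obtain ⟨ψ, W, hψ, hW, hsurj, hid, hpull⟩ := exists_moser hη
    (fun x u v => by
      rw [conformalForm_apply, conformalForm_apply, omegaSt_antisymm u v]; ring)
    (fun x u v w => by
      rw [hder, hder, hder]
      have hsymm : IsSymmSndFDerivAt ℝ E x := hE.contDiffAt.isSymmSndFDerivAt (by simp)
      rw [hsymm.eq v u, hsymm.eq w u, hsymm.eq w v]
      by_cases h : fderiv ℝ E x = 0
      · simp [h]; ring
      · have e1 := hL x h u v
        have e2 := hL x h v w
        have e3 := hL x h w u
        rw [omegaSt_antisymm u (fderiv ℝ V x v)] at e1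
        rw [omegaSt_antisymm v (fderiv ℝ V x w)] at e2
        rw [omegaSt_antisymm w (fderiv ℝ V x u)] at e3
        linear_combination - fderiv ℝ E x w * e1 - fderiv ℝ E x u * e2
          - fderiv ℝ E x v * e3)
    hρ₁ hρ₂
    (fun x hx => by ext u v; simp [conformalForm_apply, hE1 x hx, hdE x hx])
    (fun s hs x u hu => by
      have hEs : 0 < 1 - s + s * E x := by
        rcases hs.2.lt_or_eq with h | h
        · have := mul_nonneg hs.1 (hEpos x).le; linarith
        · rw [h]; simpa using hEpos x
      have hEp : 0 < 1 - s + s * E x + s * fderiv ℝ E x (V x) := by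
        have := mul_nonneg hs.1 (hp x); linarith
      have hself : omegaSt (V x) (V x) = 0 := by unfold omegaSt; ring
      simp only [conformalForm_apply] at hu
      have h1 : omegaSt (V x) u = 0 := by
        have h := hu (V x)
        rw [hself, omegaSt_antisymm u (V x)] at h
        have : (1 - s + s * E x + s * fderiv ℝ E x (V x)) * omegaSt (V x) u = 0 := by
          linear_combination - h
        exact (mul_eq_zero.1 this).resolve_left hEp.ne'
      have h2 : (1 - s + s * E x) • u + (s * fderiv ℝ E x u) • V x = 0 :=
        eq_zero_of_omegaSt_eq_zero fun v => by
          have h := hu v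
          rw [h1] at h
          simp only [← omegaL_apply] at h ⊢
          simp only [map_add, map_smul, add_apply, smul_apply, smul_eq_mul]
          linear_combination h
      have h3 : fderiv ℝ E x u = 0 := by
        have h := congrArg (fderiv ℝ E x) h2
        simp only [map_add, map_smul, smul_eq_mul, map_zero] at h
        have : (1 - s + s * E x + s * fderiv ℝ E x (V x)) * fderiv ℝ E x u = 0 := by
          linear_combination h
        exact (mul_eq_zero.1 this).resolve_left hEp.ne'
      rw [h3, mul_zero, zero_smul, add_zero] at h2
      exact (smul_eq_zero.1 h2).resolve_left hEs.ne')
  refine ⟨ψ, W, hψ, hW, hsurj, hid, fun x u v => ?_⟩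
  have := hpull x u v
  rw [conformalForm_apply] at this
  linear_combination this

end Conformal

section RealOrbit

/-- The identification of ℝ⁴ with ℂ² given by `z_j = x_j + i y_j`. -/
def realToComplex : R4 ≃ₗᵢ[ℝ] C2 where
  toFun u := !₂[⟨u 0, u 1⟩, ⟨u 2, u 3⟩]
  invFun c := !₂[(c 0).re, (c 0).im, (c 1).re, (c 1).im]
  map_add' u v := by ext i; fin_cases i <;> apply Complex.ext <;> simp
  map_smul' r u := by ext i; fin_cases i <;> apply Complex.ext <;> simp
  left_inv u := by ext i; fin_cases i <;> simp
  right_inv c := by ext i; fin_cases i <;> simp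
  norm_map' u := by
    rw [← sq_eq_sq₀ (norm_nonneg _) (norm_nonneg _), EuclideanSpace.norm_sq_eq,
      EuclideanSpace.norm_sq_eq]
    simp [Fin.sum_univ_four, Complex.sq_norm, Complex.normSq_apply]
    ring

lemma omegaSt_realToComplex_symm (w : C2) (v : R4) :
    omegaSt (realToComplex.symm (Complex.I • w)) v = - inner ℝ w (realToComplex v) := by
  have h : realToComplex.symm (Complex.I • w) =
    !₂[(Complex.I * w 0).re, (Complex.I * w 0).im, (Complex.I * w 1).re,
      (Complex.I * w 1).im] := rfl
  have h' : realToComplex v = !₂[⟨v 0, v 1⟩, ⟨v 2, v 3⟩] := rfl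
  rw [h, h', PiLp.inner_apply]
  simp [omegaSt, Fin.sum_univ_two, Complex.inner]
  ring

/-- The real form of the existence theorem for one-periodic orbits: `ω(x', ·) = -dK`. -/
theorem exists_periodic_orbit_real {K : R4 → ℝ} {K' : R4 → R4 →L[ℝ] ℝ} {z₀ : R4}
    {r₀ ρ₁ ρ m : ℝ} (hK : ∀ z, HasFDerivAt K (K' z) z) (hK'c : Continuous K')
    (hK0 : ∀ z, 0 ≤ K z) (hr₀ : 0 < r₀) (hKz : ∀ z ∈ Metric.ball z₀ r₀, K z = 0)
    (hρ₁ : 0 < ρ₁) (hρ : ρ₁ < ρ) (hKm : ∀ z, ρ₁ ≤ ‖z‖ → K z = m) (hm : π * ρ ^ 2 < m) :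
    ∃ X X' : ℝ → R4, (∀ t, HasDerivAt X (X' t) t) ∧
      (∀ t v, omegaSt (X' t) v = - K' (X t) v) ∧ (∀ t, X (t + 1) = X t) ∧
      ∃ t, K' (X t) ≠ 0 := by
  set J := realToComplex with hJ
  set L : R4 → C2 →L[ℝ] ℝ := fun z => (K' z).comp (J.symm : C2 →L[ℝ] R4) with hL
  set k : C2 → C2 := fun z => (InnerProductSpace.toDual ℝ C2).symm (L (J.symm z)) with hk
  have hgrad : ∀ z, HasGradientAt (K ∘ J.symm) (k z) z := fun z => by
    rw [hasGradientAt_iff_hasFDerivAt]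
    simp only [hk, LinearIsometryEquiv.apply_symm_apply]
    exact (hK (J.symm z)).comp z (J.symm : C2 →L[ℝ] R4).hasFDerivAt
  have hkc : Continuous k :=
    (InnerProductSpace.toDual ℝ C2).symm.continuous.comp
      ((hK'c.clm_comp continuous_const).comp J.symm.continuous)
  obtain ⟨X, hX, hper, -, t, ht⟩ := exists_periodic_orbit hgrad hkc (fun z => hK0 _) (z₀ := J z₀)
    hr₀ (fun z hz => hKz _ (by
      rw [Metric.mem_ball] at hz ⊢
      rwa [← J.symm.dist_map, J.symm_apply_apply] at hz)) hρ₁ hρ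
    (fun z hz => hKm _ (by rwa [J.symm.norm_map])) hm
  refine ⟨fun t => J.symm (X t), fun t => J.symm (Complex.I • k (X t)),
    fun t => (J.symm : C2 →L[ℝ] R4).hasFDerivAt.comp_hasDerivAt t (hX t), fun t v => ?_,
    fun t => congrArg J.symm (hper t), t, fun h => ht ?_⟩
  · rw [omegaSt_realToComplex_symm]
    simp only [hk, InnerProductSpace.toDual_symm_apply, hL]
    simp [hJ]
  · simp [hk, hL, h]

end RealOrbit

section ConformalOrbit

set_option maxSynthPendingDepth 3

/-- The one-periodic orbits of a function of the conformal factor `E`, with respect to the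
symplectic form `d(E λ)`. -/
theorem exists_conformal_orbit {E : R4 → ℝ} {V : R4 → R4} (hE : ContDiff ℝ 2 E)
    (hV : ContDiff ℝ 1 V) (hEpos : ∀ x, 0 < E x) {ρ₁ ρ m : ℝ} (hρ₁ : 0 < ρ₁) (hρ : ρ₁ < ρ)
    (hE1 : ∀ x, ρ₁ ≤ ‖x‖ → E x = 1) (hdE : ∀ x, ρ₁ ≤ ‖x‖ → fderiv ℝ E x = 0)
    (hL : ∀ x, fderiv ℝ E x ≠ 0 → ∀ u v,
      omegaSt (fderiv ℝ V x u) v + omegaSt u (fderiv ℝ V x v) = omegaSt u v)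
    (hp : ∀ x, 0 ≤ fderiv ℝ E x (V x)) {Z Z' : ℝ → ℝ} (hZ : ∀ e, HasDerivAt Z (Z' e) e)
    (hZ' : Continuous Z') (hZ0 : ∀ e, 0 ≤ Z e) {y₀ : R4} (hy₀ : ∀ᶠ e in nhds (E y₀), Z e = 0)
    (hZ1 : Z 1 = m) (hm : π * ρ ^ 2 < m) :
    ∃ (y y' : ℝ → R4) (e : ℝ), (∀ t, HasDerivAt y (y' t) t) ∧ (∀ t, y (t + 1) = y t) ∧
      (∀ t, E (y t) = e) ∧ Z' e ≠ 0 ∧ (∃ t, fderiv ℝ E (y t) ≠ 0) ∧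
      ∀ t v, (e + fderiv ℝ E (y t) (V (y t))) * omegaSt (y' t) v
        = - (Z' e * fderiv ℝ E (y t) v) := by
  obtain ⟨ρ₂, hρ₂, hρ₂'⟩ := exists_between hρ
  obtain ⟨ρ₃, hρ₃, hρ₃'⟩ := exists_between hρ₂'
  obtain ⟨ψ, W, hψ, hW, hsurj, hid, hpull⟩ :=
    exists_moser_conformal hE hV hEpos hρ₁ hρ₂ hE1 hdE hL hp
  have hEd : ∀ x, HasFDerivAt E (fderiv ℝ E x) x := fun x =>
    (hE.differentiable two_ne_zero x).hasFDerivAt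
  have hψc : Continuous ψ := continuous_iff_continuousAt.2 fun x => (hψ x).continuousAt
  obtain ⟨z₀, rfl⟩ := hsurj y₀
  have hK : ∀ z, HasFDerivAt (fun z => Z (E (ψ z)))
      (Z' (E (ψ z)) • (fderiv ℝ E (ψ z)).comp (W z)) z := fun z =>
    (hZ _).comp_hasFDerivAt z ((hEd _).comp z (hψ z))
  obtain ⟨r₀, hr₀, hball⟩ := Metric.eventually_nhds_iff_ball.1
    ((hE.continuous.comp hψc).continuousAt.eventually hy₀)
  obtain ⟨X, X', hX, hXω, hper, t₀, ht₀⟩ := exists_periodic_orbit_real hK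
    ((hZ'.comp (hE.continuous.comp hψc)).smul
      (((hE.continuous_fderiv two_ne_zero).comp hψc).clm_comp hW))
    (fun z => hZ0 _) hr₀ hball (hρ₁.trans (hρ₂.trans hρ₃)) hρ₃'
    (fun z hz => by rw [hid z (hρ₃.trans_le hz), hE1 z ((hρ₂.trans hρ₃).le.trans hz), hZ1]) hm
  have hWsurj : ∀ x, Function.Surjective (W x) := fun x => by
    have hinj : Function.Injective (W x : R4 →ₗ[ℝ] R4) := by
      rw [← LinearMap.ker_eq_bot, LinearMap.ker_eq_bot']
      intro u hu
      have hu : W x u = 0 := hu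
      refine eq_zero_of_omegaSt_eq_zero fun v => ?_
      have h := hpull x u v
      simp only [hu, map_zero, ← omegaL_apply] at h ⊢
      simpa using h.symm
    exact LinearMap.surjective_of_injective hinj
  set y : ℝ → R4 := fun t => ψ (X t) with hy
  set y' : ℝ → R4 := fun t => W (X t) (X' t) with hy'
  have hyd : ∀ t, HasDerivAt y (y' t) t := fun t => (hψ _).comp_hasDerivAt t (hX t)
  have hself : ∀ u, omegaSt u u = 0 := fun u => by unfold omegaSt; ring
  have hmain : ∀ t v, E (y t) * omegaSt (y' t) v + fderiv ℝ E (y t) (y' t) * omegaSt (V (y t)) v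
      - omegaSt (V (y t)) (y' t) * fderiv ℝ E (y t) v
      = - (Z' (E (y t)) * fderiv ℝ E (y t) v) := fun t v => by
    obtain ⟨w, rfl⟩ := hWsurj (X t) v
    have h := hpull (X t) (X' t) w
    rw [hXω t w] at h
    simpa [smul_eq_mul] using h
  have hEp : ∀ t, 0 < E (y t) + fderiv ℝ E (y t) (V (y t)) := fun t =>
    add_pos_of_pos_of_nonneg (hEpos _) (hp _)
  have hdE0 : ∀ t, fderiv ℝ E (y t) (y' t) = 0 := fun t => by
    have h1 := hmain t (y' t)
    have h2 := hmain t (V (y t))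
    rw [hself] at h1 h2
    rcases mul_eq_zero.1 (by linear_combination h1 :
      Z' (E (y t)) * fderiv ℝ E (y t) (y' t) = 0) with hz | hz
    · rw [hz] at h2
      rw [omegaSt_antisymm (y' t) (V (y t))] at h2
      have h3 : omegaSt (V (y t)) (y' t) = 0 :=
        (mul_eq_zero.1 (by linear_combination -h2 :
          (E (y t) + fderiv ℝ E (y t) (V (y t))) * omegaSt (V (y t)) (y' t) = 0)).resolve_left
          (hEp t).ne'
      have h4 : E (y t) • y' t + fderiv ℝ E (y t) (y' t) • V (y t) = 0 :=
        eq_zero_of_omegaSt_eq_zero fun v => by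
          have h := hmain t v
          rw [hz, h3] at h
          simp only [← omegaL_apply] at h ⊢
          simp only [map_add, map_smul, add_apply, smul_apply, smul_eq_mul]
          linear_combination h
      have h5 := congrArg (fderiv ℝ E (y t)) h4
      simp only [map_add, map_smul, smul_eq_mul, map_zero] at h5
      exact (mul_eq_zero.1 (by linear_combination h5 :
          (E (y t) + fderiv ℝ E (y t) (V (y t))) * fderiv ℝ E (y t) (y' t) = 0)).resolve_left
          (hEp t).ne'
    · exact hz
  have hEc : ∀ t, E (y t) = E (y t₀) := fun t =>
    is_const_of_deriv_eq_zero (f := E ∘ y)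
      (fun t => ((hEd _).comp_hasDerivAt t (hyd t)).differentiableAt)
      (fun t => by rw [((hEd _).comp_hasDerivAt t (hyd t)).deriv, hdE0]) t t₀
  refine ⟨y, y', E (y t₀), hyd, fun t => congrArg ψ (hper t), hEc, fun h => ht₀ ?_,
    ⟨t₀, fun h => ht₀ ?_⟩, fun t v => ?_⟩
  · rw [hy] at h
    simp only at h
    rw [h, zero_smul]
  · rw [hy] at h
    simp only at h
    rw [h]; simp
  · rw [← hEc t]
    have h1 := hmain t (V (y t))
    have h2 := hmain t v
    rw [hdE0, hself] at h1
    rw [hdE0] at h2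
    rw [omegaSt_antisymm (y' t) (V (y t))] at h1
    have hE0 := (hEpos (y t)).ne'
    refine mul_left_cancel₀ hE0 ?_
    linear_combination (E (y t) + fderiv ℝ E (y t) (V (y t))) * h2 - fderiv ℝ E (y t) v * h1

end ConformalOrbit

section Profiles

lemma abs_radialSlope_le {A a κ : ℝ} (hA : 0 ≤ A) (hκ : 0 < κ) (s : ℝ) :
    |radialSlope A a κ s| ≤ A := by
  have h1 : 0 ≤ max (s - a) 0 - max (s - a - κ) 0 := by
    rcases max_cases (s - a) 0 with ⟨h1, h2⟩ | ⟨h1, h2⟩ <;>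
    rcases max_cases (s - a - κ) 0 with ⟨h3, h4⟩ | ⟨h3, h4⟩ <;> rw [h1, h3] <;> linarith
  have h2 : max (s - a) 0 - max (s - a - κ) 0 ≤ κ := by
    rcases max_cases (s - a) 0 with ⟨h1, h2⟩ | ⟨h1, h2⟩ <;>
    rcases max_cases (s - a - κ) 0 with ⟨h3, h4⟩ | ⟨h3, h4⟩ <;> rw [h1, h3] <;> linarith
  have hAκ : 0 ≤ A / κ := div_nonneg hA hκ.le
  rw [radialSlope, abs_of_nonneg (mul_nonneg hAκ h1)]
  calc A / κ * (max (s - a) 0 - max (s - a - κ) 0) ≤ A / κ * κ :=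
        mul_le_mul_of_nonneg_left h2 hAκ
    _ = A := by field_simp

/-- A C¹ function which vanishes near `e₀`, takes the value `m` at `1`, and has slope at most `μ`,
provided `m < μ |1 - e₀|`. -/
lemma exists_slope_bounded_profile {e₀ m μ : ℝ} (hm : 0 < m) (hμ : 0 < μ)
    (h : m < μ * |1 - e₀|) :
    ∃ Z Z' : ℝ → ℝ, (∀ e, HasDerivAt Z (Z' e) e) ∧ Continuous Z' ∧ (∀ e, 0 ≤ Z e) ∧
      (∀ᶠ e in nhds e₀, Z e = 0) ∧ Z 1 = m ∧ ∀ e, |Z' e| ≤ μ := by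
  obtain ⟨s, hs, hsD⟩ : ∃ s : ℝ, |s| = 1 ∧ s * (1 - e₀) = |1 - e₀| := by
    rcases le_total 0 (1 - e₀) with h0 | h0
    · exact ⟨1, by simp, by rw [abs_of_nonneg h0, one_mul]⟩
    · exact ⟨-1, by simp, by rw [abs_of_nonpos h0]; ring⟩
  set D := |1 - e₀| with hD
  have hmμ : m / μ < D := (div_lt_iff₀' hμ).2 h
  have hmμ0 : 0 < m / μ := div_pos hm hμ
  set a := (D - m / μ) / 2 with ha
  have ha0 : 0 < a := by rw [ha]; linarith
  have hden : m / μ ≤ D - a - a / 2 := by rw [ha]; linarith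
  have hden0 : 0 < D - a - a / 2 := hmμ0.trans_le hden
  set A := m / (D - a - a / 2) with hA
  have hA0 : 0 ≤ A := by positivity
  have hAμ : A ≤ μ := by
    rw [hA, div_le_iff₀ hden0]
    calc m = μ * (m / μ) := by field_simp
      _ ≤ _ := mul_le_mul_of_nonneg_left hden hμ.le
  refine ⟨fun e => radialProfile A a a (s * (e - e₀)),
    fun e => radialSlope A a a (s * (e - e₀)) * s, fun e => ?_, ?_,
    fun e => radialProfile_nonneg hA0 ha0 _, ?_, ?_, fun e => ?_⟩
  · have := (hasDerivAt_radialProfile (A := A) (a := a) ha0 (s * (e - e₀))).comp e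
      (((hasDerivAt_id e).sub_const e₀).const_mul s)
    rw [mul_one] at this
    exact this
  · exact ((continuous_radialSlope A a a).comp (by fun_prop)).mul continuous_const
  · have : Filter.Tendsto (fun e => s * (e - e₀)) (nhds e₀) (nhds 0) := by
      have h : Continuous fun e => s * (e - e₀) := by fun_prop
      simpa using h.tendsto e₀
    filter_upwards [this.eventually (gt_mem_nhds ha0)] with e he
    exact radialProfile_of_le ha0 he.le
  · simp only [hsD]
    have h1 : 0 ≤ D - a - a := by rw [ha]; linarith
    rw [radialProfile, max_eq_left (by linarith), max_eq_left h1,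
      show (D - a) ^ 2 - (D - a - a) ^ 2 = 2 * a * (D - a - a / 2) by ring, hA]
    have := hden0.ne'
    generalize D - a - a / 2 = X at this
    field_simp
  · rw [abs_mul, hs, mul_one]
    exact (abs_radialSlope_le hA0 ha0 _).trans hAμ

/-- A nonzero compactly supported function can be scaled so that `1 + c G` is positive and deviates
from `1` by more than a prescribed amount less than one. -/
lemma exists_positive_factor {G : R4 → ℝ} (hG : Continuous G) {ρ q : ℝ} (hρ : 0 < ρ)
    (hsupp : ∀ x, ρ ≤ ‖x‖ → G x = 0) (hne : ∃ x, G x ≠ 0) (hq : 0 < q) (hq1 : q < 1) :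
    ∃ c > 0, (∀ x, 0 < 1 + c * G x) ∧ ∃ y, q < |1 - (1 + c * G y)| := by
  obtain ⟨x₀, -, hx₀⟩ := (isCompact_closedBall (0 : R4) ρ).exists_isMinOn
    ⟨0, by simpa using hρ.le⟩ hG.continuousOn
  by_cases h0 : G x₀ < 0
  · have hmin : ∀ x, G x₀ ≤ G x := fun x => by
      rcases le_total ρ ‖x‖ with h | h
      · rw [hsupp x h]; exact h0.le
      · exact hx₀ (by simpa using h)
    have hc : 0 < (1 + q) / 2 / (- G x₀) := div_pos (by linarith) (by linarith)
    have hv : (1 + q) / 2 / (- G x₀) * G x₀ = - ((1 + q) / 2) := by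
      field_simp [h0.ne]
    refine ⟨_, hc, fun x => ?_, x₀, ?_⟩
    · have := mul_le_mul_of_nonneg_left (hmin x) hc.le
      rw [hv] at this
      linarith
    · rw [hv, abs_of_nonneg (by linarith)]; linarith
  · have hpos : ∀ x, 0 ≤ G x := fun x => by
      rcases le_total ρ ‖x‖ with h | h
      · exact (hsupp x h).ge
      · exact (not_lt.1 h0).trans (hx₀ (by simpa using h))
    obtain ⟨y, hy⟩ := hne
    have hy : 0 < G y := (hpos y).lt_of_ne' hy
    refine ⟨(1 + q) / G y, by positivity, fun x => ?_, y, ?_⟩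
    · have := hpos x
      positivity
    · rw [div_mul_cancel₀ _ hy.ne', abs_of_nonpos (by linarith)]; linarith

end Profiles

section Reparametrization

lemma periodic_of_return {F : R4 → R4} {K : NNReal} (hF : LipschitzWith K F) {γ : ℝ → R4}
    (hγ : ∀ t, HasDerivAt γ (F (γ t)) t) {T : ℝ} (hT : γ T = γ 0) (t : ℝ) :
    γ (t + T) = γ t := by
  have h := eq_of_solutions (f := fun _ => F) (fun _ => hF) (t₀ := 0)
    (γ₁ := fun t => γ (t + T)) (γ₂ := γ) (fun t => (hγ (t + T)).comp_add_const t T) hγ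
    (by simpa using hT)
  exact congrFun h t

/-- A closed curve which is everywhere tangent to a vector field, moves with speed at most `μ`
relative to it in a constant direction, and moves somewhere, traces a periodic orbit of period at
most `μ`. -/
theorem exists_periodic_of_reparametrization {F : R4 → R4} {K : NNReal} (hF : LipschitzWith K F)
    {C : NNReal} (hC : ∀ x, ‖F x‖ ≤ C) {y : ℝ → R4} {a : ℝ → ℝ} {μ : ℝ} (ha : Continuous a)
    (haμ : ∀ t, |a t| ≤ μ) (hsign : (∀ t, 0 ≤ a t) ∨ ∀ t, a t ≤ 0)
    (hy : ∀ t, HasDerivAt y (a t • F (y t)) t) (hper : ∀ t, y (t + 1) = y t) {t₀ : ℝ}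
    (ht₀ : a t₀ ≠ 0) :
    ∃ (T : ℝ) (γ : ℝ → R4), 0 < T ∧ T ≤ μ ∧ (∀ t, HasDerivAt γ (F (γ t)) t) ∧
      (∀ t, γ (t + T) = γ t) ∧ γ 0 = y t₀ := by
  have hμ : 0 ≤ μ := (abs_nonneg _).trans (haμ 0)
  obtain ⟨γ, hγ0, hγ⟩ := exists_global_solution (f := fun _ => F) (fun _ => hF)
    (fun _ => continuous_const) (fun _ => hC) 0 (y t₀)
  set τ : ℝ → ℝ := fun t => ∫ s in t₀..t, a s with hτ
  have hτd : ∀ t, HasDerivAt τ (a t) t := fun t => ha.integral_hasStrictDerivAt t₀ t |>.hasDerivAt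
  have hτ0 : τ t₀ = 0 := intervalIntegral.integral_same
  have hL : ∀ t, LipschitzWith (μ.toNNReal * K) (fun x => a t • F x) := fun t =>
    LipschitzWith.of_dist_le_mul fun x z => by
      rw [dist_smul₀, NNReal.coe_mul, Real.coe_toNNReal _ hμ, mul_assoc]
      exact mul_le_mul (haμ t) (hF.dist_le_mul x z) dist_nonneg hμ
  have heq := eq_of_solutions (f := fun t x => a t • F x) hL (t₀ := t₀) hy
    (γ₂ := fun t => γ (τ t)) (fun t => (hγ (τ t)).scomp t (hτd t)) (by rw [hτ0, hγ0])
  have hret : γ (τ (t₀ + 1)) = γ 0 := by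
    rw [← congrFun heq (t₀ + 1), hper, hγ0]
  have hτμ : |τ (t₀ + 1)| ≤ μ := by
    have := intervalIntegral.norm_integral_le_of_norm_le_const (a := t₀) (b := t₀ + 1) (f := a)
      (C := μ) fun t _ => haμ t
    simpa using this
  have hτne : 0 < |τ (t₀ + 1)| := by
    refine abs_pos.2 ?_
    rcases hsign with h | h
    · exact (intervalIntegral.integral_pos (lt_add_one t₀) ha.continuousOn (fun t _ => h t)
        ⟨t₀, ⟨le_rfl, (lt_add_one t₀).le⟩, (h t₀).lt_of_ne' ht₀⟩).ne'
    · have := intervalIntegral.integral_pos (f := fun t => - a t) (lt_add_one t₀)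
        ha.neg.continuousOn
        (fun t _ => neg_nonneg.2 (h t))
        ⟨t₀, ⟨le_rfl, (lt_add_one t₀).le⟩, neg_pos.2 ((h t₀).lt_of_ne ht₀)⟩
      rw [intervalIntegral.integral_neg] at this
      exact (neg_pos.1 this).ne
  have hp := periodic_of_return hF hγ hret
  refine ⟨_, γ, hτne, hτμ, hγ, fun t => ?_, hγ0⟩
  rcases abs_choice (τ (t₀ + 1)) with h | h <;> rw [h]
  · exact hp t
  · have := hp (t + -τ (t₀ + 1))
    rw [neg_add_cancel_right] at this
    exact this.symm

/-- A period of an orbit of a Lipschitz vector field is bounded below in terms of the speed. -/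
lemma speed_le_of_periodic {F : R4 → R4} {K C : NNReal} (hF : LipschitzWith K F)
    (hC : ∀ x, ‖F x‖ ≤ C) {γ : ℝ → R4} (hγ : ∀ t, HasDerivAt γ (F (γ t)) t) {T : ℝ}
    (hT : 0 < T) (hret : γ T = γ 0) : ‖F (γ 0)‖ ≤ K * C * T := by
  have h1 : ∀ t, ‖γ t - γ 0‖ ≤ C * |t| := fun t => by
    simpa using Convex.norm_image_sub_le_of_norm_hasDerivWithin_le (f := γ)
      (s := Set.univ) (fun t _ => (hγ t).hasDerivWithinAt) (fun t _ => hC (γ t)) convex_univ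
      (Set.mem_univ 0) (Set.mem_univ t)
  have h2 := Convex.norm_image_sub_le_of_norm_hasDerivWithin_le (f := fun t => γ t - t • F (γ 0))
    (f' := fun t => F (γ t) - F (γ 0)) (s := Set.Icc 0 T) (C := K * (C * T))
    (fun t _ =>
      ((hγ t).sub (by simpa using (hasDerivAt_id t).smul_const (F (γ 0)))).hasDerivWithinAt)
    (fun t ht => by
      rw [← dist_eq_norm]
      refine (hF.dist_le_mul _ _).trans (mul_le_mul_of_nonneg_left ?_ K.2)
      rw [dist_eq_norm]
      refine (h1 t).trans (mul_le_mul_of_nonneg_left ?_ C.2)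
      rw [abs_of_nonneg ht.1]; exact ht.2)
    (convex_Icc 0 T) (x := 0) (y := T) ⟨le_rfl, hT.le⟩ ⟨hT.le, le_rfl⟩
  rw [hret] at h2
  simp only [zero_smul, sub_zero, sub_sub_cancel_left, norm_neg, norm_smul, Real.norm_eq_abs,
    abs_of_pos hT] at h2
  refine le_of_mul_le_mul_left (h2.trans_eq ?_) hT
  ring

end Reparametrization

section NearbyOrbits

set_option maxSynthPendingDepth 3

lemma isInvertible_omegaL : omegaL.IsInvertible :=
  isInvertible_of_forall_eq_zero fun u hu =>
    eq_zero_of_omegaSt_eq_zero fun v => by simpa using hu v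

lemma omegaSt_inverse_omegaL (L : R4 →L[ℝ] ℝ) (v : R4) : omegaSt (omegaL.inverse L) v = L v := by
  obtain ⟨e, he⟩ := isInvertible_omegaL
  rw [← omegaL_apply, ← he, ContinuousLinearMap.inverse_equiv]
  simp

lemma exists_contDiff_cutoff {S U : Set R4} (hS : IsCompact S) (hU : IsOpen U) (hSU : S ⊆ U) :
    ∃ (s : R4 → ℝ) (N K : Set R4), ContDiff ℝ ∞ s ∧ IsOpen N ∧ S ⊆ N ∧ N ⊆ K ∧ IsCompact K ∧
      K ⊆ U ∧ (∀ x ∈ N, s x = 1) ∧ (∀ x ∉ K, s x = 0) ∧ ∀ x, 0 ≤ s x := by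
  obtain ⟨K, hK, hSK, hKU⟩ := exists_compact_between hS hU hSU
  obtain ⟨s, hs1, hs0, hs⟩ := exists_contMDiffMap_one_nhds_of_subset_interior
    (modelWithCornersSelf ℝ R4) (n := (⊤ : ℕ∞)) hS.isClosed hSK
  obtain ⟨N, hN, hSN, hNs⟩ := mem_nhdsSet_iff_exists.1 hs1
  refine ⟨s, N, K, s.contMDiff.contDiff, hN, hSN, fun x hx => ?_, hK, hKU, hNs, hs0,
    fun x => (hs x).1⟩
  by_contra h
  have h1 : s x = 1 := hNs hx
  rw [hs0 x h] at h1
  exact zero_ne_one h1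

lemma contDiff_smul_of_cutoff {G : Type*} [NormedAddCommGroup G] [NormedSpace ℝ G]
    {s : R4 → ℝ} {f : R4 → G} {K U : Set R4} (hs : ContDiff ℝ ∞ s) (hK : IsClosed K)
    (hU : IsOpen U) (hKU : K ⊆ U) (hs0 : ∀ x ∉ K, s x = 0) (hf : ContDiffOn ℝ ∞ f U) :
    ContDiff ℝ ∞ fun x => s x • f x := by
  refine contDiff_iff_contDiffAt.2 fun x => ?_
  by_cases hx : x ∈ K
  · exact hs.contDiffAt.smul (hf.contDiffAt (hU.mem_nhds (hKU hx)))
  · refine contDiffAt_const (c := (0 : G)) |>.congr_of_eventuallyEq ?_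
    filter_upwards [hK.isOpen_compl.mem_nhds hx] with z hz
    rw [hs0 z hz, zero_smul]

/-- Near a level set `g = 0` which is transverse to a Liouville field within a ball of radius less
than one, there are periodic orbits of the Reeb direction of period at most `π` on levels of `g`
arbitrarily close to zero. -/
theorem exists_nearby_orbit {g : R4 → ℝ} (hg : ContDiff ℝ ∞ g) {s : R4 → ℝ}
    (hs : ContDiff ℝ ∞ s) {N K : Set R4} (hN : IsOpen N) (hK : IsCompact K)
    (hs1 : ∀ x ∈ N, s x = 1) (hs0 : ∀ x ∉ K, s x = 0) (hspos : ∀ x, 0 ≤ s x)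
    (hgK : ∀ x ∈ K, g x = 0 → x ∈ N) (hne : ∃ x ∈ K, g x = 0)
    {ρ₀ : ℝ} (hρ₀ : 0 < ρ₀) (hρ₁ : ρ₀ < 1) (hKρ : ∀ x ∈ K, ‖x‖ < ρ₀)
    {V : R4 → R4} (hV : ContDiff ℝ ∞ V) (hL : ∀ x ∈ K, ∀ u v,
      omegaSt (fderiv ℝ V x u) v + omegaSt u (fderiv ℝ V x v) = omegaSt u v)
    (hgV : ∀ x ∈ K, 0 < fderiv ℝ g x (V x))
    {F : R4 → R4} {κ C : NNReal} (hF : LipschitzWith κ F) (hFC : ∀ x, ‖F x‖ ≤ C)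
    (hFK : ∀ x ∈ K, F x = - (fderiv ℝ g x (V x))⁻¹ • omegaL.inverse (fderiv ℝ g x))
    {ε : ℝ} (hε : 0 < ε) :
    ∃ (T : ℝ) (γ : ℝ → R4), 0 < T ∧ T ≤ π ∧ (∀ t, HasDerivAt γ (F (γ t)) t) ∧
      (∀ t, γ (t + T) = γ t) ∧ γ 0 ∈ K ∧ |g (γ 0)| < ε := by
  obtain ⟨ε', hε', hεε', hsep⟩ : ∃ ε' > 0, ε' ≤ ε ∧ ∀ x ∈ K, |g x| < ε' → x ∈ N := by
    have hKN : IsCompact (K \ N) := hK.diff hN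
    rcases (K \ N).eq_empty_or_nonempty with h | h
    · exact ⟨ε, hε, le_rfl, fun x hx _ => Set.sdiff_eq_empty.1 h hx⟩
    · obtain ⟨x₁, hx₁, hmin⟩ := hKN.exists_isMinOn h (f := fun x => |g x|)
        hg.continuous.abs.continuousOn
      refine ⟨min ε |g x₁|, lt_min hε (abs_pos.2 fun h0 => hx₁.2 (hgK _ hx₁.1 h0)),
        min_le_left _ _, fun x hx hgx => by_contra fun hxN => ?_⟩
      exact absurd (hmin ⟨hx, hxN⟩) (not_le.2 (hgx.trans_le (min_le_right _ _)))
  obtain ⟨b, hb, hb1, hb0, hbpos⟩ : ∃ b : ℝ → ℝ, ContDiff ℝ ∞ b ∧ b 0 = 1 ∧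
      (∀ t, ε' ≤ |t| → b t = 0) ∧ ∀ t, 0 ≤ b t := by
    let B : ContDiffBump (0 : ℝ) := ⟨ε' / 2, ε', by positivity, by linarith⟩
    exact ⟨B, B.contDiff, B.one_of_mem_closedBall (by simp; positivity),
      fun t ht => B.zero_of_le_dist (by simpa using ht), fun t => B.nonneg⟩
  set w : R4 → ℝ := fun x => s x * b (g x) with hw
  have hwc : ContDiff ℝ ∞ w := hs.mul (hb.comp hg)
  have hwpos : ∀ x, 0 ≤ w x := fun x => mul_nonneg (hspos x) (hbpos _)
  have hwK : ∀ x ∉ K, w x = 0 := fun x hx => by simp only [hw, hs0 x hx, zero_mul]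
  have hwg : ∀ x, w x ≠ 0 → |g x| < ε' := fun x hx => by
    by_contra h
    exact hx (by simp only [hw, hb0 _ (not_lt.1 h), mul_zero])
  have hg1 : ContDiff ℝ ∞ (fderiv ℝ g) := hg.fderiv_right (by simp)
  set β : R4 → R4 →L[ℝ] ℝ := fun x => w x • fderiv ℝ g x with hβ
  have hβc : ContDiff ℝ ∞ β := hwc.smul hg1
  have hgd : ∀ x, HasFDerivAt g (fderiv ℝ g x) x := fun x =>
    (hg.differentiable (by simp) x).hasFDerivAt
  have hdw : ∀ x, HasFDerivAt w ((s x * deriv b (g x)) • fderiv ℝ g x) x := fun x => by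
    have h1 := (hs.differentiable (by simp) x).hasFDerivAt.mul
      ((hb.differentiable (by simp) (g x)).hasDerivAt.comp_hasFDerivAt x (hgd x))
    refine h1.congr_fderiv ?_
    have h2 : b (g x) • fderiv ℝ s x = 0 := by
      by_cases hgx : |g x| < ε'
      · have h3 : fderiv ℝ s x = 0 := by
          by_cases hx : x ∈ K
          · have : s =ᶠ[nhds x] fun _ => 1 := by
              filter_upwards [hN.mem_nhds (hsep x hx hgx)] with z hz using hs1 z hz
            rw [this.fderiv_eq]; simp
          · have : s =ᶠ[nhds x] fun _ => 0 := by
              filter_upwards [hK.isClosed.isOpen_compl.mem_nhds hx] with z hz using hs0 z hz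
            rw [this.fderiv_eq]; simp
        rw [h3, smul_zero]
      · rw [hb0 _ (not_lt.1 hgx), zero_smul]
    simp only [Function.comp_apply, h2, add_zero, smul_smul]
  have hβcl : ∀ x u v, fderiv ℝ β x u v = fderiv ℝ β x v u := fun x u v => by
    have h1 : HasFDerivAt β _ x :=
      (hdw x).smul ((hg1.differentiable (by simp) x).hasFDerivAt)
    have hsymm : IsSymmSndFDerivAt ℝ g x := hg.contDiffAt.isSymmSndFDerivAt (by
      rw [minSmoothness_of_isRCLikeNormedField]; norm_cast)
    rw [h1.fderiv]
    simp only [add_apply, smul_apply, smul_eq_mul, ContinuousLinearMap.smulRight_apply]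
    rw [hsymm.eq u v]
    ring
  have hβ0 : ∀ x, ρ₀ ≤ ‖x‖ → β x = 0 := fun x hx => by
    simp only [hβ, hwK x fun h => absurd (hKρ x h) (not_lt.2 hx), zero_smul]
  obtain ⟨G, hG, hG0⟩ := exists_compactly_supported_primitive (hβc.differentiable (by simp)) hβcl
    hρ₀.le hβ0
  have hGne : ∃ x, G x ≠ 0 := by
    by_contra! h
    obtain ⟨x₀, hx₀, hgx₀⟩ := hne
    have h1 : G = fun _ => 0 := funext h
    have h2 : β x₀ = 0 := (hG x₀).unique (by rw [h1]; exact hasFDerivAt_const 0 x₀)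
    have h3 : w x₀ = 1 := by
      simp only [hw, hs1 x₀ (hgK x₀ hx₀ hgx₀), hgx₀, hb1, mul_one]
    rw [hβ] at h2
    simp only [h3, one_smul] at h2
    have := hgV x₀ hx₀
    rw [h2] at this
    exact lt_irrefl _ this
  have hGc : Continuous G := continuous_iff_continuousAt.2 fun x => (hG x).continuousAt
  have hpi := pi_pos
  obtain ⟨ρ, hρ, hρ1⟩ := exists_between hρ₁
  obtain ⟨m, hm, hmπ⟩ := exists_between (show π * ρ ^ 2 < π by
    have : ρ ^ 2 < 1 := by nlinarith
    nlinarith)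
  obtain ⟨μ, hμ, hμπ⟩ := exists_between hmπ
  have hm0 : 0 < m := lt_of_le_of_lt (by positivity) hm
  have hμ0 : 0 < μ := hm0.trans hμ
  obtain ⟨c, hc, hEpos, y₀, hy₀⟩ := exists_positive_factor hGc hρ₀ hG0 hGne (div_pos hm0 hμ0)
    ((div_lt_one hμ0).2 hμ)
  obtain ⟨Z, Z', hZ, hZ'c, hZ0, hZy, hZ1, hZμ⟩ := exists_slope_bounded_profile hm0 hμ0
    ((div_lt_iff₀' hμ0).1 hy₀)
  set E : R4 → ℝ := fun x => 1 + c * G x with hE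
  have hEd : ∀ x, HasFDerivAt E (c • β x) x := fun x => ((hG x).const_mul c).const_add 1
  have hEf : ∀ x, fderiv ℝ E x = c • β x := fun x => (hEd x).fderiv
  have hEc : ContDiff ℝ 2 E := contDiff_two_of_hasFDerivAt hEd
    ((hβc.const_smul c).of_le (by exact_mod_cast le_top))
  have hEne : ∀ x, fderiv ℝ E x ≠ 0 → w x ≠ 0 := fun x hx h => hx (by
    rw [hEf, hβ]; simp only [h, zero_smul, smul_zero])
  have hEv : ∀ x v, fderiv ℝ E x v = c * (w x * fderiv ℝ g x v) := fun x v => by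
    rw [hEf, hβ]; simp [smul_eq_mul]
  have hpos : ∀ x, 0 ≤ fderiv ℝ E x (V x) := fun x => by
    rw [hEv]
    by_cases hx : x ∈ K
    · exact mul_nonneg hc.le (mul_nonneg (hwpos x) (hgV x hx).le)
    · rw [hwK x hx]; simp
  obtain ⟨y, y', e, hy, hper, hEe, hZe, ⟨t₀, ht₀⟩, hmain⟩ := exists_conformal_orbit hEc
    (hV.of_le (by exact_mod_cast le_top)) hEpos hρ₀ hρ
    (fun x hx => by simp only [hE, hG0 x hx, mul_zero, add_zero])
    (fun x hx => by rw [hEf, hβ0 x hx, smul_zero])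
    (fun x hx => hL x (by_contra fun h => hEne x hx (hwK x h)))
    hpos hZ hZ'c hZ0 hZy hZ1 hm
  have he : 0 < e := hEe 0 ▸ hEpos (y 0)
  have hyc : Continuous y := continuous_iff_continuousAt.2 fun t => (hy t).continuousAt
  set p : ℝ → ℝ := fun t => fderiv ℝ E (y t) (V (y t)) with hpdef
  have hp0 : ∀ t, 0 ≤ p t := fun t => hpos _
  have hpc : Continuous p := ((hEc.continuous_fderiv two_ne_zero).comp hyc).clm_apply
    (hV.continuous.comp hyc)
  have hep : ∀ t, 0 < e + p t := fun t => add_pos_of_pos_of_nonneg he (hp0 t)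
  have hfrac : ∀ t, 0 ≤ p t / (e + p t) := fun t => div_nonneg (hp0 t) (hep t).le
  have hfrac1 : ∀ t, p t / (e + p t) ≤ 1 := fun t => (div_le_one (hep t)).2 (by linarith)
  have hy0 : y t₀ ∈ K := by_contra fun h => hEne _ ht₀ (hwK _ h)
  have hyF : ∀ t, y' t = (Z' e * (p t / (e + p t))) • F (y t) := fun t => by
    rw [← sub_eq_zero]
    refine eq_zero_of_omegaSt_eq_zero fun v => ?_
    have h1 := hmain t v
    have h2 : omegaSt (y' t - (Z' e * (p t / (e + p t))) • F (y t)) v =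
        omegaSt (y' t) v - Z' e * (p t / (e + p t)) * omegaSt (F (y t)) v := by
      simp only [← omegaL_apply, map_sub, map_smul, sub_apply, smul_apply, smul_eq_mul]
    rw [h2, sub_eq_zero]
    refine mul_left_cancel₀ (hep t).ne' ?_
    have h3 : (e + p t) * (Z' e * (p t / (e + p t)) * omegaSt (F (y t)) v) =
        Z' e * p t * omegaSt (F (y t)) v := by
      have := (hep t).ne'
      field_simp
    rw [h3]
    refine h1.trans ?_
    by_cases hx : y t ∈ K
    · have h4 : omegaSt (F (y t)) v = - ((fderiv ℝ g (y t) (V (y t)))⁻¹ * fderiv ℝ g (y t) v) := by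
        rw [hFK _ hx, ← omegaSt_inverse_omegaL (fderiv ℝ g (y t)) v]
        simp only [← omegaL_apply, map_smul, map_neg, neg_apply, smul_apply, smul_eq_mul, neg_smul]
      have h5 := (hgV _ hx).ne'
      rw [h4, hpdef]
      simp only [hEv]
      field_simp
    · rw [hpdef]
      simp [hEv, hwK _ hx]
  obtain ⟨T, γ, hT, hTμ, hγ, hγT, hγ0⟩ := exists_periodic_of_reparametrization hF hFC
    (y := y) (a := fun t => Z' e * (p t / (e + p t))) (μ := μ) (t₀ := t₀)
    (continuous_const.mul (hpc.div (continuous_const.add hpc) fun t => (hep t).ne'))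
    (fun t => by
      rw [abs_mul, abs_of_nonneg (hfrac t)]
      calc _ ≤ μ * 1 := mul_le_mul (hZμ e) (hfrac1 t) (hfrac t) hμ0.le
        _ = μ := mul_one μ)
    (by
      rcases le_total 0 (Z' e) with h | h
      · exact Or.inl fun t => mul_nonneg h (hfrac t)
      · exact Or.inr fun t => mul_nonpos_of_nonpos_of_nonneg h (hfrac t))
    (fun t => hyF t ▸ hy t) hper
    (mul_ne_zero hZe (div_pos (by
      rw [hpdef]
      simp only [hEv]
      exact mul_pos hc (mul_pos ((hwpos _).lt_of_ne' (hEne _ ht₀)) (hgV _ hy0))) (hep t₀)).ne')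
  exact ⟨T, γ, hT, hTμ.trans hμπ.le, hγ, hγT, hγ0 ▸ hy0,
    hγ0 ▸ (hwg _ (hEne _ ht₀)).trans_le hεε'⟩

end NearbyOrbits

section LimitOrbit

set_option maxSynthPendingDepth 3

/-- The periodic orbits on nearby levels accumulate on an orbit on the zero level. -/
theorem exists_orbit_on_zero_level {g : R4 → ℝ} (hg : ContDiff ℝ ∞ g) {s : R4 → ℝ}
    (hs : ContDiff ℝ ∞ s) {N K : Set R4} (hN : IsOpen N) (hK : IsCompact K)
    (hs1 : ∀ x ∈ N, s x = 1) (hs0 : ∀ x ∉ K, s x = 0) (hspos : ∀ x, 0 ≤ s x)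
    (hgK : ∀ x ∈ K, g x = 0 → x ∈ N) (hne : ∃ x ∈ K, g x = 0)
    {ρ₀ : ℝ} (hρ₀ : 0 < ρ₀) (hρ₁ : ρ₀ < 1) (hKρ : ∀ x ∈ K, ‖x‖ < ρ₀)
    {V : R4 → R4} (hV : ContDiff ℝ ∞ V) (hL : ∀ x ∈ K, ∀ u v,
      omegaSt (fderiv ℝ V x u) v + omegaSt u (fderiv ℝ V x v) = omegaSt u v)
    (hgV : ∀ x ∈ K, 0 < fderiv ℝ g x (V x))
    {F : R4 → R4} {κ C : NNReal} (hF : LipschitzWith κ F) (hFC : ∀ x, ‖F x‖ ≤ C)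
    (hFK : ∀ x ∈ K, F x = - (fderiv ℝ g x (V x))⁻¹ • omegaL.inverse (fderiv ℝ g x)) :
    ∃ (T : ℝ) (γ : ℝ → R4), 0 < T ∧ T ≤ π ∧ (∀ t, HasDerivAt γ (F (γ t)) t) ∧
      (∀ t, γ (t + T) = γ t) ∧ γ 0 ∈ K ∧ g (γ 0) = 0 := by
  have hnear := fun (ε : ℝ) (hε : 0 < ε) => exists_nearby_orbit hg hs hN hK hs1 hs0 hspos hgK hne
    hρ₀ hρ₁ hKρ hV hL hgV hF hFC hFK hε
  have hF0 : ∀ x ∈ K, F x ≠ 0 := fun x hx h => by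
    have h1 : omegaSt (F x) (V x) = -1 := by
      rw [hFK x hx, ← omegaL_apply, map_smul, smul_apply, omegaL_apply, omegaSt_inverse_omegaL,
        smul_eq_mul, neg_mul, inv_mul_cancel₀ (hgV x hx).ne']
    rw [h] at h1
    simp [omegaSt] at h1
  obtain ⟨x₀, hx₀, -⟩ := hne
  obtain ⟨x₁, hx₁, hmin⟩ := hK.exists_isMinOn ⟨x₀, hx₀⟩ hF.continuous.norm.continuousOn
  have hr : 0 < ‖F x₁‖ := norm_pos_iff.2 (hF0 x₁ hx₁)
  have hlow : ∀ (T : ℝ) (γ : ℝ → R4), 0 < T → (∀ t, HasDerivAt γ (F (γ t)) t) → γ T = γ 0 →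
      γ 0 ∈ K → ‖F x₁‖ ≤ κ * C * T := fun T γ hT hγ hret h0 =>
    (hmin h0).trans (speed_le_of_periodic hF hFC hγ hT hret)
  obtain ⟨T₁, γ₁, hT₁, -, hγ₁, hper₁, hK₁, -⟩ := hnear 1 one_pos
  have hκC : 0 < (κ : ℝ) * C := by
    have h1 := hlow T₁ γ₁ hT₁ hγ₁ (by simpa using hper₁ 0) hK₁
    by_contra h
    have h2 : (κ : ℝ) * C * T₁ ≤ 0 := mul_nonpos_of_nonpos_of_nonneg (not_lt.1 h) hT₁.le
    linarith
  have hδ : 0 < ‖F x₁‖ / (κ * C) := div_pos hr hκC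
  set δ := ‖F x₁‖ / (κ * C) with hδdef
  choose φ hφ0 hφ using fun x => exists_global_solution (f := fun _ => F) (fun _ => hF)
    (fun _ => continuous_const) (fun _ => hFC) 0 x
  have hφc : ContinuousOn (fun q : ℝ × R4 => φ q.2 q.1) (Set.Icc 0 π ×ˢ Set.univ) := by
    refine continuousOn_prod_of_continuousOn_lipschitzOnWith' _ (Real.toNNReal (exp (κ * π)))
      (fun t ht => LipschitzOnWith.of_dist_le_mul fun x _ z _ => ?_)
      fun x _ t _ => (hφ x t).continuousAt.continuousWithinAt
    have h1 := dist_solutions_le (f := fun _ => F) (fun _ => hF) (hφ x) (hφ z) ht.1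
    rw [hφ0, hφ0] at h1
    refine h1.trans ?_
    rw [Real.coe_toNNReal _ (exp_pos _).le, mul_comm]
    exact mul_le_mul_of_nonneg_right (exp_le_exp.2 (mul_le_mul_of_nonneg_left ht.2 κ.2)) dist_nonneg
  have hsub : Set.Icc δ π ×ˢ K ⊆ Set.Icc 0 π ×ˢ Set.univ :=
    Set.prod_mono (Set.Icc_subset_Icc_left hδ.le) (Set.subset_univ _)
  have hScpt : IsCompact {q ∈ Set.Icc δ π ×ˢ K | φ q.2 q.1 - q.2 = 0} := by
    have hc : IsCompact (Set.Icc δ π ×ˢ K) := isCompact_Icc.prod hK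
    exact hc.of_isClosed_subset
      (((hφc.mono hsub).sub continuous_snd.continuousOn).preimage_isClosed_of_isClosed hc.isClosed
        isClosed_singleton) fun q hq => hq.1
  have hS : ∀ ε : ℝ, 0 < ε → ∃ q ∈ {q ∈ Set.Icc δ π ×ˢ K | φ q.2 q.1 - q.2 = 0}, |g q.2| < ε := by
    intro ε hε
    obtain ⟨T, γ, hT, hTπ, hγ, hper, hγK, hgγ⟩ := hnear ε hε
    have hret : γ T = γ 0 := by simpa using hper 0
    have hγφ : φ (γ 0) = γ :=
      eq_of_solutions (f := fun _ => F) (t₀ := 0) (fun _ => hF) (hφ _) hγ (hφ0 _)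
    refine ⟨(T, γ 0), ⟨⟨⟨?_, hTπ⟩, hγK⟩, ?_⟩, hgγ⟩
    · rw [hδdef, div_le_iff₀' hκC]
      exact hlow T γ hT hγ hret hγK
    · simp only [hγφ, hret, sub_self]
  obtain ⟨q₀, hq₀, -⟩ := hS 1 one_pos
  obtain ⟨q, hq, hqmin⟩ := hScpt.exists_isMinOn ⟨q₀, hq₀⟩
    (f := fun q : ℝ × R4 => |g q.2|) (hg.continuous.comp continuous_snd).abs.continuousOn
  have hgq : g q.2 = 0 := by
    by_contra h
    obtain ⟨q', hq', hlt⟩ := hS _ (abs_pos.2 h)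
    exact absurd (hqmin hq') (not_le.2 hlt)
  refine ⟨q.1, φ q.2, hδ.trans_le hq.1.1.1, hq.1.1.2, hφ q.2,
    periodic_of_return hF (hφ q.2) ((sub_eq_zero.1 hq.2).trans (hφ0 _).symm), ?_, ?_⟩
  · rw [hφ0]; exact hq.1.2
  · rw [hφ0]; exact hgq

end LimitOrbit

section ReebOrbit

set_option maxSynthPendingDepth 3

lemma contDiff_of_autonomous {F : R4 → R4} (hF : ContDiff ℝ ∞ F) {γ : ℝ → R4}
    (hγ : ∀ t, HasDerivAt γ (F (γ t)) t) : ContDiff ℝ ∞ γ := by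
  refine contDiff_infty.2 fun n => ?_
  induction n with
  | zero => exact contDiff_zero.2 (continuous_iff_continuousAt.2 fun t => (hγ t).continuousAt)
  | succ n ih =>
    push_cast
    refine contDiff_succ_iff_deriv.2 ⟨fun t => (hγ t).differentiableAt, by simp, ?_⟩
    rw [funext fun t => (hγ t).deriv]
    exact (hF.of_le (by exact_mod_cast le_top)).comp ih

theorem exists_short_reeb_orbit_of_outward {g : R4 → ℝ} (hg : ContDiff ℝ ∞ g)
    {M : Set R4} (hM : M = g ⁻¹' {0}) (hMcpt : IsCompact M) (hMball : M ⊆ Metric.ball (0 : R4) 1)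
    {U : Set R4} (hU : IsOpen U) (hMU : M ⊆ U)
    {Y : R4 → R4} (hY : ContDiffOn ℝ ∞ Y U)
    (hLiou : ∀ x ∈ U, ∀ u v : R4,
      omegaSt (fderiv ℝ Y x u) v + omegaSt u (fderiv ℝ Y x v) = omegaSt u v)
    (htrans : ∀ x ∈ M, fderiv ℝ g x (Y x) ≠ 0) (hpos : ∃ x ∈ M, 0 < fderiv ℝ g x (Y x)) :
    ∃ (T : ℝ) (γ : ℝ → R4), 0 < T ∧ T ≤ π ∧ ContDiff ℝ ∞ γ ∧ (∃ t s, γ t ≠ γ s) ∧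
      (∀ t, γ t ∈ M) ∧ (∀ t, γ (t + T) = γ t) ∧
      (∀ t, fderiv ℝ g (γ t) (deriv γ t) = 0) ∧
      (∀ t, ∀ v : R4, fderiv ℝ g (γ t) v = 0 → omegaSt (deriv γ t) v = 0) ∧
      (∀ t, omegaSt (Y (γ t)) (deriv γ t) = 1) := by
  obtain ⟨x₀, hx₀, hgx₀⟩ := hpos
  have hgM : ∀ x, x ∈ M ↔ g x = 0 := fun x => by rw [hM]; simp
  obtain ⟨ρ₀, hρ₀, hρ₁, hMρ⟩ : ∃ ρ₀ : ℝ, 0 < ρ₀ ∧ ρ₀ < 1 ∧ ∀ x ∈ M, ‖x‖ < ρ₀ := by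
    obtain ⟨x₁, hx₁, hmax⟩ := hMcpt.exists_isMaxOn ⟨x₀, hx₀⟩ continuous_norm.continuousOn
    have h1 : ‖x₁‖ < 1 := by simpa using hMball hx₁
    obtain ⟨ρ₀, h, h'⟩ := exists_between h1
    exact ⟨ρ₀, (norm_nonneg _).trans_lt h, h', fun x hx => (hmax hx).trans_lt h⟩
  have hg1 : ContDiff ℝ ∞ (fderiv ℝ g) := hg.fderiv_right (by simp)
  have hgY : ContDiffOn ℝ ∞ (fun x => fderiv ℝ g x (Y x)) U := hg1.contDiffOn.clm_apply hY
  set U₁ : Set R4 := (U ∩ (fun x => fderiv ℝ g x (Y x)) ⁻¹' Set.Ioi 0) ∩ Metric.ball 0 ρ₀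
  have hU₁ : IsOpen U₁ :=
    (hgY.continuousOn.isOpen_inter_preimage hU isOpen_Ioi).inter Metric.isOpen_ball
  have hU₁U : U₁ ⊆ U := fun x hx => hx.1.1
  have hU₁pos : ∀ x ∈ U₁, 0 < fderiv ℝ g x (Y x) := fun x hx => hx.1.2
  have hMcl : IsClosed (M ∩ U₁) := by
    have h1 : M ∩ U₁ = M ∩ (fun x => fderiv ℝ g x (Y x)) ⁻¹' Set.Ici 0 := by
      ext x
      exact ⟨fun hx => ⟨hx.1, (hU₁pos x hx.2).le⟩, fun hx => ⟨hx.1, ⟨hMU hx.1,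
        lt_of_le_of_ne hx.2 (htrans x hx.1).symm⟩, by simpa using hMρ x hx.1⟩⟩
    rw [h1]
    exact (hgY.continuousOn.mono hMU).preimage_isClosed_of_isClosed hMcpt.isClosed isClosed_Ici
  have hx₀U : x₀ ∈ U₁ := ⟨⟨hMU hx₀, hgx₀⟩, by simpa using hMρ x₀ hx₀⟩
  obtain ⟨s, N, K, hs, hN, hMN, hNK, hK, hKU, hs1, hs0, hspos⟩ := exists_contDiff_cutoff
    (hMcpt.of_isClosed_subset hMcl Set.inter_subset_left) hU₁ Set.inter_subset_right
  obtain ⟨χ, N', K', hχ, hN', hKN', -, hK', hKU', hχ1, hχ0, -⟩ := exists_contDiff_cutoff hK hU₁ hKU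
  set X : R4 → R4 := fun x => omegaL.inverse (fderiv ℝ g x) with hX
  have hXc : ContDiff ℝ ∞ X := (ContinuousLinearMap.contDiff _).comp hg1
  have hV : ContDiff ℝ ∞ fun x => χ x • Y x :=
    contDiff_smul_of_cutoff hχ hK'.isClosed hU₁ hKU' hχ0 (hY.mono hU₁U)
  set F : R4 → R4 := fun x => χ x • (-(fderiv ℝ g x (Y x))⁻¹ • X x) with hF
  have hFc : ContDiff ℝ ∞ F := contDiff_smul_of_cutoff hχ hK'.isClosed hU₁ hKU' hχ0
    ((((hgY.mono hU₁U).inv fun x hx => (hU₁pos x hx).ne').neg).smul hXc.contDiffOn)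
  have hFs : HasCompactSupport F :=
    HasCompactSupport.intro hK' fun x hx => by simp only [hF, hχ0 x hx, zero_smul]
  obtain ⟨κ, hκ⟩ := hFc.lipschitzWith_of_hasCompactSupport hFs (by simp)
  obtain ⟨C, hC⟩ := hFs.exists_bound_of_continuous hFc.continuous
  have hVY : ∀ x ∈ K, (fun x => χ x • Y x) =ᶠ[nhds x] Y := fun x hx => by
    filter_upwards [hN'.mem_nhds (hKN' hx)] with z hz
    rw [hχ1 z hz, one_smul]
  have hKM : ∀ x ∈ K, g x = 0 → x ∈ N := fun x hx h => hMN ⟨(hgM x).2 h, hKU hx⟩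
  obtain ⟨T, γ, hT, hTπ, hγ, hper, hγK, hγg⟩ := exists_orbit_on_zero_level hg hs hN hK hs1 hs0 hspos
    hKM ⟨x₀, hNK (hMN ⟨hx₀, hx₀U⟩), (hgM x₀).1 hx₀⟩ hρ₀ hρ₁ (fun x hx => by simpa using (hKU hx).2)
    hV (fun x hx => by rw [(hVY x hx).fderiv_eq]; exact hLiou x (hU₁U (hKU hx)))
    (fun x hx => by rw [(hVY x hx).eq_of_nhds]; exact hU₁pos x (hKU hx)) hκ (C := C.toNNReal)
    (fun x => (hC x).trans (Real.le_coe_toNNReal C))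
    (fun x hx => by simp only [hF, hX, hχ1 x (hKN' hx), one_smul])
  have hdg : ∀ x, fderiv ℝ g x (F x) = 0 := fun x => by
    have h1 : fderiv ℝ g x (X x) = 0 := by
      rw [← omegaSt_inverse_omegaL (fderiv ℝ g x) (X x)]
      have := omegaSt_antisymm (X x) (X x)
      simp only [hX] at this ⊢
      linarith
    simp only [hF, map_smul, h1, smul_zero]
  have hγM : ∀ t, γ t ∈ M := fun t => by
    have hd : ∀ t, HasDerivAt (g ∘ γ) 0 t := fun t => by
      have := ((hg.differentiable (by simp) (γ t)).hasFDerivAt).comp_hasDerivAt t (hγ t)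
      rwa [hdg] at this
    rw [hgM, ← hγg]
    exact is_const_of_deriv_eq_zero (fun t => (hd t).differentiableAt) (fun t => (hd t).deriv) t 0
  have hγc : Continuous γ := continuous_iff_continuousAt.2 fun t => (hγ t).continuousAt
  have hγU : ∀ t, γ t ∈ U₁ := by
    have h1 : γ ⁻¹' (M ∩ U₁) = γ ⁻¹' U₁ := by
      ext t
      exact ⟨fun h => h.2, fun h => ⟨hγM t, h⟩⟩
    have h2 : IsClopen (γ ⁻¹' U₁) := ⟨h1 ▸ hMcl.preimage hγc, hU₁.preimage hγc⟩
    exact Set.eq_univ_iff_forall.1 (h2.eq_univ ⟨0, hKU hγK⟩)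
  have hdγ : ∀ t, deriv γ t = -(fderiv ℝ g (γ t) (Y (γ t)))⁻¹ • X (γ t) := fun t => by
    rw [(hγ t).deriv, hF]
    simp only [hχ1 _ (hKN' (hNK (hMN ⟨hγM t, hγU t⟩))), one_smul]
  have hω : ∀ t v, omegaSt (deriv γ t) v =
      -(fderiv ℝ g (γ t) (Y (γ t)))⁻¹ * fderiv ℝ g (γ t) v := fun t v => by
    rw [hdγ, ← omegaL_apply, map_smul, smul_apply, omegaL_apply, omegaSt_inverse_omegaL,
      smul_eq_mul]
  have hωY : ∀ t, omegaSt (Y (γ t)) (deriv γ t) = 1 := fun t => by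
    rw [omegaSt_antisymm, hω, neg_mul, neg_neg, inv_mul_cancel₀ (hU₁pos _ (hγU t)).ne']
  refine ⟨T, γ, hT, hTπ, contDiff_of_autonomous hFc hγ, ?_, hγM, hper, fun t => ?_,
    fun t v hv => by rw [hω, hv, mul_zero], hωY⟩
  · by_contra! h
    have h1 : deriv γ 0 = 0 := by rw [funext fun t => h t 0, deriv_const]
    have h2 := hωY 0
    rw [h1, ← omegaL_apply, map_zero] at h2
    exact zero_ne_one h2
  · rw [(hγ t).deriv, hdg]

end ReebOrbit

/-- Upper-bound half of c(B⁴) = π: a compact contact-type hypersurface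
M = g⁻¹(0) contained in the open unit ball carries a closed Reeb orbit of the
induced contact form α = (ι_Y ω_st)|TM of period at most π. -/
theorem contact_type_in_ball_short_reeb_orbit
    (g : R4 → ℝ) (hg : ContDiff ℝ ∞ g)
    (M : Set R4) (hM : M = g ⁻¹' {0})
    (hMne : M.Nonempty) (hMcpt : IsCompact M)
    (hMball : M ⊆ Metric.ball (0 : R4) 1)
    (hreg : ∀ x ∈ M, fderiv ℝ g x ≠ 0)
    (U : Set R4) (hU : IsOpen U) (hMU : M ⊆ U)
    (Y : R4 → R4) (hY : ContDiffOn ℝ ∞ Y U)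
    (hLiou : ∀ x ∈ U, ∀ u v : R4,
      omegaSt (fderiv ℝ Y x u) v + omegaSt u (fderiv ℝ Y x v) = omegaSt u v)
    (htrans : ∀ x ∈ M, fderiv ℝ g x (Y x) ≠ 0) :
    ∃ (T : ℝ) (γ : ℝ → R4), 0 < T ∧ T ≤ π ∧ ContDiff ℝ ∞ γ ∧ (∃ t s, γ t ≠ γ s) ∧
      (∀ t, γ t ∈ M) ∧ (∀ t, γ (t + T) = γ t) ∧
      -- γ′(t) is tangent to M:
      (∀ t, fderiv ℝ g (γ t) (deriv γ t) = 0) ∧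
      -- γ′(t) lies in the kernel of ω_st restricted to T_{γ(t)}M:
      (∀ t, ∀ v : R4, fderiv ℝ g (γ t) v = 0 → omegaSt (deriv γ t) v = 0) ∧
      -- normalisation α(γ′) = ω_st(Y, γ′) = 1:
      (∀ t, omegaSt (Y (γ t)) (deriv γ t) = 1) := by
  obtain ⟨x₀, hx₀⟩ := hMne
  rcases (htrans x₀ hx₀).lt_or_gt with h | h
  · have hneg : ∀ x, fderiv ℝ (fun x => -g x) x = -fderiv ℝ g x := fun x => fderiv_fun_neg
    have hM' : M = (fun x => -g x) ⁻¹' {0} := by rw [hM]; ext x; simp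
    have key := exists_short_reeb_orbit_of_outward (g := fun x => -g x) hg.neg hM' hMcpt hMball
      hU hMU hY hLiou
      (fun x hx => by rw [hneg, neg_apply]; exact neg_ne_zero.2 (htrans x hx))
      ⟨x₀, hx₀, by rw [hneg, neg_apply]; exact neg_pos.2 h⟩
    simpa only [hneg, neg_apply, neg_eq_zero] using key
  · exact exists_short_reeb_orbit_of_outward hg hM hMcpt hMball hU hMU hY hLiou htrans
      ⟨x₀, hx₀, h⟩
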